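/- arXiv:1710.04757 — 3 statements merged into one kernel-verified Lean document; each statement's English description precedes it below -/
import Mathlib

section
/- A complete multipartite graph K with n > 1 vertices and m edges can be decomposed into edge-disjoint Hamilton paths if and only if (n−1) divides m and the maximum degree of K is at most 2m/(n−1). -/
open SimpleGraph

/-- A decomposition of `G` into `t` edge-disjoint Hamilton paths: a family of `t`
Hamiltonian paths of `G` such that every edge of `G` lies on exactly one of them. -/
def SimpleGraph.HamiltonianPathDecomposition {V : Type*} [DecidableEq V] (G : SimpleGraph V) (t : ℕ) : Prop :=
  ∃ (u v : Fin t → V) (p : ∀ i, G.Walk (u i) (v i)),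
    (∀ i, (p i).IsHamiltonian) ∧
    (∀ e ∈ G.edgeSet, ∃! i, e ∈ (p i).edges)


/-- The union of two partial matchings (given as involutions) is 2-colourable. -/
lemma two_matchings {α : Type*} [DecidableEq α] (n : ℕ) : ∀ (E : Finset α) (f g : α → α),
    E.card ≤ n →
    (∀ x ∈ E, f x ∈ E ∧ f (f x) = x) → (∀ x ∈ E, g x ∈ E ∧ g (g x) = x) →
    ∃ s : α → Bool, ∀ x ∈ E, (f x ≠ x → s (f x) ≠ s x) ∧ (g x ≠ x → s (g x) ≠ s x) := by
  induction n with
  | zero =>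
    intro E f g hE _ _
    have : E = ∅ := by simpa using hE
    subst this
    exact ⟨fun _ => true, by simp⟩
  | succ n ih =>
    intro E
    have key : ∀ (f g : α → α), E.card ≤ n + 1 →
        (∀ x ∈ E, f x ∈ E ∧ f (f x) = x) → (∀ x ∈ E, g x ∈ E ∧ g (g x) = x) →
        (∃ x ∈ E, f x ≠ x) →
        ∃ s : α → Bool, ∀ x ∈ E, (f x ≠ x → s (f x) ≠ s x) ∧ (g x ≠ x → s (g x) ≠ s x) := by
      intro f g hE hf hg ⟨x, hx, hxy⟩
      obtain ⟨y, hy⟩ : ∃ y, y = f x := ⟨_, rfl⟩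
      have hyE : y ∈ E := hy ▸ (hf x hx).1
      have hfy : f y = x := hy ▸ (hf x hx).2
      have hne : y ≠ x := hy ▸ hxy
      let E' := (E.erase x).erase y
      have hmem : ∀ z, z ∈ E' ↔ z ∈ E ∧ z ≠ x ∧ z ≠ y := by
        intro z; simp [E']; tauto
      have hcard : E'.card ≤ n := by
        have h1 : (E.erase x).card + 1 = E.card := Finset.card_erase_add_one hx
        have h2 : E'.card ≤ (E.erase x).card := Finset.card_le_card (Finset.erase_subset _ _)
        omega
      let g' : α → α := fun z => if g z = x then (if g y = y then z else g y)
        else if g z = y then (if g x = x then z else g x) else g z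
      obtain ⟨s, hs⟩ := ih E' f g' hcard (by
          intro z hz
          rw [hmem] at hz ⊢
          have := hf z hz.1
          have := hf x hx
          grind) (by
          intro z hz
          rw [hmem] at hz ⊢
          have := hg z hz.1
          have := hg x hx
          have := hg y hyE
          simp only [g']
          grind)
      have hgx := hg x hx
      have hgy := hg y hyE
      let vx : Bool := if g x ≠ x ∧ g x ≠ y then !(s (g x)) else
        if g y ≠ x ∧ g y ≠ y then s (g y) else true
      refine ⟨fun z => if z = x then vx else if z = y then !vx else s z, ?_⟩
      intro z hz
      have hgz := hg z hz
      have hfz := hf z hz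
      by_cases h1 : z = x
      · subst h1
        refine ⟨by grind, fun h => ?_⟩
        by_cases h2 : g z = y
        · grind
        · simp [h, h2, vx]
      · by_cases h2 : z = y
        · subst h2
          refine ⟨by grind, fun h => ?_⟩
          by_cases h3 : g z = x
          · grind
          · have h4 : g x ≠ z := by grind
            by_cases h5 : g x = x
            · simp [h, h3, vx, h1, h5]
            · have h6 := (hs (g x) (by rw [hmem]; exact ⟨hgx.1, h5, h4⟩)).2
              simp only [g', hgx.2] at h6
              simp [h, h3, vx, h1, h5, h4]
              simp [h] at h6
              have : g z ≠ g x := by grind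
              exact h6 this
        · have h3 := hs z (by rw [hmem]; exact ⟨hz, h1, h2⟩)
          refine ⟨by grind, fun h => ?_⟩
          by_cases h4 : g z = x
          · have h5 : g x = z := by grind
            simp [h4, h1, h2, vx, h5]
          · by_cases h5 : g z = y
            · have h6 : g y = z := by grind
              by_cases h7 : g x = x
              · simp [h4, h1, h2, vx, h5, h6, h7, hne]
              · have h8 : g x ≠ y := by grind
                have h9 := h3.2
                simp only [g', h5, hne, h7, if_true, if_false] at h9
                have : g x ≠ z := by grind
                have h9 := h9 this
                simp [h4, h1, h2, vx, h5, h6, h7, hne, h8]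
                exact h9
            · have h9 := h3.2
              simp only [g', h4, h5, if_false] at h9
              simp [h4, h1, h2, h5, vx]
              simpa using h9 h
    intro f g hE hf hg
    by_cases h1 : ∃ x ∈ E, f x ≠ x
    · exact key f g hE hf hg h1
    · by_cases h2 : ∃ x ∈ E, g x ≠ x
      · obtain ⟨s, hs⟩ := key g f hE hg hf h2
        exact ⟨s, fun x hx => (hs x hx).symm⟩
      · push Not at h1 h2
        exact ⟨fun _ => true, fun x hx => by simp [h1 x hx, h2 x hx]⟩

/-- Two-level pairing. -/
lemma pairing {α K L : Type*} [DecidableEq α] (p : α → K) (r : α → L) (n : ℕ) :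
    ∀ E : Finset α, E.card ≤ n → ∃ g : α → α, (∀ x ∈ E, g x ∈ E ∧ g (g x) = x ∧ p (g x) = p x) ∧
      (∀ x ∈ E, ∀ y ∈ E, p x = p y → g x = x → g y = y → x = y) ∧
      (∀ x ∈ E, ∀ y ∈ E, p x = p y → r x = r y → (g x = x ∨ r (g x) ≠ r x) →
        (g y = y ∨ r (g y) ≠ r y) → x = y) := by
  induction n with
  | zero =>
    intro E hE
    have : E = ∅ := by simpa using hE
    subst this
    exact ⟨id, by simp⟩
  | succ n ih =>
    intro E hE
    by_cases h : ∃ x ∈ E, ∃ y ∈ E, x ≠ y ∧ p x = p y ∧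
      ((∃ x ∈ E, ∃ y ∈ E, x ≠ y ∧ p x = p y ∧ r x = r y) → r x = r y)
    · obtain ⟨x, hx, y, hy, hne, hp, hr⟩ := h
      let E' := (E.erase x).erase y
      have hmem : ∀ z, z ∈ E' ↔ z ∈ E ∧ z ≠ x ∧ z ≠ y := by
        intro z; simp [E']; tauto
      have hcard : E'.card ≤ n := by
        have h1 : (E.erase x).card + 1 = E.card := Finset.card_erase_add_one hx
        have h2 : E'.card ≤ (E.erase x).card := Finset.card_le_card (Finset.erase_subset _ _)
        omega
      obtain ⟨g, h1, h2, h3⟩ := ih E' hcard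
      refine ⟨fun z => if z = x then y else if z = y then x else g z, ?_, ?_, ?_⟩
      · intro z hz
        have := h1 z
        rw [hmem, hmem] at this
        grind
      · intro z hz w hw
        have := h2 z
        have := this 
        simp only [hmem] at this
        have := this
        grind
      · intro z hz w hw hpzw hrzw a b
        have h4 := h3 z
        simp only [hmem] at h4
        by_cases hr' : r x = r y
        · grind
        · by_contra hzw
          exact hr' (hr ⟨z, hz, w, hw, hzw, hpzw, hrzw⟩)
    · refine ⟨id, by simp, ?_, ?_⟩
      · intro x hx y hy hp _ _
        by_contra hne
        apply h
        by_cases h' : ∃ x ∈ E, ∃ y ∈ E, x ≠ y ∧ p x = p y ∧ r x = r y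
        · obtain ⟨x, hx, y, hy, h1, h2, h3⟩ := h'
          exact ⟨x, hx, y, hy, h1, h2, fun _ => h3⟩
        · exact ⟨x, hx, y, hy, hne, hp, fun h => absurd h h'⟩
      · intro x hx y hy hp hr _ _
        by_contra hne
        exact h ⟨x, hx, y, hy, hne, hp, fun _ => hr⟩

/-- balanced two-colouring of a finset -/
def Bal {α : Type*} (S : Finset α) (s : α → Bool) : Prop :=
  (S.filter (fun x => s x = true)).card ≤ (S.filter (fun x => s x = false)).card + 1 ∧
  (S.filter (fun x => s x = false)).card ≤ (S.filter (fun x => s x = true)).card + 1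

lemma bal_of_pairing {α : Type*} [DecidableEq α] (S : Finset α) (s : α → Bool) (g : α → α)
    (P : α → Prop)
    (h1 : ∀ x ∈ S, ¬ P x → g x ∈ S ∧ g (g x) = x ∧ s (g x) ≠ s x)
    (h2 : ∀ x ∈ S, ∀ y ∈ S, P x → P y → x = y) : Bal S s := by
  classical
  have key : ∀ b, (S.filter (fun x => s x = b)).card ≤ (S.filter (fun x => s x = !b)).card + 1 := by
    intro b
    have e1 : (S.filter (fun x => s x = b)).card =
        ((S.filter (fun x => s x = b)).filter P).card +
        ((S.filter (fun x => s x = b)).filter (fun x => ¬ P x)).card :=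
      (Finset.card_filter_add_card_filter_not _).symm
    have e2 : ((S.filter (fun x => s x = b)).filter P).card ≤ 1 := by
      rw [Finset.card_le_one]
      intro x hx y hy
      simp only [Finset.mem_filter] at hx hy
      exact h2 x hx.1.1 y hy.1.1 hx.2 hy.2
    have e3 : ((S.filter (fun x => s x = b)).filter (fun x => ¬ P x)).card ≤
        (S.filter (fun x => s x = !b)).card := by
      apply Finset.card_le_card_of_injOn g
      · intro x hx
        simp only [Finset.coe_filter, Finset.mem_filter, Set.mem_ofPred_eq] at hx ⊢
        have := h1 x hx.1.1 hx.2
        refine ⟨this.1, ?_⟩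
        have h := this.2.2
        rw [hx.1.2] at h
        cases b <;> simp_all
      · intro x hx y hy hxy
        simp only [Finset.coe_filter, Finset.mem_filter, Set.mem_ofPred_eq] at hx hy
        rw [← (h1 x hx.1.1 hx.2).2.1, ← (h1 y hy.1.1 hy.2).2.1, hxy]
    omega
  exact ⟨key true, key false⟩

lemma disc {α K₁ L₁ K₂ L₂ : Type*} [DecidableEq α] [DecidableEq K₁] [DecidableEq L₁]
    [DecidableEq K₂] [DecidableEq L₂] (E : Finset α)
    (p₁ : α → K₁) (r₁ : α → L₁) (p₂ : α → K₂) (r₂ : α → L₂) :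
    ∃ s : α → Bool, (∀ k, Bal (E.filter (fun x => p₁ x = k)) s) ∧
      (∀ k l, Bal (E.filter (fun x => p₁ x = k ∧ r₁ x = l)) s) ∧
      (∀ k, Bal (E.filter (fun x => p₂ x = k)) s) ∧
      (∀ k l, Bal (E.filter (fun x => p₂ x = k ∧ r₂ x = l)) s) := by
  obtain ⟨f, f1, f2, f3⟩ := pairing p₁ r₁ _ E le_rfl
  obtain ⟨g, g1, g2, g3⟩ := pairing p₂ r₂ _ E le_rfl
  obtain ⟨s, hs⟩ := two_matchings _ E f g le_rfl (fun x hx => ⟨(f1 x hx).1, (f1 x hx).2.1⟩)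
    (fun x hx => ⟨(g1 x hx).1, (g1 x hx).2.1⟩)
  refine ⟨s, fun k => ?_, fun k l => ?_, fun k => ?_, fun k l => ?_⟩
  · apply bal_of_pairing _ s f (fun x => f x = x)
    · intro x hx h
      simp only [Finset.mem_filter] at hx ⊢
      have := f1 x hx.1
      exact ⟨⟨this.1, this.2.2.trans hx.2⟩, this.2.1, (hs x hx.1).1 h⟩
    · intro x hx y hy a b
      simp only [Finset.mem_filter] at hx hy
      exact f2 x hx.1 y hy.1 (hx.2.trans hy.2.symm) a b
  · apply bal_of_pairing _ s f (fun x => f x = x ∨ r₁ (f x) ≠ r₁ x)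
    · intro x hx h
      simp only [Finset.mem_filter] at hx ⊢
      push Not at h
      have := f1 x hx.1
      exact ⟨⟨this.1, this.2.2.trans hx.2.1, h.2.trans hx.2.2⟩, this.2.1, (hs x hx.1).1 h.1⟩
    · intro x hx y hy a b
      simp only [Finset.mem_filter] at hx hy
      exact f3 x hx.1 y hy.1 (hx.2.1.trans hy.2.1.symm) (hx.2.2.trans hy.2.2.symm) a b
  · apply bal_of_pairing _ s g (fun x => g x = x)
    · intro x hx h
      simp only [Finset.mem_filter] at hx ⊢
      have := g1 x hx.1
      exact ⟨⟨this.1, this.2.2.trans hx.2⟩, this.2.1, (hs x hx.1).2 h⟩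
    · intro x hx y hy a b
      simp only [Finset.mem_filter] at hx hy
      exact g2 x hx.1 y hy.1 (hx.2.trans hy.2.symm) a b
  · apply bal_of_pairing _ s g (fun x => g x = x ∨ r₂ (g x) ≠ r₂ x)
    · intro x hx h
      simp only [Finset.mem_filter] at hx ⊢
      push Not at h
      have := g1 x hx.1
      exact ⟨⟨this.1, this.2.2.trans hx.2.1, h.2.trans hx.2.2⟩, this.2.1, (hs x hx.1).2 h.1⟩
    · intro x hx y hy a b
      simp only [Finset.mem_filter] at hx hy
      exact g3 x hx.1 y hy.1 (hx.2.1.trans hy.2.1.symm) (hx.2.2.trans hy.2.2.symm) a b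


lemma sq_bal {a b a' b' : ℕ} (h : a' + b' = a + b) (h1 : a' ≤ b' + 1) (h2 : b' ≤ a' + 1) :
    a' ^ 2 + b' ^ 2 ≤ a ^ 2 + b ^ 2 ∧ (b + 1 < a → a' ^ 2 + b' ^ 2 < a ^ 2 + b ^ 2) := by
  have hab : (a' : ℤ) + b' = a + b := by exact_mod_cast h
  have e : ∀ x y : ℤ, 2 * (x ^ 2 + y ^ 2) = (x + y) ^ 2 + (x - y) ^ 2 := by intros; ring
  have e1 := e a b
  have e2 := e a' b'
  rw [hab] at e2
  have d1 : ((a' : ℤ) - b') ^ 2 ≤ ((a : ℤ) - b) ^ 2 := by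
    rw [sq_le_sq]
    rcases le_or_gt (b : ℤ) a with h3 | h3 <;> rcases le_or_gt (b' : ℤ) a' with h4 | h4 <;>
      simp only [abs_le, le_abs] <;> omega
  constructor
  · zify; linarith
  · intro h5
    have d2 : ((a' : ℤ) - b') ^ 2 < ((a : ℤ) - b) ^ 2 := by
      rw [sq_lt_sq]
      simp only [abs_lt, lt_abs]; omega
    zify; linarith

lemma sum_two {C : Type*} [Fintype C] [DecidableEq C] (f : C → ℕ) {c c' : C} (h : c ≠ c') :
    ∑ d, f d = f c + f c' + ∑ d ∈ (Finset.univ.erase c).erase c', f d := by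
  rw [← Finset.add_sum_erase _ f (Finset.mem_univ c),
    ← Finset.add_sum_erase _ f (Finset.mem_erase.2 ⟨h.symm, Finset.mem_univ c'⟩)]
  ring

lemma sum_sq_two {C : Type*} [Fintype C] [DecidableEq C] (f f' : C → ℕ) {c c' : C} (h : c ≠ c')
    (h0 : ∀ d, d ≠ c → d ≠ c' → f' d = f d)
    (hs : f' c + f' c' = f c + f c') (h1 : f' c ≤ f' c' + 1) (h2 : f' c' ≤ f' c + 1) :
    ∑ d, f' d ^ 2 ≤ ∑ d, f d ^ 2 ∧ (f c' + 1 < f c → ∑ d, f' d ^ 2 < ∑ d, f d ^ 2) := by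
  rw [sum_two (fun d => f d ^ 2) h, sum_two (fun d => f' d ^ 2) h]
  have : ∑ d ∈ (Finset.univ.erase c).erase c', f' d ^ 2 =
      ∑ d ∈ (Finset.univ.erase c).erase c', f d ^ 2 := by
    apply Finset.sum_congr rfl
    intro d hd
    simp only [Finset.mem_erase] at hd
    rw [h0 d hd.2.1 hd.1]
  rw [this]
  have := sq_bal hs h1 h2
  exact ⟨by omega, fun h => by have := this.2 h; omega⟩

/-- Equitable colourings from halvings. -/
lemma equi_abs {α C : Type*} [DecidableEq α] [Fintype C] [DecidableEq C] [Nonempty C]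
    (J : Finset (Finset α))
    (h : ∀ E' : Finset α, ∃ s : α → Bool, ∀ S ∈ J, Bal (S.filter (fun x => x ∈ E')) s) :
    ∃ φ : α → C, ∀ S ∈ J, ∀ c c', (S.filter (fun x => φ x = c)).card ≤
      (S.filter (fun x => φ x = c')).card + 1 := by
  classical
  let Φ : (α → C) → ℕ := fun φ => ∑ S ∈ J, ∑ d, (S.filter (fun x => φ x = d)).card ^ 2
  obtain ⟨φ, hφ⟩ : ∃ φ, ∀ φ', Φ φ ≤ Φ φ' := by
    obtain ⟨φ, -, hφ⟩ := WellFounded.has_min (InvImage.wf Φ Nat.lt_wfRel.wf) Set.univ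
      ⟨fun _ => Classical.arbitrary C, trivial⟩
    exact ⟨φ, fun φ' => not_lt.1 (hφ φ' trivial)⟩
  refine ⟨φ, ?_⟩
  by_contra! hcon
  obtain ⟨S₀, hS₀, c, c', hcc⟩ := hcon
  have hne : c ≠ c' := by rintro rfl; omega
  obtain ⟨s, hs⟩ := h ((J.biUnion id).filter (fun x => φ x = c ∨ φ x = c'))
  let φ' : α → C := fun x => if φ x = c ∨ φ x = c' then (if s x = true then c else c') else φ x
  have key : ∀ S ∈ J,
      ∑ d, (S.filter (fun x => φ' x = d)).card ^ 2 ≤ ∑ d, (S.filter (fun x => φ x = d)).card ^ 2 ∧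
      ((S.filter (fun x => φ x = c')).card + 1 < (S.filter (fun x => φ x = c)).card →
      ∑ d, (S.filter (fun x => φ' x = d)).card ^ 2 <
        ∑ d, (S.filter (fun x => φ x = d)).card ^ 2) := by
    intro S hS
    have hb := hs S hS
    have e1 : S.filter (fun x => φ' x = c) = (S.filter (fun x => x ∈ (J.biUnion id).filter
        (fun x => φ x = c ∨ φ x = c'))).filter (fun x => s x = true) := by
      ext x
      simp only [Finset.mem_filter, Finset.mem_biUnion, id, φ']
      constructor
      · rintro ⟨hx, h1⟩
        refine ⟨⟨hx, ⟨S, hS, hx⟩, ?_⟩, ?_⟩ <;> grind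
      · rintro ⟨⟨hx, _, h1⟩, h2⟩
        exact ⟨hx, by simp [h1, h2]⟩
    have e2 : S.filter (fun x => φ' x = c') = (S.filter (fun x => x ∈ (J.biUnion id).filter
        (fun x => φ x = c ∨ φ x = c'))).filter (fun x => s x = false) := by
      ext x
      simp only [Finset.mem_filter, Finset.mem_biUnion, id, φ']
      constructor
      · rintro ⟨hx, h1⟩
        refine ⟨⟨hx, ⟨S, hS, hx⟩, ?_⟩, ?_⟩ <;> grind
      · rintro ⟨⟨hx, _, h1⟩, h2⟩
        exact ⟨hx, by simp [h1, h2]⟩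
    apply sum_sq_two (fun d => (S.filter (fun x => φ x = d)).card)
      (fun d => (S.filter (fun x => φ' x = d)).card) hne
    · intro d h1 h2
      congr 1
      ext x
      simp only [Finset.mem_filter, φ']
      grind
    · have h1 : ∀ ψ : α → C, (S.filter (fun x => ψ x = c)).card +
          (S.filter (fun x => ψ x = c')).card = (S.filter (fun x => ψ x = c ∨ ψ x = c')).card := by
        intro ψ
        rw [Finset.filter_or, Finset.card_union_of_disjoint]
        rw [Finset.disjoint_filter]
        intro x _ h1 h2
        exact hne (h1.symm.trans h2)
      simp only [h1]
      congr 1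
      ext x
      simp only [Finset.mem_filter, φ']
      grind
    · simp only [e1, e2]; exact hb.1
    · simp only [e1, e2]; exact hb.2
  have hlt : Φ φ' < Φ φ :=
    Finset.sum_lt_sum (fun S hS => (key S hS).1) ⟨S₀, hS₀, (key S₀ hS₀).2 hcc⟩
  exact absurd (hφ φ') (not_le.2 hlt)

lemma equi {α C K₁ L₁ K₂ : Type*} [DecidableEq α] [Fintype C] [DecidableEq C] [Nonempty C]
    [DecidableEq K₁] [DecidableEq L₁] [DecidableEq K₂] (E : Finset α)
    (p₁ : α → K₁) (r₁ : α → L₁) (p₂ : α → K₂) :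
    ∃ φ : α → C,
      (∀ k c c', (E.filter (fun x => p₁ x = k ∧ φ x = c)).card ≤
        (E.filter (fun x => p₁ x = k ∧ φ x = c')).card + 1) ∧
      (∀ k l c c', (E.filter (fun x => (p₁ x = k ∧ r₁ x = l) ∧ φ x = c)).card ≤
        (E.filter (fun x => (p₁ x = k ∧ r₁ x = l) ∧ φ x = c')).card + 1) ∧
      (∀ k c c', (E.filter (fun x => p₂ x = k ∧ φ x = c)).card ≤
        (E.filter (fun x => p₂ x = k ∧ φ x = c')).card + 1) := by
  let J : Finset (Finset α) := E.image (fun y => E.filter (fun x => p₁ x = p₁ y)) ∪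
    (E.image (fun y => E.filter (fun x => p₁ x = p₁ y ∧ r₁ x = r₁ y)) ∪
    E.image (fun y => E.filter (fun x => p₂ x = p₂ y)))
  obtain ⟨φ, hφ⟩ := equi_abs (C := C) J (by
    intro E'
    obtain ⟨s, h1, h2, h3, -⟩ := disc (E.filter (fun x => x ∈ E')) p₁ r₁ p₂ (fun _ => ())
    refine ⟨s, ?_⟩
    intro S hS
    simp only [J, Finset.mem_union, Finset.mem_image] at hS
    rcases hS with ⟨y, _, rfl⟩ | ⟨y, _, rfl⟩ | ⟨y, _, rfl⟩
    · rw [Finset.filter_comm]; exact h1 _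
    · rw [Finset.filter_comm]; exact h2 _ _
    · rw [Finset.filter_comm]; exact h3 _)
  have key : ∀ (P : α → Prop) [DecidablePred P], (∀ y ∈ E, P y → E.filter P ∈ J) → ∀ c c',
      (E.filter (fun x => P x ∧ φ x = c)).card ≤ (E.filter (fun x => P x ∧ φ x = c')).card + 1 := by
    intro P _ hP c c'
    rw [← Finset.filter_filter, ← Finset.filter_filter]
    rcases (E.filter P).eq_empty_or_nonempty with h | ⟨y, hy⟩
    · simp [h]
    · rw [Finset.mem_filter] at hy
      exact hφ _ (hP y hy.1 hy.2) c c'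
  refine ⟨φ, fun k => key _ ?_, fun k l => key _ ?_, fun k => key _ ?_⟩
  · rintro y hy rfl
    simp only [J, Finset.mem_union]
    exact Or.inl (Finset.mem_image.2 ⟨y, hy, rfl⟩)
  · rintro y hy ⟨rfl, rfl⟩
    simp only [J, Finset.mem_union]
    exact Or.inr (Or.inl (Finset.mem_image.2 ⟨y, hy, rfl⟩))
  · rintro y hy rfl
    simp only [J, Finset.mem_union]
    exact Or.inr (Or.inr (Finset.mem_image.2 ⟨y, hy, rfl⟩))

/-- A coloured multigraph: `N c x y` is the number of edges of colour `c` joining `x` and `y`. -/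
structure Col {C P : Type*} [Fintype C] (M : P → P → ℕ) (N : C → P → P → ℕ) : Prop where
  symm : ∀ c x y, N c x y = N c y x
  sum : ∀ x y, ∑ c, N c x y = M x y

/-- number of indices -/
lemma card_slice {C P : Type*} [Fintype C] [Fintype P] [DecidableEq C] [DecidableEq P]
    (T : C → P → ℕ) (Z : C → P → Prop) [∀ c x, Decidable (Z c x)]
    (s : C × P × ℕ → Bool) (b : Bool) (D : ℕ) (hD : ∀ c x, T c x ≤ D) :
    (((Finset.univ ×ˢ Finset.univ ×ˢ Finset.range D).filter
      (fun e : C × P × ℕ => e.2.2 < T e.1 e.2.1 ∧ Z e.1 e.2.1)).filter (fun e => s e = b)).card =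
    ∑ c, ∑ x, if Z c x then ((Finset.range (T c x)).filter (fun k => s (c, x, k) = b)).card else 0 := by
  rw [Finset.filter_filter, Finset.card_filter, Finset.sum_product]
  apply Finset.sum_congr rfl
  intro c _
  rw [Finset.sum_product]
  apply Finset.sum_congr rfl
  intro x _
  rw [← Finset.card_filter]
  split_ifs with h
  · congr 1
    ext k
    have := hD c x
    simp [h]
    intro _
    omega
  · simp [h]

lemma exch {C P L : Type*} [Fintype C] [Fintype P] [DecidableEq C] [DecidableEq P] [DecidableEq L]
    {M : P → P → ℕ} {N : C → P → P → ℕ} (hM : ∀ x y, M x y = M y x) (hN : Col M N)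
    {p p' : P} (hne : p ≠ p')
    (htw : ∀ x, x ≠ p → x ≠ p' → M p x = M p' x) (β : C → P → L) :
    ∃ N' : C → P → P → ℕ, Col M N' ∧
      (∀ c x y, x ≠ p → x ≠ p' → y ≠ p → y ≠ p' → N' c x y = N c x y) ∧
      (∀ c, N' c p p' = N c p p') ∧ (∀ c x, N' c x x = N c x x) ∧
      (∀ c x, x ≠ p → x ≠ p' → N' c p x + N' c p' x = N c p x + N c p' x) ∧
      (∀ c, (∑ x, if x ≠ p ∧ x ≠ p' then N' c p x else 0) ≤
        (∑ x, if x ≠ p ∧ x ≠ p' then N' c p' x else 0) + 1 ∧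
        (∑ x, if x ≠ p ∧ x ≠ p' then N' c p' x else 0) ≤
        (∑ x, if x ≠ p ∧ x ≠ p' then N' c p x else 0) + 1) ∧
      (∀ c l, (∑ x, if (x ≠ p ∧ x ≠ p') ∧ β c x = l then N' c p x else 0) ≤
        (∑ x, if (x ≠ p ∧ x ≠ p') ∧ β c x = l then N' c p' x else 0) + 1 ∧
        (∑ x, if (x ≠ p ∧ x ≠ p') ∧ β c x = l then N' c p' x else 0) ≤
        (∑ x, if (x ≠ p ∧ x ≠ p') ∧ β c x = l then N' c p x else 0) + 1) := by
  let T : C → P → ℕ := fun c x => N c p x + N c p' x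
  let D : ℕ := ∑ c, ∑ x, T c x
  have hD : ∀ c x, T c x ≤ D := fun c x =>
    (Finset.single_le_sum (f := fun x => T c x) (fun _ _ => Nat.zero_le _) (Finset.mem_univ x)).trans
    (Finset.single_le_sum (f := fun c => ∑ x, T c x) (fun _ _ => Nat.zero_le _) (Finset.mem_univ c))
  obtain ⟨s, h1, -, h2, h3⟩ := disc ((Finset.univ ×ˢ Finset.univ ×ˢ Finset.range D).filter
      (fun e : C × P × ℕ => e.2.2 < T e.1 e.2.1 ∧ (e.2.1 ≠ p ∧ e.2.1 ≠ p')))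
      (fun e => e.2.1) (fun _ => ()) (fun e => e.1) (fun e => β e.1 e.2.1)
  let A : Bool → C → P → ℕ := fun b c x => ((Finset.range (T c x)).filter (fun k => s (c, x, k) = b)).card
  have hA : ∀ c x, A true c x + A false c x = T c x := by
    intro c x
    have := Finset.card_filter_add_card_filter_not (s := Finset.range (T c x)) (fun k => s (c, x, k) = true)
    simpa [A] using this
  let N' : C → P → P → ℕ := fun c x y =>
    if x = p ∧ y ≠ p ∧ y ≠ p' then A true c y else
    if x = p' ∧ y ≠ p ∧ y ≠ p' then A false c y else
    if y = p ∧ x ≠ p ∧ x ≠ p' then A true c x else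
    if y = p' ∧ x ≠ p ∧ x ≠ p' then A false c x else N c x y
  have n1 : ∀ c x, x ≠ p → x ≠ p' → N' c p x = A true c x := by
    intro c x h h'; simp [N', h, h']
  have n2 : ∀ c x, x ≠ p → x ≠ p' → N' c p' x = A false c x := by
    intro c x h h'; simp [N', h, h', hne.symm]
  have n3 : ∀ c x y, N' c x y = N' c y x := by
    intro c x y
    have := hN.symm c x y
    simp only [N']; grind
  have slice : ∀ (Z : C → P → Prop) [∀ c x, Decidable (Z c x)],
      Bal (((Finset.univ ×ˢ Finset.univ ×ˢ Finset.range D).filter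
      (fun e : C × P × ℕ => e.2.2 < T e.1 e.2.1 ∧ (e.2.1 ≠ p ∧ e.2.1 ≠ p'))).filter
        (fun e => Z e.1 e.2.1)) s → 
      (∑ c, ∑ x, if (x ≠ p ∧ x ≠ p') ∧ Z c x then N' c p x else 0) ≤
      (∑ c, ∑ x, if (x ≠ p ∧ x ≠ p') ∧ Z c x then N' c p' x else 0) + 1 ∧
      (∑ c, ∑ x, if (x ≠ p ∧ x ≠ p') ∧ Z c x then N' c p' x else 0) ≤
      (∑ c, ∑ x, if (x ≠ p ∧ x ≠ p') ∧ Z c x then N' c p x else 0) + 1 := by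
    intro Z _ hb
    have e := fun b => card_slice T (fun c x => (x ≠ p ∧ x ≠ p') ∧ Z c x) s b D hD
    unfold Bal at hb
    simp only [Finset.filter_filter, and_assoc] at hb e
    rw [e true, e false] at hb
    have t1 : ∀ c x, (if (x ≠ p ∧ x ≠ p') ∧ Z c x then N' c p x else 0) = 
      (if x ≠ p ∧ x ≠ p' ∧ Z c x then ((Finset.range (T c x)).filter (fun k => s (c, x, k) = true)).card else 0) := by
      intro c x
      by_cases h : x ≠ p ∧ x ≠ p'
      · rw [n1 c x h.1 h.2]; simp only [and_assoc, A]
      · simp [h]; tauto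
    have t2 : ∀ c x, (if (x ≠ p ∧ x ≠ p') ∧ Z c x then N' c p' x else 0) = 
      (if x ≠ p ∧ x ≠ p' ∧ Z c x then ((Finset.range (T c x)).filter (fun k => s (c, x, k) = false)).card else 0) := by
      intro c x
      by_cases h : x ≠ p ∧ x ≠ p'
      · rw [n2 c x h.1 h.2]; simp only [and_assoc, A]
      · simp [h]; tauto
    simp only [t1, t2]
    exact hb
  refine ⟨N', ⟨n3, ?_⟩, ?_, ?_, ?_, ?_, ?_, ?_⟩
  · have tot : ∀ x, x ≠ p → x ≠ p' → ∑ c, A true c x = M p x ∧ ∑ c, A false c x = M p' x := by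
      intro x hx hx'
      have h := slice (fun c y => y = x) (h1 x)
      have u1 : ∀ q, (∑ c, ∑ y, if (y ≠ p ∧ y ≠ p') ∧ y = x then N' c q y else 0) = ∑ c, N' c q x := by
        intro q
        apply Finset.sum_congr rfl
        intro c _
        rw [Finset.sum_eq_single x]
        · simp [hx, hx']
        · intro y _ hy; simp [hy]
        · simp
      rw [u1, u1] at h
      simp only [n1 _ x hx hx', n2 _ x hx hx'] at h
      have h5 : ∑ c, A true c x + ∑ c, A false c x = M p x + M p' x := by
        rw [← Finset.sum_add_distrib, ← hN.sum, ← hN.sum, ← Finset.sum_add_distrib]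
        exact Finset.sum_congr rfl (fun c _ => hA c x)
      have h6 := htw x hx hx'
      omega
    intro x y
    by_cases c1 : x = p ∧ y ≠ p ∧ y ≠ p'
    · obtain ⟨rfl, a, b⟩ := c1
      simp only [n1 _ y a b]; exact (tot y a b).1
    · by_cases c2 : x = p' ∧ y ≠ p ∧ y ≠ p'
      · obtain ⟨rfl, a, b⟩ := c2
        simp only [n2 _ y a b]; exact (tot y a b).2
      · by_cases c3 : y = p ∧ x ≠ p ∧ x ≠ p'
        · obtain ⟨rfl, a, b⟩ := c3
          simp only [n3 _ x, n1 _ x a b]; rw [hM]; exact (tot x a b).1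
        · by_cases c4 : y = p' ∧ x ≠ p ∧ x ≠ p'
          · obtain ⟨rfl, a, b⟩ := c4
            simp only [n3 _ x, n2 _ x a b]; rw [hM]; exact (tot x a b).2
          · simp only [N', c1, c2, c3, c4, if_false]
            exact hN.sum x y
  · intro c x y a b a' b'
    simp [N', a, b, a', b']
  · intro c
    simp [N', hne.symm]
  · intro c x
    simp only [N']; grind
  · intro c x a b
    rw [n1 c x a b, n2 c x a b]; exact hA c x
  · intro c
    have h := slice (fun d x => d = c) (h2 c)
    have u1 : ∀ q, (∑ d, ∑ y, if (y ≠ p ∧ y ≠ p') ∧ d = c then N' d q y else 0) =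
        ∑ y, if (y ≠ p ∧ y ≠ p') then N' c q y else 0 := by
      intro q
      rw [Finset.sum_eq_single c]
      · simp
      · intro d _ hd; simp [hd]
      · simp
    rw [u1, u1] at h
    exact h
  · intro c l
    have h := slice (fun d x => d = c ∧ β d x = l) (h3 c l)
    have u1 : ∀ q, (∑ d, ∑ y, if (y ≠ p ∧ y ≠ p') ∧ d = c ∧ β d y = l then N' d q y else 0) =
        ∑ y, if (y ≠ p ∧ y ≠ p') ∧ β c y = l then N' c q y else 0 := by
      intro q
      rw [Finset.sum_eq_single c]
      · simp
      · intro d _ hd; simp [hd]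
      · simp
    rw [u1, u1] at h
    exact h


lemma sum_split {P : Type*} [Fintype P] [DecidableEq P] (f : P → ℕ) {p p' : P} (h : p ≠ p') :
    ∑ x, f x = f p + f p' + ∑ x, if x ≠ p ∧ x ≠ p' then f x else 0 := by
  rw [sum_two f h, sum_two (fun x => if x ≠ p ∧ x ≠ p' then f x else 0) h]
  simp only [ne_eq, not_true_eq_false, false_and, and_false, if_false, zero_add]
  congr 1
  apply Finset.sum_congr rfl
  intro x hx
  simp only [Finset.mem_erase] at hx
  simp [hx.1, hx.2.1]

lemma even_sum_symm {P : Type*} [DecidableEq P] (N : P → P → ℕ) (hs : ∀ x y, N x y = N y x)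
    (h0 : ∀ x, N x x = 0) (B : Finset P) : Even (∑ x ∈ B, ∑ y ∈ B, N x y) := by
  induction B using Finset.induction_on with
  | empty => simp
  | insert a B ha ih =>
    rw [Finset.sum_insert ha, Finset.sum_insert ha]
    simp only [Finset.sum_insert ha, h0, Finset.sum_add_distrib]
    have : ∑ x ∈ B, N x a = ∑ x ∈ B, N a x := Finset.sum_congr rfl (fun x _ => hs x a)
    rw [this]
    obtain ⟨k, hk⟩ := ih
    exact ⟨∑ x ∈ B, N a x + k, by rw [hk]; ring⟩

section
variable {C P : Type*} [Fintype C] [Fintype P] [DecidableEq C] [DecidableEq P]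

lemma Col.diag {M : P → P → ℕ} {N : C → P → P → ℕ} (hN : Col M N) (h0 : ∀ x, M x x = 0) (c : C)
    (x : P) : N c x x = 0 := by
  have := hN.sum x x
  rw [h0, Finset.sum_eq_zero_iff] at this
  exact this c (Finset.mem_univ c)

lemma exch2 {L : Type*} [DecidableEq L]
    {M : P → P → ℕ} {N : C → P → P → ℕ} (hM : ∀ x y, M x y = M y x) (h0 : ∀ x, M x x = 0)
    (hN : Col M N) {p p' : P} (hne : p ≠ p')
    (htw : ∀ x, x ≠ p → x ≠ p' → M p x = M p' x) (β : C → P → L) :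
    ∃ N' : C → P → P → ℕ, Col M N' ∧
      (∀ c x, x ≠ p → x ≠ p' → ∑ y, N' c x y = ∑ y, N c x y) ∧
      (∀ c, ∑ y, N' c p y + ∑ y, N' c p' y = ∑ y, N c p y + ∑ y, N c p' y) ∧
      (∀ c, ∑ y, N' c p y ≤ ∑ y, N' c p' y + 1 ∧ ∑ y, N' c p' y ≤ ∑ y, N' c p y + 1) ∧
      (∀ c (r : P → P → Prop), Equivalence r → (∀ x y, 0 < N' c x y → r x y) → r p p' →
        ∀ x y, 0 < N c x y → r x y) ∧
      (∀ c x y, x ≠ p → x ≠ p' → y ≠ p → y ≠ p' → N' c x y = N c x y) ∧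
      (∀ c, N' c p p' = N c p p') ∧ 
      (∀ c x, x ≠ p → x ≠ p' → N' c p x + N' c p' x = N c p x + N c p' x) ∧
      (∀ c l, (∑ x, if (x ≠ p ∧ x ≠ p') ∧ β c x = l then N' c p x else 0) ≤
        (∑ x, if (x ≠ p ∧ x ≠ p') ∧ β c x = l then N' c p' x else 0) + 1 ∧
        (∑ x, if (x ≠ p ∧ x ≠ p') ∧ β c x = l then N' c p' x else 0) ≤
        (∑ x, if (x ≠ p ∧ x ≠ p') ∧ β c x = l then N' c p x else 0) + 1) := by
  obtain ⟨N', hN', h1, h2, h3, h4, h5, h6⟩ := exch hM hN hne htw β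
  have a1 : ∀ c x, N' c x x = 0 := fun c x => hN'.diag h0 c x
  have a2 : ∀ c x, N c x x = 0 := fun c x => hN.diag h0 c x
  refine ⟨N', hN', ?_, ?_, ?_, ?_, h1, h2, h4, h6⟩
  · intro c x a b
    rw [sum_split _ hne, sum_split (fun y => N c x y) hne]
    rw [hN'.symm c x, hN'.symm c x, h4 c x a b, hN.symm c x, hN.symm c x]
    congr 1
    apply Finset.sum_congr rfl
    intro y _
    split_ifs with h
    · exact h1 c x y a b h.1 h.2
    · rfl
  · intro c
    have e : (∑ x, if x ≠ p ∧ x ≠ p' then N' c p x else 0) +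
        (∑ x, if x ≠ p ∧ x ≠ p' then N' c p' x else 0) =
        (∑ x, if x ≠ p ∧ x ≠ p' then N c p x else 0) +
        (∑ x, if x ≠ p ∧ x ≠ p' then N c p' x else 0) := by
      rw [← Finset.sum_add_distrib, ← Finset.sum_add_distrib]
      apply Finset.sum_congr rfl
      intro y _
      split_ifs with h
      · exact h4 c y h.1 h.2
      · rfl
    rw [sum_split (fun y => N' c p y) hne, sum_split (fun y => N' c p' y) hne,
      sum_split (fun y => N c p y) hne, sum_split (fun y => N c p' y) hne]
    have := h2 c
    have := hN.symm c p p'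
    have := hN'.symm c p p'
    simp only [a1, a2] at *
    omega
  · intro c
    rw [sum_split (fun y => N' c p y) hne, sum_split (fun y => N' c p' y) hne]
    have := hN'.symm c p p'
    have := h5 c
    simp only [a1] at *
    omega
  · intro c r hr hadj hpp x y hxy
    have key : ∀ y, y ≠ p → y ≠ p' → 0 < N c p y + N c p' y → r p y := by
      intro y a b h
      rw [← h4 c y a b] at h
      rcases Nat.eq_zero_or_pos (N' c p y) with h' | h'
      · exact hr.trans hpp (hadj _ _ (by omega))
      · exact hadj _ _ h'
    by_cases x1 : x = p
    · subst x1
      by_cases y1 : y = x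
      · subst y1; exact hr.refl _
      by_cases y2 : y = p'
      · subst y2; exact hpp
      exact key y y1 y2 (by omega)
    by_cases x2 : x = p'
    · subst x2
      by_cases y1 : y = p
      · subst y1; exact hr.symm hpp
      by_cases y2 : y = x
      · subst y2; exact hr.refl _
      exact hr.trans (hr.symm hpp) (key y y1 y2 (by omega))
    by_cases y1 : y = p
    · subst y1; rw [hN.symm] at hxy; exact hr.symm (key x x1 x2 (by omega))
    by_cases y2 : y = p'
    · subst y2; rw [hN.symm] at hxy; exact hr.symm (hr.trans (hr.symm hpp) (key x x1 x2 (by omega)))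
    exact hadj _ _ (by rw [h1 c x y x1 x2 y1 y2]; exact hxy)

lemma exists_min_nat {X : Type*} (Q : X → Prop) (Φ : X → ℕ) (h : ∃ x, Q x) :
    ∃ x, Q x ∧ ∀ y, Q y → Φ x ≤ Φ y := by
  obtain ⟨x, hx, hm⟩ := WellFounded.has_min (InvImage.wf Φ Nat.lt_wfRel.wf) {x | Q x} h
  exact ⟨x, hx, fun y hy => not_lt.1 (hm y hy)⟩

/-- Connectivity after identification of the classes of `π`. -/
def QConn {Q : Type*} (π : P → Q) (N : C → P → P → ℕ) : Prop :=
  ∀ (c : C) (r : P → P → Prop), Equivalence r → (∀ x y, 0 < N c x y → r x y) →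
    (∀ x y, π x = π y → r x y) → ∀ x y, r x y

lemma refine_deg {Q : Type*} [DecidableEq Q] (π : P → Q) (d : P → ℕ)
    (hd : ∀ x y, π x = π y → d x = d y)
    {M : P → P → ℕ} (hM : ∀ x y, M x y = M y x) (h0 : ∀ x, M x x = 0)
    (htw : ∀ p p' x, π p = π p' → x ≠ p → x ≠ p' → M p x = M p' x)
    (hex : ∃ N : C → P → P → ℕ, Col M N ∧ QConn π N ∧ 
      ∀ c q, ∑ p ∈ Finset.univ.filter (fun p => π p = q), ∑ x, N c p x =
        ∑ p ∈ Finset.univ.filter (fun p => π p = q), 2 * d p) :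
    ∃ N : C → P → P → ℕ, Col M N ∧ QConn π N ∧ ∀ c p, ∑ x, N c p x = 2 * d p := by
  obtain ⟨N, ⟨hN, hQ, hdeg⟩, hmin⟩ := exists_min_nat _
    (fun N : C → P → P → ℕ => ∑ c, ∑ p, (∑ x, N c p x) ^ 2) hex
  refine ⟨N, hN, hQ, ?_⟩
  by_contra! hcon
  obtain ⟨c, p₀, hp₀⟩ := hcon
  obtain ⟨p, p', hpp, hlt⟩ : ∃ p p', π p = π p' ∧ ∑ x, N c p' x + 1 < ∑ x, N c p x := by
    have hq := hdeg c (π p₀)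
    by_cases hlow : ∃ p', π p' = π p₀ ∧ ∑ x, N c p' x < 2 * d p'
    · by_cases hhigh : ∃ p, π p = π p₀ ∧ 2 * d p < ∑ x, N c p x
      · obtain ⟨p', h1, h2⟩ := hlow
        obtain ⟨p, h3, h4⟩ := hhigh
        have := hd p p' (h3.trans h1.symm)
        exact ⟨p, p', h3.trans h1.symm, by omega⟩
      · exfalso
        push Not at hhigh
        obtain ⟨p', h1, h2⟩ := hlow
        have := Finset.sum_lt_sum (s := Finset.univ.filter (fun p => π p = π p₀))
          (f := fun p => ∑ x, N c p x) (g := fun p => 2 * d p)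
          (fun i hi => hhigh i (by simpa using hi)) ⟨p', by simpa using h1, h2⟩
        omega
    · exfalso
      push Not at hlow
      have := Finset.sum_lt_sum (s := Finset.univ.filter (fun p => π p = π p₀))
          (g := fun p => ∑ x, N c p x) (f := fun p => 2 * d p)
          (fun i hi => hlow i (by simpa using hi)) ⟨p₀, by simp, by
            have := hlow p₀ rfl; omega⟩
      omega
  have hne : p ≠ p' := by rintro rfl; omega
  obtain ⟨N', hN', e1, e2, e3, e4, -⟩ := exch2 hM h0 hN hne (fun x => htw p p' x hpp) (fun _ _ => ())
  have key : ∀ c', ∑ q, (∑ x, N' c' q x) ^ 2 ≤ ∑ q, (∑ x, N c' q x) ^ 2 ∧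
      (∑ x, N c' p' x + 1 < ∑ x, N c' p x →
      ∑ q, (∑ x, N' c' q x) ^ 2 < ∑ q, (∑ x, N c' q x) ^ 2) := fun c' =>
    sum_sq_two (fun q => ∑ x, N c' q x) (fun q => ∑ x, N' c' q x) hne (e1 c') (e2 c')
      (e3 c').1 (e3 c').2
  have := hmin N' ⟨hN', ?_, ?_⟩
  · have hlt' := Finset.sum_lt_sum (s := Finset.univ) (f := fun c => ∑ q, (∑ x, N' c q x) ^ 2)
      (g := fun c => ∑ q, (∑ x, N c q x) ^ 2) (fun c _ => (key c).1)
      ⟨c, Finset.mem_univ c, (key c).2 hlt⟩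
    exact absurd this (not_le.2 hlt')
  · intro c r hr h1 h2
    exact hQ c r hr (e4 c r hr h1 (h2 _ _ hpp)) h2
  · intro c q
    rw [← hdeg c q]
    rw [Finset.sum_filter, Finset.sum_filter, sum_split _ hne,
      sum_split (fun a => if π a = q then ∑ x, N c a x else 0) hne]
    congr 1
    · rw [hpp]
      split_ifs
      · exact e2 c
      · rfl
    · apply Finset.sum_congr rfl
      intro x _
      split_ifs with h1 h2
      · exact e1 c x h1.1 h1.2
      · rfl
      · rfl

lemma refine_conn {Q : Type*} (π : P → Q) (d : P → ℕ) (hdpos : ∀ p, 0 < d p)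
    (hd : ∀ x y, π x = π y → d x = d y)
    {M : P → P → ℕ} (hM : ∀ x y, M x y = M y x) (h0 : ∀ x, M x x = 0)
    (htw : ∀ p p' x, π p = π p' → x ≠ p → x ≠ p' → M p x = M p' x)
    (hex : ∃ N : C → P → P → ℕ, Col M N ∧ QConn π N ∧ ∀ c p, ∑ x, N c p x = 2 * d p) :
    ∃ N : C → P → P → ℕ, Col M N ∧ QConn id N ∧ ∀ c p, ∑ x, N c p x = 2 * d p := by
  classical
  let Rch : (C → P → P → ℕ) → C → P → P → Prop := fun N c =>
    Relation.EqvGen (fun x y => 0 < N c x y)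
  obtain ⟨N, ⟨hN, hQ, hdeg⟩, hmin⟩ := exists_min_nat _
    (fun N : C → P → P → ℕ => (Finset.univ.filter
      (fun e : C × P × P => ¬ Rch N e.1 e.2.1 e.2.2)).card) hex
  have hEq : ∀ (N : C → P → P → ℕ) c, Equivalence (Rch N c) := fun N c => Relation.EqvGen.is_equivalence _
  refine ⟨N, hN, ?_, hdeg⟩
  suffices hsuf : ∀ c p p', π p = π p' → Rch N c p p' by
    intro c r hr h1 _ x y
    have h2 := hQ c (Rch N c) (hEq N c) (fun x y h => Relation.EqvGen.rel _ _ h) (hsuf c) x y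
    have : ∀ x y, Rch N c x y → r x y := by
      intro x y h
      induction h with
      | rel x y h => exact h1 x y h
      | refl x => exact hr.refl x
      | symm x y _ h => exact hr.symm h
      | trans x y z _ _ h h' => exact hr.trans h h'
    exact this x y h2
  by_contra! hcon
  obtain ⟨c₀, p, p', hpp, hnr⟩ := hcon
  have hne : p ≠ p' := by rintro rfl; exact hnr ((hEq N c₀).refl _)
  let H : C → P → P → Prop := fun c x y => x ≠ p ∧ x ≠ p' ∧ y ≠ p ∧ y ≠ p' ∧ 0 < N c x y
  let β : C → P → Set P := fun c x => {y | Relation.EqvGen (H c) x y}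
  have hβ : ∀ c x y, Relation.EqvGen (H c) x y → β c x = β c y := by
    intro c x y h
    ext z
    exact ⟨fun h' => (Relation.EqvGen.symm _ _ h).trans _ _ _ h', fun h' => h.trans _ _ _ h'⟩
  obtain ⟨N', hN', e1, e2, e3, e4, e5, e6, e7, e8⟩ :=
    exch2 hM h0 hN hne (fun x => htw p p' x hpp) β
  have hdpp := hd p p' hpp
  have hdeg' : ∀ c x, ∑ y, N' c x y = 2 * d x := by
    intro c x
    by_cases a : x = p
    · subst a
      have := e2 c; have := e3 c; have := hdeg c x; have := hdeg c p'
      omega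
    by_cases b : x = p'
    · subst b
      have := e2 c; have := e3 c; have := hdeg c x; have := hdeg c p
      -- parity
      omega
    · rw [e1 c x a b, hdeg]
  have hconn : ∀ c, Rch N' c p p' := by
    intro c
    rcases Nat.eq_zero_or_pos (N' c p p') with hz | hz
    swap
    · exact Relation.EqvGen.rel _ _ hz
    have hsplit := sum_split (fun y => N' c p y) hne
    simp only [hz, hN'.diag h0, hdeg'] at hsplit
    obtain ⟨x, hx⟩ : ∃ x, 0 < (if x ≠ p ∧ x ≠ p' then N' c p x else 0) := by
      by_contra! hall
      have : (∑ x, if x ≠ p ∧ x ≠ p' then N' c p x else 0) = 0 :=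
        Finset.sum_eq_zero (fun x _ => Nat.le_zero.1 (hall x))
      have := hdpos p
      omega
    split_ifs at hx with hxp
    swap
    · omega
    -- the branch of x
    let B : Finset P := Finset.univ.filter (fun y => (y ≠ p ∧ y ≠ p') ∧ β c y = β c x)
    have hB : ∀ y, y ∈ B ↔ (y ≠ p ∧ y ≠ p') ∧ β c y = β c x := by intro y; simp [B]
    have hsum : ∀ y ∈ B, ∑ z, N c y z = (∑ z ∈ B, N c y z) + (N c p y + N c p' y) := by
      intro y hy
      rw [sum_split _ hne, hN.symm c y p, hN.symm c y p', add_comm]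
      congr 1
      rw [Finset.sum_filter]
      apply Finset.sum_congr rfl
      intro z _
      by_cases hz : z ≠ p ∧ z ≠ p'
      · by_cases hz' : β c z = β c x
        · simp [hz, hz']
        · simp only [hz, hz', and_false, if_false, ne_eq, not_false_eq_true, and_self, if_true]
          by_contra hpos
          apply hz'
          rw [hB] at hy
          rw [← hy.2]
          exact (hβ c y z (Relation.EqvGen.rel _ _
            ⟨hy.1.1, hy.1.2, hz.1, hz.2, Nat.pos_of_ne_zero hpos⟩)).symm
      · rw [if_neg hz, if_neg (fun h => hz h.1)]
    have hev : Even (∑ y ∈ B, (N c p y + N c p' y)) := by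
      have h1 := even_sum_symm (N c) (hN.symm c) (hN.diag h0 c) B
      have h2 : ∑ y ∈ B, ∑ z, N c y z = (∑ y ∈ B, ∑ z ∈ B, N c y z) + ∑ y ∈ B, (N c p y + N c p' y) := by
        rw [← Finset.sum_add_distrib]; exact Finset.sum_congr rfl hsum
      simp only [hdeg, ← Finset.mul_sum] at h2
      obtain ⟨k, hk⟩ := h1
      exact (Nat.even_add.1 (h2 ▸ even_two_mul _)).1 ⟨k, hk⟩
    have hTN : ∑ y ∈ B, (N c p y + N c p' y) = ∑ y ∈ B, N' c p y + ∑ y ∈ B, N' c p' y := by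
      rw [← Finset.sum_add_distrib]
      apply Finset.sum_congr rfl
      intro y hy
      rw [hB] at hy
      exact (e7 c y hy.1.1 hy.1.2).symm
    have h8 := e8 c (β c x)
    simp only [← Finset.sum_filter] at h8
    change ∑ y ∈ B, N' c p y ≤ ∑ y ∈ B, N' c p' y + 1 ∧ ∑ y ∈ B, N' c p' y ≤ ∑ y ∈ B, N' c p y + 1 at h8
    have hxB : x ∈ B := by rw [hB]; exact ⟨hxp, rfl⟩
    have h9 : 0 < ∑ y ∈ B, N' c p y :=
      lt_of_lt_of_le hx (Finset.single_le_sum (f := fun y => N' c p y) (fun _ _ => Nat.zero_le _) hxB)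
    have h10 : 0 < ∑ y ∈ B, N' c p' y := by
      rw [hTN] at hev
      obtain ⟨k, hk⟩ := hev
      omega
    obtain ⟨y, hyB, hy⟩ := (Finset.sum_pos_iff).1 h10
    have hxy : Relation.EqvGen (H c) y x := by
      have h := ((hB y).1 hyB).2
      have : x ∈ β c x := Relation.EqvGen.refl _
      rw [← h] at this
      exact this
    have hxy' : Rch N' c y x := by
      have E := hEq N' c
      have hH : ∀ a b, H c a b → Rch N' c a b := by
        rintro a b ⟨h1, h2, h3, h4, h5⟩
        refine Relation.EqvGen.rel _ _ ?_
        rw [e5 c a b h1 h2 h3 h4]; exact h5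
      have gen : ∀ a b, Relation.EqvGen (H c) a b → Rch N' c a b := by
       intro a b hab
       induction hab with
       | rel x y h => exact hH x y h
       | refl x => exact E.refl x
       | symm x y _ h => exact E.symm h
       | trans x y z _ _ h h' => exact E.trans h h'
      exact gen _ _ hxy
    have E := hEq N' c
    exact E.trans (Relation.EqvGen.rel _ _ hx) (E.trans (E.symm hxy') (E.symm (Relation.EqvGen.rel _ _ hy)))
  have hmono : ∀ c x y, Rch N c x y → Rch N' c x y := by
    intro c x y h
    have h1 := e4 c (Rch N' c) (hEq N' c) (fun x y h => Relation.EqvGen.rel _ _ h) (hconn c)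
    have E := hEq N' c
    induction h with
    | rel x y h => exact h1 x y h
    | refl x => exact E.refl x
    | symm x y _ h => exact E.symm h
    | trans x y z _ _ h h' => exact E.trans h h'
  have hQ' : QConn π N' := by
    intro c r hr h1 h2
    exact hQ c r hr (e4 c r hr h1 (h2 _ _ hpp)) h2
  have := hmin N' ⟨hN', hQ', hdeg'⟩
  refine absurd this (not_le.2 (Finset.card_lt_card ?_))
  rw [Finset.ssubset_iff_of_subset]
  · exact ⟨(c₀, p, p'), by simpa using hnr, by simpa using hconn c₀⟩
  · intro e he
    simp only [Finset.mem_filter, Finset.mem_univ, true_and] at he ⊢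
    exact fun h => he (hmono _ _ _ h)

end


section
variable {C P : Type*} [Fintype C] [Fintype P] [DecidableEq C] [DecidableEq P]

lemma eq_of_near (f : C → ℕ) (k : ℕ) (hs : ∑ c, f c = Fintype.card C * k)
    (h : ∀ c c', f c ≤ f c' + 1) (c : C) : f c = k := by
  have hc : ∑ _c : C, k = Fintype.card C * k := by simp
  rcases lt_trichotomy (f c) k with h1 | h1 | h1
  · exfalso
    have : ∑ c, f c < ∑ _c : C, k := Finset.sum_lt_sum (fun c' _ => by have := h c' c; omega)
      ⟨c, Finset.mem_univ _, h1⟩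
    omega
  · exact h1
  · exfalso
    have : ∑ _c : C, k < ∑ c, f c := Finset.sum_lt_sum (fun c' _ => by have := h c c'; omega)
      ⟨c, Finset.mem_univ _, h1⟩
    omega

lemma pos_of_near (f : C → ℕ) (hs : Fintype.card C ≤ ∑ c, f c)
    (h : ∀ c c', f c ≤ f c' + 1) (c : C) : 0 < f c := by
  have hc : ∑ _c : C, 1 = Fintype.card C := by simp
  by_contra! h1
  have : ∑ c, f c < ∑ _c : C, 1 := Finset.sum_lt_sum (fun c' _ => by have := h c' c; omega)
      ⟨c, Finset.mem_univ _, by omega⟩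
  omega

lemma card_fib2 (A : Finset (P × P × ℕ)) (Z : P × P × ℕ → Prop) [DecidablePred Z] (S : Finset P) :
    ∑ p ∈ S, ∑ x, (A.filter (fun e => Z e ∧ e.1 = p ∧ e.2.1 = x)).card =
      (A.filter (fun e => Z e ∧ e.1 ∈ S)).card := by
  simp only [Finset.card_filter]
  rw [Finset.sum_congr rfl (fun p _ => Finset.sum_comm), Finset.sum_comm]
  apply Finset.sum_congr rfl
  intro e _
  by_cases h : Z e <;> simp [h, ite_and]

lemma card_fib2' (A : Finset (P × P × ℕ)) (Z : P × P × ℕ → Prop) [DecidablePred Z] (S : Finset P) :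
    ∑ p ∈ S, ∑ x, (A.filter (fun e => Z e ∧ e.1 = x ∧ e.2.1 = p)).card =
      (A.filter (fun e => Z e ∧ e.2.1 ∈ S)).card := by
  simp only [Finset.card_filter]
  rw [Finset.sum_congr rfl (fun p _ => Finset.sum_comm), Finset.sum_comm]
  apply Finset.sum_congr rfl
  intro e _
  by_cases h : Z e <;> simp [h, ite_and]

lemma card_colours {α : Type*} (A : Finset α) (Z : α → Prop) [DecidablePred Z] (φ : α → C) :
    ∑ c, (A.filter (fun e => Z e ∧ φ e = c)).card = (A.filter Z).card := by
  simp only [Finset.card_filter]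
  rw [Finset.sum_comm]
  apply Finset.sum_congr rfl
  intro e _
  by_cases h : Z e <;> simp [h]

set_option maxHeartbeats 1000000 in
lemma start {Q : Type*} [DecidableEq Q] [Nonempty C] (π : P → Q) (d : P → ℕ)
    {M : P → P → ℕ} (hM : ∀ x y, M x y = M y x) (h0 : ∀ x, M x x = 0)
    (hdeg : ∀ p, ∑ x, M p x = 2 * Fintype.card C * d p) :
    ∃ N : C → P → P → ℕ, Col M N ∧
      (∀ c q, ∑ p ∈ Finset.univ.filter (fun p => π p = q), ∑ x, N c p x =
        ∑ p ∈ Finset.univ.filter (fun p => π p = q), 2 * d p) ∧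
      (∀ q q', 2 * Fintype.card C ≤ (∑ p ∈ Finset.univ.filter (fun p => π p = q),
          ∑ p' ∈ Finset.univ.filter (fun p => π p = q'), M p p') + 1 →
        ∀ c, ∃ p p', π p = q ∧ π p' = q' ∧ 0 < N c p p') := by
  classical
  obtain ⟨D, hD⟩ : ∃ D, ∀ p p', M p p' ≤ D :=
    ⟨∑ p, ∑ p', M p p', fun p p' => (Finset.single_le_sum (f := fun x => M p x)
      (fun _ _ => Nat.zero_le _) (Finset.mem_univ p')).trans
      (Finset.single_le_sum (f := fun p => ∑ x, M p x)
      (fun _ _ => Nat.zero_le _) (Finset.mem_univ p))⟩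
  let E : Finset (P × P × ℕ) := (Finset.univ ×ˢ Finset.univ ×ˢ Finset.range D).filter
    (fun e => e.2.2 < M e.1 e.2.1)
  have hE : ∀ e, e ∈ E ↔ e.2.2 < M e.1 e.2.1 := by
    intro e
    simp only [E, Finset.mem_filter, Finset.mem_product, Finset.mem_univ, true_and,
      Finset.mem_range, and_iff_right_iff_imp]
    exact fun h => lt_of_lt_of_le h (hD _ _)
  let rev : P × P × ℕ → P × P × ℕ := fun e => (e.2.1, e.1, e.2.2)
  have hrr : ∀ e, rev (rev e) = e := fun e => rfl
  have hrE : ∀ e ∈ E, rev e ∈ E := by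
    intro e he
    rw [hE] at he ⊢
    show e.2.2 < M e.2.1 e.1
    rw [hM]; exact he
  have hrne : ∀ e ∈ E, rev e ≠ e := by
    intro e he h
    have h1 : e.2.1 = e.1 := congrArg Prod.fst h
    rw [hE, h1, h0] at he
    omega
  have hcardE : ∀ p x, (E.filter (fun e => e.1 = p ∧ e.2.1 = x)).card = M p x := by
    intro p x
    have : E.filter (fun e => e.1 = p ∧ e.2.1 = x) = (Finset.range (M p x)).image (fun k => (p, x, k)) := by
      ext ⟨a, b, k⟩
      simp only [Finset.mem_filter, hE, Finset.mem_image, Finset.mem_range, Prod.mk.injEq]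
      constructor
      · rintro ⟨h, rfl, rfl⟩
        exact ⟨k, h, rfl, rfl, rfl⟩
      · rintro ⟨k, h, rfl, rfl, rfl⟩
        exact ⟨h, rfl, rfl⟩
    rw [this, Finset.card_image_of_injective, Finset.card_range]
    intro a b h
    simpa using h
  obtain ⟨s, s1, -, s3, s4⟩ := disc E (fun e => (s(e.1, e.2.1), e.2.2)) (fun _ => ())
    (fun e => π e.1) (fun e => π e.2.1)
  have hs : ∀ e ∈ E, s (rev e) = !(s e) := by
    intro e he
    have hb := s1 (s(e.1, e.2.1), e.2.2)
    have hF : E.filter (fun x => (s(x.1, x.2.1), x.2.2) = (s(e.1, e.2.1), e.2.2)) = {e, rev e} := by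
      ext ⟨a, b, k⟩
      simp only [Finset.mem_filter, Prod.mk.injEq, Sym2.eq_iff, Finset.mem_insert,
        Finset.mem_singleton]
      constructor
      · rintro ⟨-, h1 | h1, rfl⟩
        · left; rw [h1.1, h1.2]
        · right; rw [h1.1, h1.2]
      · rintro (rfl | h)
        · exact ⟨he, Or.inl ⟨rfl, rfl⟩, rfl⟩
        · have := hrE e he
          rw [← h] at this
          refine ⟨this, Or.inr ?_, ?_⟩
          · exact ⟨congrArg Prod.fst h, congrArg (fun z => z.2.1) h⟩
          · exact congrArg (fun z => z.2.2) h
    rw [hF] at hb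
    unfold Bal at hb
    have hc : ({e, rev e} : Finset (P × P × ℕ)).card = 2 := Finset.card_pair (hrne e he).symm
    by_contra hcon
    have hcon' : s (rev e) = s e := by
      revert hcon; cases s (rev e) <;> cases s e <;> simp
    cases h : s e
    · rw [h] at hcon'
      rw [Finset.filter_true_of_mem (p := fun x => s x = false) (by simp [h, hcon']),
        Finset.filter_false_of_mem (p := fun x => s x = true) (by simp [h, hcon']), hc] at hb
      simp at hb
    · rw [h] at hcon'
      rw [Finset.filter_true_of_mem (p := fun x => s x = true) (by simp [h, hcon']),
        Finset.filter_false_of_mem (p := fun x => s x = false) (by simp [h, hcon']), hc] at hb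
      simp at hb
  let A := E.filter (fun e => s e = true)
  have hrev : ∀ (Z : P × P × ℕ → Prop) [DecidablePred Z], (A.filter (fun e => Z (rev e))).card =
      ((E.filter Z).filter (fun e => s e = false)).card := by
    intro Z _
    refine Finset.card_bij' (fun e _ => rev e) (fun e _ => rev e) ?_ ?_ ?_ ?_
    · intro e he
      simp only [A, Finset.mem_filter] at he ⊢
      exact ⟨⟨hrE e he.1.1, he.2⟩, by rw [hs e he.1.1, he.1.2]; rfl⟩
    · intro e he
      simp only [A, Finset.mem_filter] at he ⊢
      exact ⟨⟨hrE e he.1.1, by rw [hs e he.1.1, he.2]; rfl⟩, he.1.2⟩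
    · intro e _; rfl
    · intro e _; rfl
  have hfwd : ∀ (Z : P × P × ℕ → Prop) [DecidablePred Z], (A.filter Z).card =
      ((E.filter Z).filter (fun e => s e = true)).card := by
    intro Z _
    rw [Finset.filter_comm]
  have hboth : ∀ (Z : P × P × ℕ → Prop) [DecidablePred Z], (A.filter Z).card + (A.filter (fun e => Z (rev e))).card =
      (E.filter Z).card := by
    intro Z _
    rw [hrev, hfwd]
    have := Finset.card_filter_add_card_filter_not (s := E.filter Z) (fun e => s e = true)
    simpa using this
  have hW : ∀ q q', (E.filter (fun e => π e.1 = q ∧ π e.2.1 = q')).card =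
      ∑ p ∈ Finset.univ.filter (fun p => π p = q),
          ∑ p' ∈ Finset.univ.filter (fun p => π p = q'), M p p' := by
    intro q q'
    simp only [← hcardE]
    have := card_fib2 E (fun e => π e.2.1 = q') (Finset.univ.filter (fun p => π p = q))
    simp only [Finset.mem_filter, Finset.mem_univ, true_and] at this
    rw [Finset.filter_congr (fun e _ => and_comm), ← this]
    apply Finset.sum_congr rfl
    intro p _
    rw [Finset.sum_filter]
    apply Finset.sum_congr rfl
    intro x _
    split_ifs with h
    · congr 1
      apply Finset.filter_congr
      rintro e -
      constructor
      · exact fun h => h.2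
      · rintro ⟨h1, h2⟩; exact ⟨by rw [h2, h], h1, h2⟩
    · rw [Finset.card_eq_zero, Finset.filter_eq_empty_iff]
      rintro e - ⟨h1, -, h2⟩
      exact h (by rw [← h2, h1])
  have hO : ∀ q, (E.filter (fun e => π e.1 = q)).card =
      2 * (Fintype.card C * ∑ p ∈ Finset.univ.filter (fun p => π p = q), d p) := by
    intro q
    have := card_fib2 E (fun e => True) (Finset.univ.filter (fun p => π p = q))
    simp only [Finset.mem_filter, Finset.mem_univ, true_and, hcardE, hdeg] at this
    rw [← this, ← Finset.mul_sum]; ring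
  have hout : ∀ q, (A.filter (fun e => π e.1 = q)).card =
      Fintype.card C * ∑ p ∈ Finset.univ.filter (fun p => π p = q), d p := by
    intro q
    have h1 := hboth (fun e => π e.1 = q)
    have h2 := s3 q
    unfold Bal at h2
    rw [← hfwd (fun e => π e.1 = q), ← hrev (fun e => π e.1 = q)] at h2
    rw [hO] at h1
    omega
  have hin : ∀ q, (A.filter (fun e => π e.2.1 = q)).card =
      Fintype.card C * ∑ p ∈ Finset.univ.filter (fun p => π p = q), d p := by
    intro q
    have h1 := hboth (fun e => π e.1 = q)
    have h2 := hout q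
    rw [hO] at h1
    change _ + (A.filter (fun e => π e.2.1 = q)).card = _ at h1
    omega
  obtain ⟨φ, f1, f2, f3⟩ := equi (C := C) A (fun e => π e.1) (fun e => π e.2.1) (fun e => π e.2.1)
  refine ⟨fun c p p' => (A.filter (fun e => φ e = c ∧ e.1 = p ∧ e.2.1 = p')).card +
    (A.filter (fun e => φ e = c ∧ e.1 = p' ∧ e.2.1 = p)).card, ⟨?_, ?_⟩, ?_, ?_⟩
  · intro c x y
    exact add_comm _ _
  · intro x y
    rw [Finset.sum_add_distrib]
    have g1 := card_colours A (fun e => e.1 = x ∧ e.2.1 = y) φ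
    have g2 := card_colours A (fun e => e.1 = y ∧ e.2.1 = x) φ
    simp only [and_comm (a := φ _ = _)]
    rw [g1, g2, ← hcardE x y, ← hboth (fun e => e.1 = x ∧ e.2.1 = y)]
    congr 2
    apply Finset.filter_congr
    intro e _
    exact and_comm
  · intro c q
    simp only [Finset.sum_add_distrib]
    rw [card_fib2 A (fun e => φ e = c), card_fib2' A (fun e => φ e = c)]
    simp only [Finset.mem_filter, Finset.mem_univ, true_and]
    have g1 := eq_of_near (fun c => (A.filter (fun e => π e.1 = q ∧ φ e = c)).card) _
      ((card_colours A (fun e => π e.1 = q) φ).trans (hout q)) (f1 q) c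
    have g2 := eq_of_near (fun c => (A.filter (fun e => π e.2.1 = q ∧ φ e = c)).card) _
      ((card_colours A (fun e => π e.2.1 = q) φ).trans (hin q)) (f3 q) c
    simp only [and_comm (a := φ _ = _)]
    rw [g1, g2, ← Finset.mul_sum]
    ring
  · intro q q' hq c
    rw [← hW] at hq
    have h1 := hboth (fun e => π e.1 = q ∧ π e.2.1 = q')
    have h2 := s4 q q'
    unfold Bal at h2
    rw [← hfwd (fun e => π e.1 = q ∧ π e.2.1 = q'), ← hrev (fun e => π e.1 = q ∧ π e.2.1 = q')] at h2
    have h3 : Fintype.card C ≤ (A.filter (fun e => π e.1 = q ∧ π e.2.1 = q')).card ∨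
        Fintype.card C ≤ (A.filter (fun e => π e.1 = q' ∧ π e.2.1 = q)).card := by
      change _ + (A.filter (fun e => π e.2.1 = q ∧ π e.1 = q')).card = _ at h1
      change _ ≤ (A.filter (fun e => π e.2.1 = q ∧ π e.1 = q')).card + 1 ∧
        (A.filter (fun e => π e.2.1 = q ∧ π e.1 = q')).card ≤ _ at h2
      simp only [and_comm (a := π _ = q')]
      omega
    rcases h3 with h3 | h3
    · have := pos_of_near (fun c => (A.filter (fun e => (π e.1 = q ∧ π e.2.1 = q') ∧ φ e = c)).card)
        (by rw [card_colours A (fun e => π e.1 = q ∧ π e.2.1 = q') φ]; exact h3) (f2 q q') c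
      obtain ⟨e, he⟩ := Finset.card_pos.1 this
      simp only [Finset.mem_filter] at he
      refine ⟨e.1, e.2.1, he.2.1.1, he.2.1.2, Nat.add_pos_left (Finset.card_pos.2 ⟨e, ?_⟩) _⟩
      simp only [Finset.mem_filter]
      exact ⟨he.1, he.2.2, by simp⟩
    · have := pos_of_near (fun c => (A.filter (fun e => (π e.1 = q' ∧ π e.2.1 = q) ∧ φ e = c)).card)
        (by rw [card_colours A (fun e => π e.1 = q' ∧ π e.2.1 = q) φ]; exact h3) (f2 q' q) c
      obtain ⟨e, he⟩ := Finset.card_pos.1 this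
      simp only [Finset.mem_filter] at he
      refine ⟨e.2.1, e.1, he.2.1.2, he.2.1.1, Nat.add_pos_right _ (Finset.card_pos.2 ⟨e, ?_⟩)⟩
      simp only [Finset.mem_filter]
      exact ⟨he.1, he.2.2, by simp⟩

end


section
variable {C : Type*} [Fintype C]

lemma exists_sub_sum (f : C → ℕ) (k : ℕ) (hk : k ≤ ∑ c, f c) :
    ∃ h : C → ℕ, (∀ c, h c ≤ f c) ∧ ∑ c, h c = k := by
  classical
  induction k with
  | zero => exact ⟨fun _ => 0, fun _ => Nat.zero_le _, by simp⟩
  | succ k ih =>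
    obtain ⟨h, h1, h2⟩ := ih (by omega)
    obtain ⟨c, hc⟩ : ∃ c, h c < f c := by
      by_contra! hcon
      have := Finset.sum_le_sum (fun c (_ : c ∈ Finset.univ) => hcon c)
      omega
    refine ⟨Function.update h c (h c + 1), ?_, ?_⟩
    · intro d
      by_cases hd : d = c
      · subst hd; simpa using hc
      · simpa [hd] using h1 d
    · rw [Finset.sum_update_of_mem (Finset.mem_univ c)]
      rw [← Finset.sum_erase_add _ _ (Finset.mem_univ c), Finset.erase_eq] at h2
      omega

lemma transport {X : Type*} (S : Finset X) (m : X → ℕ) : ∀ (f : C → ℕ),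
    ∑ c, f c = ∑ x ∈ S, m x →
    ∃ g : C → X → ℕ, (∀ x ∈ S, ∑ c, g c x = m x) ∧ ∀ c, ∑ x ∈ S, g c x = f c := by
  classical
  induction S using Finset.induction_on with
  | empty =>
    intro f hf
    refine ⟨fun _ _ => 0, by simp, fun c => ?_⟩
    have := (Finset.sum_eq_zero_iff.1 (by simpa using hf : ∑ c, f c = 0)) c (Finset.mem_univ c)
    simp [this]
  | insert a S ha ih =>
    intro f hf
    rw [Finset.sum_insert ha] at hf
    obtain ⟨h, h1, h2⟩ := exists_sub_sum f (m a) (by omega)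
    have h3 : ∑ c, (f c - h c) = ∑ x ∈ S, m x := by
      have : ∑ c, (f c - h c) + ∑ c, h c = ∑ c, f c := by
        rw [← Finset.sum_add_distrib]
        exact Finset.sum_congr rfl (fun c _ => Nat.sub_add_cancel (h1 c))
      omega
    obtain ⟨g, g1, g2⟩ := ih _ h3
    refine ⟨fun c => Function.update (g c) a (h c), ?_, ?_⟩
    · intro x hx
      by_cases hxa : x = a
      · subst hxa; simpa using h2
      · simpa [hxa] using g1 x ((Finset.mem_insert.1 hx).resolve_left hxa)
    · intro c
      rw [Finset.sum_insert ha]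
      have : ∑ x ∈ S, Function.update (g c) a (h c) x = ∑ x ∈ S, g c x := by
        apply Finset.sum_congr rfl
        intro x hx
        rw [Function.update_of_ne]
        rintro rfl; exact ha hx
      rw [this, g2]
      simp only [Function.update_self]
      have := h1 c
      omega

lemma lift_col {U P : Type*} [Fintype U] [Fintype P] [DecidableEq P] (ρ : U → P)
    {M : U → U → ℕ} (hM : ∀ u v, M u v = M v u) (h0 : ∀ u v, ρ u = ρ v → M u v = 0)
    {M' : P → P → ℕ} (hM' : ∀ p p', M' p p' = ∑ u ∈ Finset.univ.filter (fun u => ρ u = p),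
      ∑ v ∈ Finset.univ.filter (fun u => ρ u = p'), M u v)
    {n : C → P → P → ℕ} (hn : Col M' n) :
    ∃ N : C → U → U → ℕ, Col M N ∧ ∀ c p p', ∑ u ∈ Finset.univ.filter (fun u => ρ u = p),
      ∑ v ∈ Finset.univ.filter (fun u => ρ u = p'), N c u v = n c p p' := by
  classical
  let e := Fintype.equivFin P
  have key : ∀ p p', ∃ g : C → U × U → ℕ,
      (∀ x ∈ (Finset.univ.filter (fun u => ρ u = p)) ×ˢ (Finset.univ.filter (fun u => ρ u = p')),
        ∑ c, g c x = M x.1 x.2) ∧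
      ∀ c, ∑ x ∈ (Finset.univ.filter (fun u => ρ u = p)) ×ˢ (Finset.univ.filter (fun u => ρ u = p')),
        g c x = n c p p' := by
    intro p p'
    apply transport
    rw [hn.sum, hM', Finset.sum_product]
  choose g g1 g2 using key
  refine ⟨fun c u v => if e (ρ u) < e (ρ v) then g (ρ u) (ρ v) c (u, v) else
    if e (ρ v) < e (ρ u) then g (ρ v) (ρ u) c (v, u) else 0, ⟨?_, ?_⟩, ?_⟩
  · intro c x y
    rcases lt_trichotomy (e (ρ x)) (e (ρ y)) with h | h | h
    · simp [h, h.le]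
    · simp [h]
    · simp [h, h.le]
  · intro x y
    rcases lt_trichotomy (e (ρ x)) (e (ρ y)) with h | h | h
    · simp only [h, if_true]
      exact g1 (ρ x) (ρ y) (x, y) (by simp)
    · simp [h, h0 x y (e.injective h)]
    · simp only [h, if_true, not_lt.2 h.le, if_false]
      rw [hM]
      exact g1 (ρ y) (ρ x) (y, x) (by simp)
  · intro c p p'
    rcases lt_trichotomy (e p) (e p') with h | h | h
    · rw [← g2, Finset.sum_product]
      apply Finset.sum_congr rfl
      intro u hu
      apply Finset.sum_congr rfl
      intro v hv
      simp only [Finset.mem_filter, Finset.mem_univ, true_and] at hu hv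
      simp [hu, hv, h]
    · have hpp := e.injective h
      subst hpp
      have hz : M' p p = 0 := by
        rw [hM']
        apply Finset.sum_eq_zero; intro u hu
        apply Finset.sum_eq_zero; intro v hv
        simp only [Finset.mem_filter, Finset.mem_univ, true_and] at hu hv
        exact h0 u v (hu.trans hv.symm)
      have hz' : n c p p = 0 := by
        have := hn.sum p p
        rw [hz] at this
        exact Finset.sum_eq_zero_iff.1 this c (Finset.mem_univ c)
      rw [hz']
      apply Finset.sum_eq_zero; intro u hu
      apply Finset.sum_eq_zero; intro v hv
      simp only [Finset.mem_filter, Finset.mem_univ, true_and] at hu hv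
      simp [hu, hv]
    · rw [hn.symm, ← g2, Finset.sum_product, Finset.sum_comm]
      apply Finset.sum_congr rfl
      intro u hu
      apply Finset.sum_congr rfl
      intro v hv
      simp only [Finset.mem_filter, Finset.mem_univ, true_and] at hu hv
      simp [hu, hv, h, h.le]

end


section
variable {ι : Type*} [Fintype ι] [DecidableEq ι]

/-- Multiplicities at the level of parts, with the extra vertex `none`. -/
def MP (a : ι → ℕ) (b : ℕ) : Option ι → Option ι → ℕ
  | none, none => 0
  | none, some i => a i * (a i - b)
  | some i, none => a i * (a i - b)
  | some i, some j => if i = j then 0 else a i * a j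

/-- Weights of the parts. -/
def dP (a : ι → ℕ) : Option ι → ℕ
  | none => 1
  | some i => a i

lemma MP_symm (a : ι → ℕ) (b : ℕ) (x y) : MP a b x y = MP a b y x := by
  rcases x with _ | i <;> rcases y with _ | j <;> simp only [MP]
  by_cases h : i = j
  · simp [h]
  · simp [h, Ne.symm h, mul_comm]

lemma MP_diag (a : ι → ℕ) (b : ℕ) (x) : MP a b x x = 0 := by
  rcases x with _ | i <;> simp [MP]

lemma MP_twin (a : ι → ℕ) (b : ℕ) (p p' x : Option ι) (h : p.map a = p'.map a)
    (h1 : x ≠ p) (h2 : x ≠ p') : MP a b p x = MP a b p' x := by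
  rcases p with _ | i <;> rcases p' with _ | j <;> simp at h
  · rfl
  · rcases x with _ | k <;> simp only [MP]
    · rw [h]
    · rw [if_neg, if_neg, h]
      · rintro rfl; exact h2 rfl
      · rintro rfl; exact h1 rfl

lemma MP_deg (a : ι → ℕ) (b t : ℕ) (hb : ∀ i, b ≤ a i) (hn : ∑ i, a i = b + 2 * t)
    (hs : ∑ i, a i * (a i - b) = 2 * t) (p) : ∑ x, MP a b p x = 2 * t * dP a p := by
  rcases p with _ | i
  · simp [Fintype.sum_option, MP, dP, hs]
  · simp only [Fintype.sum_option, MP, dP]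
    have h1 : ∑ j, (if i = j then 0 else a i * a j) + a i * a i = a i * (b + 2 * t) := by
      rw [← hn, Finset.mul_sum, ← Finset.sum_erase_add _ _ (Finset.mem_univ i),
        ← Finset.sum_erase_add (Finset.univ) (fun j => a i * a j) (Finset.mem_univ i)]
      simp only [if_true, add_zero]
      congr 1
      apply Finset.sum_congr rfl
      intro j hj
      rw [if_neg (Finset.ne_of_mem_erase hj).symm]
    obtain ⟨k, hk⟩ := Nat.exists_eq_add_of_le (hb i)
    have h2 : a i - b = k := by omega
    rw [h2]
    nlinarith

/-- Total weight of the parts of size `α`. -/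
def wt (a : ι → ℕ) (α : ℕ) : ℕ := ∑ i ∈ Finset.univ.filter (fun i => a i = α), a i

lemma MP_group (a : ι → ℕ) (b : ℕ) {α β : ℕ} (h : α ≠ β) :
    ∑ p ∈ Finset.univ.filter (fun p : Option ι => p.map a = some α),
      ∑ p' ∈ Finset.univ.filter (fun p : Option ι => p.map a = some β), MP a b p p' =
      wt a α * wt a β := by
  simp only [Finset.sum_filter, Fintype.sum_option, wt, Option.map_none, Option.map_some,
    Option.some.injEq, reduceCtorEq, if_false, zero_add, MP]
  rw [Finset.sum_mul]
  apply Finset.sum_congr rfl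
  intro i _
  split_ifs with hi
  · rw [Finset.mul_sum]
    apply Finset.sum_congr rfl
    intro j _
    split_ifs with hj hij
    · subst hij; exact absurd (hi.symm.trans hj) h
    · rfl
    · simp
  · simp

lemma wt_ge (a : ι → ℕ) (i : ι) : a i ≤ wt a (a i) :=
  Finset.single_le_sum (f := fun i => a i) (fun _ _ => Nat.zero_le _) (by simp)

lemma exists_of_wt (a : ι → ℕ) {α : ℕ} (h : 0 < wt a α) : ∃ i, a i = α := by
  obtain ⟨i, hi, -⟩ := Finset.sum_pos_iff.1 h
  exact ⟨i, by simpa using hi⟩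

lemma wt_arith (a : ι → ℕ) (b t : ℕ) (hb : ∀ i, b ≤ a i) (hn : ∑ i, a i = b + 2 * t)
    (hs : ∑ i, a i * (a i - b) = 2 * t) :
    b ≤ wt a b ∧ 2 * t + 2 * b ≤ 2 * wt a b + wt a (b + 1) := by
  have h1 : ∑ i, a i * (a i - b) + b = ∑ i, a i := by omega
  have h2 : ∀ i, (if a i = b + 1 then a i else 0) + 2 * (a i) ≤
      a i * (a i - b) + 2 * (if a i = b then a i else 0) + 2 * (if a i = b + 1 then a i else 0) := by
    intro i
    obtain ⟨k, hk⟩ := Nat.exists_eq_add_of_le (hb i)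
    have h3 : a i - b = k := by omega
    rw [h3]
    split_ifs with h4 h5 h5
    · omega
    · have : k = 1 := by omega
      subst this; omega
    · omega
    · have : 2 ≤ k := by omega
      nlinarith
  have h3 := Finset.sum_le_sum (fun i (_ : i ∈ Finset.univ) => h2 i)
  simp only [Finset.sum_add_distrib, ← Finset.mul_sum] at h3
  simp only [← Finset.sum_filter] at h3
  change wt a (b + 1) + 2 * _ ≤ _ + 2 * wt a b + 2 * wt a (b + 1) at h3
  have h6 : ∀ i, a i ≤ a i * (a i - b) + (if a i = b then a i else 0) := by
    intro i
    split_ifs with h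
    · omega
    · have := hb i
      exact Nat.le_mul_of_pos_right _ (by omega)
  have h7 := Finset.sum_le_sum (fun i (_ : i ∈ Finset.univ) => h6 i)
  simp only [Finset.sum_add_distrib] at h7
  simp only [← Finset.sum_filter] at h7
  change _ ≤ _ + wt a b at h7
  constructor <;> omega

lemma part_conn (a : ι → ℕ) (ha : ∀ i, 0 < a i) (b t : ℕ) (hb : ∀ i, b ≤ a i)
    (hn : ∑ i, a i = b + 2 * t) (ht : 0 < t)
    (hs : ∑ i, a i * (a i - b) = 2 * t) :
    ∃ N : Fin t → Option ι → Option ι → ℕ, Col (MP a b) N ∧ QConn id N ∧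
      ∀ c p, ∑ x, N c p x = 2 * dP a p := by
  haveI : Nonempty (Fin t) := ⟨⟨0, ht⟩⟩
  have hdeq : ∀ x y : Option ι, x.map a = y.map a → dP a x = dP a y := by
    intro x y h
    rcases x with _ | i <;> rcases y with _ | j <;> simp at h
    · rfl
    · exact h
  have hdpos : ∀ x : Option ι, 0 < dP a x := by
    intro x
    rcases x with _ | i
    · exact Nat.one_pos
    · exact ha i
  apply refine_conn (fun p : Option ι => p.map a) (dP a) hdpos hdeq (MP_symm a b) (MP_diag a b)
    (fun p p' x h h1 h2 => MP_twin a b p p' x h h1 h2)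
  apply refine_deg (fun p : Option ι => p.map a) (dP a) hdeq (MP_symm a b) (MP_diag a b)
    (fun p p' x h h1 h2 => MP_twin a b p p' x h h1 h2)
  obtain ⟨N, hN, hdeg, hjoin⟩ := start (C := Fin t) (fun p : Option ι => p.map a) (dP a) (MP_symm a b)
    (MP_diag a b) (by rw [Fintype.card_fin]; exact MP_deg a b t hb hn hs)
  refine ⟨N, hN, ?_, hdeg⟩
  intro c r hr h1 h2
  have hj : ∀ i j, a i ≠ a j → 2 * t ≤ wt a (a i) * wt a (a j) + 1 → r (some i) (some j) := by
    intro i j hij hw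
    obtain ⟨p, p', hp, hp', hpos⟩ := hjoin (some (a i)) (some (a j))
      (by rw [MP_group a b hij, Fintype.card_fin]; exact hw) c
    exact hr.trans (h2 (some i) p hp.symm) (hr.trans (h1 _ _ hpos) (h2 p' (some j) hp'))
  obtain ⟨i₁, hi₁⟩ : ∃ i, r none (some i) := by
    have := hdeg c none
    have hf : Finset.univ.filter (fun p : Option ι => p.map a = none) = {none} := by
      ext p; simp
    rw [hf] at this
    simp only [Finset.sum_singleton, dP] at this
    obtain ⟨x, -, hx⟩ := Finset.sum_pos_iff.1 (by omega : 0 < ∑ x, N c none x)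
    rcases x with _ | i
    · have := Col.diag hN (MP_diag a b) c none
      omega
    · exact ⟨i, h1 _ _ hx⟩
  suffices hsuf : ∃ i₀, ∀ i, r (some i) (some i₀) by
    obtain ⟨i₀, hi₀⟩ := hsuf
    have : ∀ x, r x (some i₀) := by
      intro x
      rcases x with _ | i
      · exact hr.trans hi₁ (hi₀ _)
      · exact hi₀ i
    exact fun x y => hr.trans (this x) (hr.symm (this y))
  rcases Nat.eq_zero_or_pos b with hb0 | hb0
  · subst hb0
    refine ⟨i₁, fun i => h2 _ _ ?_⟩
    have hone : ∀ i, a i = 1 := by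
      intro i
      have h3 : ∀ i ∈ Finset.univ, a i ≤ a i * (a i - 0) := fun i _ =>
        Nat.le_mul_of_pos_right _ (by have := ha i; omega)
      have h4 := (Finset.sum_eq_sum_iff_of_le h3).1 (by omega) i (Finset.mem_univ i)
      have := ha i
      simp only [Nat.sub_zero] at h4
      nlinarith
    simp [hone]
  · obtain ⟨w1, w2⟩ := wt_arith a b t hb hn hs
    obtain ⟨i₀, hi₀⟩ := exists_of_wt a (lt_of_lt_of_le hb0 w1)
    refine ⟨i₀, fun i => ?_⟩
    have hmid : ∀ i, a i = b + 1 → r (some i) (some i₀) := by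
      intro i hi
      apply hj
      · omega
      · have := wt_ge a i
        rw [hi] at this ⊢
        rw [hi₀]
        obtain ⟨u, hu⟩ := Nat.exists_eq_add_of_le (show 1 ≤ wt a b by omega)
        obtain ⟨v, hv⟩ := Nat.exists_eq_add_of_le (show 2 ≤ wt a (b + 1) by omega)
        rw [hu, hv] at w2 ⊢
        nlinarith [Nat.zero_le (u * v)]
    rcases lt_trichotomy (a i) (b + 1) with hi | hi | hi
    · apply h2
      have := hb i
      simp only [Option.map_some, Option.some.injEq]
      omega
    · exact hmid i hi
    · have h3 := wt_ge a i
      have h4 : 3 ≤ wt a (a i) := by omega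
      by_cases hpq : wt a (b + 1) ≤ wt a b
      · apply hj
        · omega
        · rw [hi₀]; nlinarith
      · obtain ⟨j, hjb⟩ := exists_of_wt a (show 0 < wt a (b + 1) by omega)
        refine hr.trans (hj i j (by omega) ?_) (hmid j hjb)
        rw [hjb]; nlinarith

variable (V : ι → Type*) [∀ i, Fintype (V i)] [∀ i, DecidableEq (V i)]

/-- Multiplicities at the level of vertices, with the extra vertex `none`. -/
def MU (b : ℕ) : Option (Σ i, V i) → Option (Σ i, V i) → ℕ
  | none, none => 0
  | none, some u => Fintype.card (V u.1) - b
  | some u, none => Fintype.card (V u.1) - b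
  | some u, some v => if u.1 = v.1 then 0 else 1

lemma MU_symm (b : ℕ) (x y) : MU V b x y = MU V b y x := by
  rcases x with _ | i <;> rcases y with _ | j <;> simp only [MU]
  by_cases h : i.1 = j.1
  · simp [h]
  · simp [h, Ne.symm h]

lemma MU_zero (b : ℕ) (x y : Option (Σ i, V i)) (h : x.map Sigma.fst = y.map Sigma.fst) :
    MU V b x y = 0 := by
  rcases x with _ | i <;> rcases y with _ | j <;> simp at h
  · rfl
  · simp [MU, h]

lemma MU_twin (b : ℕ) (p p' x : Option (Σ i, V i)) (h : p.map Sigma.fst = p'.map Sigma.fst) :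
    MU V b p x = MU V b p' x := by
  rcases p with _ | i <;> rcases p' with _ | j <;> simp at h
  · rfl
  · rcases x with _ | k <;> simp only [MU] <;> rw [h]

lemma sum_part (f : ι → ℕ) (j : ι) :
    (∑ i, ∑ _y : V i, if i = j then f i else 0) = Fintype.card (V j) * f j := by
  simp only [Finset.sum_const, Finset.card_univ, smul_eq_mul, mul_ite, mul_zero]
  simp

lemma MP_MU (b : ℕ) (p p' : Option ι) : MP (fun i => Fintype.card (V i)) b p p' =
    ∑ u ∈ Finset.univ.filter (fun u : Option (Σ i, V i) => u.map Sigma.fst = p),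
      ∑ v ∈ Finset.univ.filter (fun u : Option (Σ i, V i) => u.map Sigma.fst = p'), MU V b u v := by
  rcases p with _ | i <;> rcases p' with _ | j <;>
  simp only [Finset.sum_filter, Fintype.sum_option, Fintype.sum_sigma, MU, MP, Option.map_none,
    Option.map_some, Option.some.injEq, reduceCtorEq, if_true, if_false]
  · simp
  · simp only [zero_add, Finset.sum_const_zero, add_zero]
    exact (sum_part V (fun i => Fintype.card (V i) - b) j).symm
  · simp only [Finset.sum_const_zero, add_zero, zero_add]
    exact (sum_part V (fun j => Fintype.card (V j) - b) i).symm
  · by_cases h : i = j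
    · subst h
      simp
    · simp [h]

lemma card_fibre (p : Option ι) :
    (Finset.univ.filter (fun u : Option (Σ i, V i) => u.map Sigma.fst = p)).card =
      dP (fun i => Fintype.card (V i)) p := by
  rcases p with _ | i <;>
  rw [Finset.card_filter]
  · simp [- Finset.sum_boole, Fintype.sum_option, Fintype.sum_sigma, dP]
  · simp only [Fintype.sum_option, Fintype.sum_sigma, dP, Option.map_none,
      Option.map_some, Option.some.injEq, reduceCtorEq, if_false, zero_add]
    rw [sum_part V (fun _ => 1) i, mul_one]

lemma two_factors [∀ i, Nonempty (V i)] (b t : ℕ) (hb : ∀ i, b ≤ Fintype.card (V i))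
    (hn : ∑ i, Fintype.card (V i) = b + 2 * t) (ht : 0 < t)
    (hs : ∑ i, Fintype.card (V i) * (Fintype.card (V i) - b) = 2 * t) :
    ∃ N : Fin t → Option (Σ i, V i) → Option (Σ i, V i) → ℕ, Col (MU V b) N ∧ QConn id N ∧
      ∀ c p, ∑ x, N c p x = 2 := by
  obtain ⟨n, hn, hQ, hdeg⟩ := part_conn (fun i => Fintype.card (V i)) (fun i => Fintype.card_pos)
    b t hb hn ht hs
  obtain ⟨N, hN, hNn⟩ := lift_col (fun u : Option (Σ i, V i) => u.map Sigma.fst) (MU_symm V b)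
    (MU_zero V b) (MP_MU V b) hn
  apply refine_conn (fun u : Option (Σ i, V i) => u.map Sigma.fst) (fun _ => 1) (fun _ => Nat.one_pos)
    (fun _ _ _ => rfl) (MU_symm V b) (fun x => MU_zero V b x x rfl)
    (fun p p' x h _ _ => MU_twin V b p p' x h)
  apply refine_deg (fun u : Option (Σ i, V i) => u.map Sigma.fst) (fun _ => 1)
    (fun _ _ _ => rfl) (MU_symm V b) (fun x => MU_zero V b x x rfl)
    (fun p p' x h _ _ => MU_twin V b p p' x h)
  refine ⟨N, hN, ?_, ?_⟩
  · intro c r hr h1 h2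
    let sec : Option ι → Option (Σ i, V i) := fun p => p.map (fun i => ⟨i, Classical.arbitrary (V i)⟩)
    have hsec : ∀ p, (sec p).map Sigma.fst = p := by
      intro p; rcases p with _ | i <;> rfl
    have key : ∀ p p', r (sec p) (sec p') := by
      refine hQ c (fun p p' => r (sec p) (sec p'))
        ⟨fun _ => hr.refl _, fun h => hr.symm h, fun h h' => hr.trans h h'⟩ ?_ ?_
      · intro p p' hpos
        rw [← hNn] at hpos
        obtain ⟨u, hu, hpos⟩ := Finset.sum_pos_iff.1 hpos
        obtain ⟨v, hv, hpos⟩ := Finset.sum_pos_iff.1 hpos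
        simp only [Finset.mem_filter, Finset.mem_univ, true_and] at hu hv
        exact hr.trans (h2 _ _ ((hsec p).trans hu.symm)) (hr.trans (h1 _ _ hpos)
          (h2 _ _ (hv.trans (hsec p').symm)))
      · intro p p' h
        cases (show p = p' from h)
        exact hr.refl _
    intro x y
    exact hr.trans (h2 _ _ (hsec _).symm) (hr.trans (key (x.map Sigma.fst) (y.map Sigma.fst))
      (h2 _ _ (hsec _)))
  · intro c p
    rw [Finset.sum_const, card_fibre, smul_eq_mul, mul_one, mul_comm, ← hdeg c p]
    simp only [← hNn]
    conv_rhs => rw [Finset.sum_comm]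
    apply Finset.sum_congr rfl
    intro u _
    rw [← Finset.sum_fiberwise (s := Finset.univ) (g := fun u : Option (Σ i, V i) => u.map Sigma.fst)]

end


section
variable {W : Type*} [Fintype W] [DecidableEq W]

lemma two_nbrs {U : Type*} [Fintype U] [DecidableEq U] (f : U → ℕ) (hf : ∑ x, f x = 2) {a b z : U}
    (hab : a ≠ b) (ha : 0 < f a) (hb : 0 < f b) (hz : 0 < f z) : z = a ∨ z = b := by
  by_contra! h
  have h1 : ∑ x ∈ ({a, b, z} : Finset U), f x ≤ ∑ x, f x :=
    Finset.sum_le_sum_of_subset (Finset.subset_univ _)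
  rw [Finset.sum_insert (by simp [hab, h.1.symm]), Finset.sum_insert (by simp [h.2.symm]),
    Finset.sum_singleton] at h1
  omega

lemma extract (G : SimpleGraph W) (K : Option W → Option W → ℕ) (hsym : ∀ x y, K x y = K y x)
    (h0 : ∀ x, K x x = 0) (hdeg : ∀ u, ∑ x, K u x = 2)
    (hconn : ∀ r : Option W → Option W → Prop, Equivalence r → (∀ x y, 0 < K x y → r x y) →
      ∀ x y, r x y)
    (hG : ∀ x y, 0 < K (some x) (some y) → G.Adj x y) :
    ∃ (u v : W) (p : G.Walk u v), p.IsHamiltonian ∧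
      ∀ x y, s(x, y) ∈ p.edges ↔ 0 < K (some x) (some y) := by
  let H : SimpleGraph W :=
    { Adj := fun x y => 0 < K (some x) (some y)
      symm := ⟨fun x y h => by rw [hsym]; exact h⟩
      loopless := ⟨fun x h => by rw [h0] at h; omega⟩ }
  have hHG : H ≤ G := fun x y h => hG x y h
  obtain ⟨s, hs⟩ : ∃ s, 0 < K none (some s) := by
    obtain ⟨x, -, hx⟩ := Finset.sum_pos_iff.1 (by rw [hdeg none]; omega : 0 < ∑ x, K none x)
    rcases x with _ | s
    · rw [h0] at hx; omega
    · exact ⟨s, hx⟩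
  obtain ⟨e, p, hp, hmax⟩ : ∃ (e : W) (p : H.Walk s e), p.IsPath ∧
      ∀ (e' : W) (p' : H.Walk s e'), p'.IsPath → p'.length ≤ p.length := by
    let S : Set ℕ := {k | ∃ (e : W) (p : H.Walk s e), p.IsPath ∧ p.length = k}
    have hne : S.Nonempty := ⟨0, s, SimpleGraph.Walk.nil, by simp, rfl⟩
    have hbdd : BddAbove S := ⟨Fintype.card W, by
      rintro k ⟨e, p, hp, rfl⟩
      exact hp.length_lt.le⟩
    obtain ⟨e, p, hp, hl⟩ := Nat.sSup_mem hne hbdd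
    exact ⟨e, p, hp, fun e' p' hp' => by rw [hl]; exact le_csSup hbdd ⟨e', p', hp', rfl⟩⟩
  let f : ℕ → Option W := fun k => match k with
    | 0 => none
    | k + 1 => some (p.getVert k)
  have hinj : ∀ i j, i ≤ p.length + 1 → j ≤ p.length + 1 → f i = f j → i = j := by
    intro i j hi hj hij
    rcases i with _ | i <;> rcases j with _ | j
    · rfl
    · simp [f] at hij
    · simp [f] at hij
    · have := hp.getVert_injOn (show i ∈ {i | i ≤ p.length} by simp; omega)
        (show j ∈ {i | i ≤ p.length} by simp; omega) (by simpa [f] using hij)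
      omega
  have hadj : ∀ i, i ≤ p.length → 0 < K (f i) (f (i + 1)) := by
    intro i hi
    rcases i with _ | i
    · simpa [f] using hs
    · exact p.adj_getVert_succ (by omega)
  have hnb : ∀ i z, i < p.length → 0 < K (f (i + 1)) z → z = f i ∨ z = f (i + 2) := by
    intro i z hi hz
    refine two_nbrs (K (f (i + 1))) (hdeg _) ?_ ?_ ?_ hz
    · intro h
      have := hinj i (i + 2) (by omega) (by omega) h
      omega
    · rw [hsym]; exact hadj i (by omega)
    · exact hadj (i + 1) (by omega)
  -- the set of vertices on the path
  have hclosed : ∀ x y, x ∈ p.support → 0 < K (some x) (some y) → y ∈ p.support := by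
    intro x y hx hxy
    obtain ⟨i, rfl, hi⟩ := SimpleGraph.Walk.mem_support_iff_exists_getVert.1 hx
    rcases hi.lt_or_eq with hi | hi
    · rcases hnb i (some y) hi hxy with h | h
      · rcases i with _ | i
        · simp [f] at h
        · simp only [f, Option.some.injEq] at h
          rw [h]; exact p.getVert_mem_support _
      · simp only [f, Option.some.injEq] at h
        rw [h]; exact p.getVert_mem_support _
    · by_contra hy
      rw [hi, p.getVert_length] at hxy
      have := hmax _ _ (hp.concat hy (show H.Adj e y from hxy))
      rw [SimpleGraph.Walk.length_concat] at this
      omega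
  have hinf : ∀ y, 0 < K none (some y) → y ∈ p.support := by
    let B : Finset (Option W) := p.support.toFinset.image some
    have hB : ∀ x, x ∈ B ↔ ∃ w ∈ p.support, some w = x := by
      intro x; simp [B]
    have hnB : none ∉ B := by simp [hB]
    have h1 := even_sum_symm K hsym h0 B
    have h2 : ∑ x ∈ B, ∑ y, K x y = ∑ x ∈ B, ∑ y ∈ B, K x y + ∑ x ∈ B, K x none := by
      rw [← Finset.sum_add_distrib]
      apply Finset.sum_congr rfl
      intro x hx
      rw [add_comm, ← Finset.sum_insert hnB]
      symm
      apply Finset.sum_subset (Finset.subset_univ _)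
      intro y _ hy
      rcases y with _ | y
      · simp at hy
      · by_contra hne
        obtain ⟨w, hw, rfl⟩ := (hB x).1 hx
        apply hy
        rw [Finset.mem_insert, hB]
        exact Or.inr ⟨y, hclosed w y hw (Nat.pos_of_ne_zero hne), rfl⟩
    simp only [hdeg, Finset.sum_const, smul_eq_mul] at h2
    have h3 : ∑ x ∈ B, K x none = ∑ x ∈ B, K none x := Finset.sum_congr rfl (fun x _ => hsym _ _)
    have hsB : some s ∈ B := (hB _).2 ⟨s, p.start_mem_support, rfl⟩
    have h4 : 0 < ∑ x ∈ B, K none x := lt_of_lt_of_le hs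
      (Finset.single_le_sum (f := fun x => K none x) (fun _ _ => Nat.zero_le _) hsB)
    intro y hy
    by_contra hcon
    have hyB : some y ∉ B := by
      rw [hB]; rintro ⟨w, hw, h⟩
      simp only [Option.some.injEq] at h
      subst h; exact hcon hw
    have h5 : ∑ x ∈ insert (some y) B, K none x ≤ ∑ x, K none x :=
      Finset.sum_le_sum_of_subset (Finset.subset_univ _)
    rw [Finset.sum_insert hyB, hdeg] at h5
    obtain ⟨k, hk⟩ := h1
    omega
  have hall : ∀ w, w ∈ p.support := by
    let S : Option W → Prop := fun x => ∀ w, x = some w → w ∈ p.support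
    have hS : ∀ x y, 0 < K x y → S x → S y := by
      intro x y hxy hx w hw
      subst hw
      rcases x with _ | x
      · exact hinf w hxy
      · exact hclosed x w (hx x rfl) hxy
    have := hconn (fun x y => S x ↔ S y) ⟨fun _ => Iff.rfl, fun h => h.symm, fun h h' => h.trans h'⟩
      (fun x y h => ⟨hS x y h, hS y x (by rw [hsym]; exact h)⟩)
    intro w
    exact (this none (some w)).1 (by intro w hw; cases hw) w rfl
  have hedge : ∀ x y, s(x, y) ∈ p.edges ↔ 0 < K (some x) (some y) := by
    intro x y
    constructor
    · intro h
      exact (p.adj_of_mem_edges h : H.Adj x y)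
    · have key : ∀ i y, i < p.length → 0 < K (some (p.getVert i)) (some y) →
          s(p.getVert i, y) ∈ p.edges := by
        intro i y hi h
        rw [SimpleGraph.Walk.mk_mem_edges_iff_exists]
        rcases hnb i (some y) hi h with h | h
        · rcases i with _ | i
          · simp [f] at h
          · simp only [f, Option.some.injEq] at h
            exact ⟨i, by omega, by rw [h]; exact Sym2.eq_swap⟩
        · simp only [f, Option.some.injEq] at h
          exact ⟨i, hi, by rw [h]⟩
      intro h
      obtain ⟨i, rfl, hi⟩ := SimpleGraph.Walk.mem_support_iff_exists_getVert.1 (hall x)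
      obtain ⟨j, rfl, hj⟩ := SimpleGraph.Walk.mem_support_iff_exists_getVert.1 (hall y)
      rcases hi.lt_or_eq with hi | hi
      · exact key i _ hi h
      · rcases hj.lt_or_eq with hj | hj
        · rw [Sym2.eq_swap]
          rw [hsym] at h
          exact key j _ hj h
        · rw [hi, hj, h0] at h; omega
  refine ⟨s, e, p.mapLe hHG, ?_, ?_⟩
  · refine SimpleGraph.Walk.IsPath.isHamiltonian_of_mem (hp.mapLe hHG) ?_
    intro w
    simpa using hall w
  · intro x y
    rw [SimpleGraph.Walk.edges_mapLe_eq_edges]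
    exact hedge x y

end

section necessity
variable {W : Type*} [Fintype W] [DecidableEq W]

lemma path_nbrs {G : SimpleGraph W} {u v : W} (p : G.Walk u v) (hp : p.IsPath) (x : W) :
    ∃ a b, ∀ y, s(x, y) ∈ p.edges → y = a ∨ y = b := by
  by_cases hx : x ∈ p.support
  · obtain ⟨k, rfl, hk⟩ := SimpleGraph.Walk.mem_support_iff_exists_getVert.1 hx
    refine ⟨p.getVert (k - 1), p.getVert (k + 1), fun y hy => ?_⟩
    rw [SimpleGraph.Walk.mk_mem_edges_iff_exists] at hy
    obtain ⟨i, hi, h⟩ := hy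
    rw [Sym2.eq_iff] at h
    have inj := hp.getVert_injOn
    rcases h with ⟨h1, h2⟩ | ⟨h1, h2⟩
    · have := inj (show i ∈ {i | i ≤ p.length} from hi.le) (show k ∈ {i | i ≤ p.length} from hk) h1
      subst this
      exact Or.inr h2.symm
    · have := inj (show i + 1 ∈ {i | i ≤ p.length} from hi) (show k ∈ {i | i ≤ p.length} from hk) h2
      subst this
      exact Or.inl (by simpa using h1.symm)
  · exact ⟨x, x, fun y hy => absurd (p.fst_mem_support_of_mem_edges hy) hx⟩

lemma decomp_card {G : SimpleGraph W} [Fintype G.edgeSet] {t : ℕ}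
    (h : G.HamiltonianPathDecomposition t) :
    G.edgeFinset.card = t * (Fintype.card W - 1) := by
  obtain ⟨u, v, p, hp, hu⟩ := h
  have h1 : G.edgeFinset = Finset.univ.biUnion (fun i => (p i).edges.toFinset) := by
    ext e
    simp only [SimpleGraph.mem_edgeFinset, Finset.mem_biUnion, Finset.mem_univ, true_and,
      List.mem_toFinset]
    constructor
    · intro he
      exact (hu e he).exists
    · rintro ⟨i, hi⟩
      exact (p i).edges_subset_edgeSet hi
  rw [h1, Finset.card_biUnion]
  · have : ∀ i ∈ Finset.univ, ((p i).edges.toFinset).card = Fintype.card W - 1 := by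
      intro i _
      rw [List.toFinset_card_of_nodup (hp i).isPath.isTrail.edges_nodup,
        SimpleGraph.Walk.length_edges, (hp i).length_eq]
    rw [Finset.sum_congr rfl this]
    simp
  · intro i _ j _ hij
    change Disjoint _ _
    rw [Finset.disjoint_left]
    intro e he he'
    rw [List.mem_toFinset] at he he'
    exact hij ((hu e ((p i).edges_subset_edgeSet he)).unique he he')

lemma decomp_deg {G : SimpleGraph W} [DecidableRel G.Adj] {t : ℕ}
    (h : G.HamiltonianPathDecomposition t) (x : W) : G.degree x ≤ 2 * t := by
  obtain ⟨u, v, p, hp, hu⟩ := h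
  choose a b hab using fun i => path_nbrs (p i) (hp i).isPath x
  have h1 : G.neighborFinset x ⊆ Finset.univ.biUnion (fun i => ({a i, b i} : Finset W)) := by
    intro y hy
    rw [SimpleGraph.mem_neighborFinset] at hy
    obtain ⟨i, hi⟩ := (hu s(x, y) hy).exists
    simp only [Finset.mem_biUnion, Finset.mem_univ, true_and, Finset.mem_insert,
      Finset.mem_singleton]
    exact ⟨i, hab i y hi⟩
  rw [← SimpleGraph.card_neighborFinset_eq_degree]
  refine (Finset.card_le_card h1).trans (Finset.card_biUnion_le.trans ?_)
  refine (Finset.sum_le_sum (fun i _ => Finset.card_le_two)).trans ?_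
  simp [mul_comm]

end necessity

section sufficiency
variable {ι : Type*} [Fintype ι] [DecidableEq ι] (V : ι → Type*)
    [∀ i, Fintype (V i)] [∀ i, DecidableEq (V i)]

lemma cm_degree [DecidableRel (completeMultipartiteGraph V).Adj] (u : Σ i, V i) :
    (completeMultipartiteGraph V).degree u + Fintype.card (V u.1) = Fintype.card (Σ i, V i) := by
  have h1 : (completeMultipartiteGraph V).neighborFinset u =
      Finset.univ.filter (fun v => ¬ v.1 = u.1) := by
    ext v
    simp [completeMultipartiteGraph, eq_comm]
  have h2 : (Finset.univ.filter (fun v : Σ i, V i => v.1 = u.1)).card = Fintype.card (V u.1) := by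
    rw [Finset.card_filter, Fintype.sum_sigma, sum_part V (fun _ => 1) u.1, mul_one]
  rw [← SimpleGraph.card_neighborFinset_eq_degree, h1, ← h2, add_comm,
    Finset.card_filter_add_card_filter_not, Finset.card_univ]

lemma suff [∀ i, Nonempty (V i)] [DecidableRel (completeMultipartiteGraph V).Adj]
    (t : ℕ) (h1 : 1 < Fintype.card (Σ i, V i))
    (hm : (completeMultipartiteGraph V).edgeFinset.card = (Fintype.card (Σ i, V i) - 1) * t)
    (hd : ∀ u, (completeMultipartiteGraph V).degree u ≤ 2 * t) :
    (completeMultipartiteGraph V).HamiltonianPathDecomposition t := by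
  rcases Nat.eq_zero_or_pos t with rfl | ht
  · refine ⟨fun i => i.elim0, fun i => i.elim0, fun i => i.elim0, fun i => i.elim0, ?_⟩
    intro e he
    rw [mul_zero, Finset.card_eq_zero] at hm
    rw [← SimpleGraph.mem_edgeFinset, hm] at he
    simp at he
  set n := Fintype.card (Σ i, V i) with hn
  have hsum : ∑ i, Fintype.card (V i) = n := by rw [hn, Fintype.card_sigma]
  have hle : ∀ i, n ≤ 2 * t + Fintype.card (V i) := by
    intro i
    have e1 := hd ⟨i, Classical.arbitrary _⟩
    have e2 := cm_degree V ⟨i, Classical.arbitrary _⟩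
    simp only at e2
    omega
  have hdegsum : ∑ i, Fintype.card (V i) * Fintype.card (V i) + 2 * ((n - 1) * t) = n * n := by
    rw [← hm, ← SimpleGraph.sum_degrees_eq_twice_card_edges]
    have : ∑ i, Fintype.card (V i) * Fintype.card (V i) = ∑ u : Σ i, V i, Fintype.card (V u.1) := by
      rw [Fintype.sum_sigma]
      apply Finset.sum_congr rfl
      intro i _
      change _ = ∑ _y : V i, Fintype.card (V i)
      rw [Finset.sum_const, Finset.card_univ, smul_eq_mul]
    rw [this, ← Finset.sum_add_distrib]
    have h3 : ∀ u ∈ (Finset.univ : Finset (Σ i, V i)),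
        Fintype.card (V u.1) + (completeMultipartiteGraph V).degree u = n := fun u _ => by
      rw [add_comm]; exact cm_degree V u
    rw [Finset.sum_congr rfl h3, Finset.sum_const, Finset.card_univ, smul_eq_mul]
  obtain ⟨k, hk⟩ : ∃ k, n = k + 2 := ⟨n - 2, by omega⟩
  have hk1 : n - 1 = k + 1 := by omega
  rw [hk1] at hdegsum
  have h2t : 2 * t ≤ n := by
    have : n ≤ ∑ i, Fintype.card (V i) * Fintype.card (V i) := by
      rw [← hsum]
      exact Finset.sum_le_sum (fun i _ => Nat.le_mul_of_pos_left _ Fintype.card_pos)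
    by_contra! hcon
    nlinarith
  obtain ⟨b, hb⟩ : ∃ b, n = b + 2 * t := ⟨n - 2 * t, by omega⟩
  have hbi : ∀ i, b ≤ Fintype.card (V i) := fun i => by have := hle i; omega
  have hs : ∑ i, Fintype.card (V i) * (Fintype.card (V i) - b) = 2 * t := by
    have e1 : ∑ i, Fintype.card (V i) * (Fintype.card (V i) - b) + n * b =
        ∑ i, Fintype.card (V i) * Fintype.card (V i) := by
      rw [← hsum, Finset.sum_mul, ← Finset.sum_add_distrib]
      apply Finset.sum_congr rfl
      intro i _
      rw [← mul_add, Nat.sub_add_cancel (hbi i)]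
    have e2 : n * n = n * b + n * (2 * t) := by rw [← mul_add, ← hb]
    have e3 : n * (2 * t) = 2 * ((k + 1) * t) + 2 * t := by rw [hk]; ring
    omega
  obtain ⟨N, hN, hQ, hdeg⟩ := two_factors V b t hbi (hsum.trans hb) ht hs
  have hpos : ∀ c x y, 0 < N c (some x) (some y) → (completeMultipartiteGraph V).Adj x y := by
    intro c x y h
    have e1 := hN.sum (some x) (some y)
    have e2 : N c (some x) (some y) ≤ ∑ c, N c (some x) (some y) :=
      Finset.single_le_sum (f := fun c => N c (some x) (some y)) (fun _ _ => Nat.zero_le _)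
        (Finset.mem_univ c)
    simp only [MU] at e1
    simp only [completeMultipartiteGraph, SimpleGraph.comap_adj, SimpleGraph.top_adj]
    intro hxy
    rw [if_pos hxy] at e1
    omega
  choose u v p hp he using fun c => extract (completeMultipartiteGraph V) (N c) (hN.symm c)
    (hN.diag (fun x => MU_zero V b x x rfl) c) (hdeg c)
    (fun r hr h => hQ c r hr h (fun x y hxy => by cases (show x = y from hxy); exact hr.refl x)) (hpos c)
  refine ⟨u, v, p, hp, ?_⟩
  intro e
  induction e using Sym2.ind with
  | _ x y =>
    intro hxy
    have hxy' : ¬ x.1 = y.1 := by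
      simpa [completeMultipartiteGraph] using hxy
    have e1 := hN.sum (some x) (some y)
    simp only [MU, if_neg hxy'] at e1
    simp only [he]
    obtain ⟨c, -, hc⟩ := Finset.sum_pos_iff.1 (by omega : 0 < ∑ c, N c (some x) (some y))
    refine ⟨c, hc, ?_⟩
    intro c' hc'
    by_contra hne
    rw [sum_two (fun c => N c (some x) (some y)) hne] at e1
    omega

end sufficiency

theorem completeMultipartite_hamiltonian_path_decomposition_iff
    {ι : Type*} [Fintype ι] [DecidableEq ι] (V : ι → Type*)
    [∀ i, Fintype (V i)] [∀ i, DecidableEq (V i)] [∀ i, Nonempty (V i)]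
    (n m : ℕ) (hn : n = Fintype.card (Σ i, V i))
    (hm : m = (completeMultipartiteGraph V).edgeFinset.card)
    (h1 : 1 < n) :
    (∃ t, (completeMultipartiteGraph V).HamiltonianPathDecomposition t) ↔
      (n - 1) ∣ m ∧ (completeMultipartiteGraph V).maxDegree ≤ 2 * m / (n - 1) := by
  constructor
  · rintro ⟨t, ht⟩
    have hc := decomp_card ht
    rw [← hm, ← hn] at hc
    refine ⟨⟨t, by rw [hc, mul_comm]⟩, ?_⟩
    rw [hc, ← mul_assoc, Nat.mul_div_cancel _ (by omega)]
    exact SimpleGraph.maxDegree_le_of_forall_degree_le _ _ (fun x => decomp_deg ht x)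
  · rintro ⟨⟨t, ht⟩, hd⟩
    refine ⟨t, suff V t (hn ▸ h1) (by rw [← hm, ← hn, ht]) ?_⟩
    intro u
    have e1 : 2 * m / (n - 1) = 2 * t := by
      rw [ht, mul_left_comm, Nat.mul_div_cancel_left _ (by omega)]
    rw [e1] at hd
    exact (SimpleGraph.degree_le_maxDegree _ u).trans hd
end

section
/- Let a ≥ 1 and x ≥ 1 be integers with (a+1)·x even. Then the complete multipartite graph with one part of cardinality a and x parts of cardinality a+1 can be decomposed into (a+1)·x/2 edge-disjoint Hamilton paths. -/
open SimpleGraph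

/-- The zigzag `0, 1, -1, 2, -2, …`. -/
def zig (s : ℕ) : ℤ := if s % 2 = 1 then ((s : ℤ) + 1) / 2 else -((s : ℤ) / 2)

/-- A bounded form of congruence modulo `2r`. -/
def cg (r : ℕ) (A B : ℤ) : Prop := A = B ∨ A = B + 2 * r ∨ A = B - 2 * r

theorem zig_cover_lt (r : ℕ) (U V : ℤ) (h0 : 0 ≤ U) (h1 : U < V) (h2 : V < 2 * r) :
    ∃ i s : ℕ, i < r ∧ s + 1 < 2 * r ∧
      ((cg r (i + zig s) U ∧ cg r (i + zig (s + 1)) V) ∨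
       (cg r (i + zig s) V ∧ cg r (i + zig (s + 1)) U)) := by
  have key : ∀ (i s : ℤ), 0 ≤ i → i < r → 0 ≤ s → s + 1 < 2 * r →
      ((cg r (i + zig s.toNat) U ∧ cg r (i + zig (s.toNat + 1)) V) ∨
       (cg r (i + zig s.toNat) V ∧ cg r (i + zig (s.toNat + 1)) U)) →
      ∃ i s : ℕ, i < r ∧ s + 1 < 2 * r ∧
      ((cg r (i + zig s) U ∧ cg r (i + zig (s + 1)) V) ∨
       (cg r (i + zig s) V ∧ cg r (i + zig (s + 1)) U)) := by
    intro i s hi hi' hs hs' h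
    refine ⟨i.toNat, s.toNat, by omega, by omega, ?_⟩
    rwa [Int.toNat_of_nonneg hi]
  rcases Int.emod_two_eq_zero_or_one (U + V) with he | he
  · by_cases hi : (U + V) / 2 < r
    · refine key ((U + V) / 2) (V - U - 1) (by omega) hi (by omega) (by omega) (Or.inr ?_)
      unfold cg zig
      split_ifs <;> omega
    · refine key ((U + V) / 2 - r) (2 * r - (V - U) - 1) (by omega) (by omega) (by omega)
        (by omega) (Or.inl ?_)
      unfold cg zig
      split_ifs <;> omega
  · by_cases hi : (U + V - 1) / 2 < r
    · refine key ((U + V - 1) / 2) (V - U - 1) (by omega) hi (by omega) (by omega) (Or.inl ?_)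
      unfold cg zig
      split_ifs <;> omega
    · refine key ((U + V - 1) / 2 - r) (2 * r - (V - U) - 1) (by omega) (by omega) (by omega)
        (by omega) (Or.inr ?_)
      unfold cg zig
      split_ifs <;> omega

theorem zig_cover (r : ℕ) (U V : ℤ) (h0 : 0 ≤ U) (h0' : 0 ≤ V) (h1 : U ≠ V) (h2 : V < 2 * r)
    (h2' : U < 2 * r) :
    ∃ i s : ℕ, i < r ∧ s + 1 < 2 * r ∧
      ((cg r (i + zig s) U ∧ cg r (i + zig (s + 1)) V) ∨
       (cg r (i + zig s) V ∧ cg r (i + zig (s + 1)) U)) := by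
  rcases lt_or_gt_of_ne h1 with h | h
  · exact zig_cover_lt r U V h0 h h2
  · obtain ⟨i, s, hi, hs, h⟩ := zig_cover_lt r V U h0' h h2'
    exact ⟨i, s, hi, hs, h.symm⟩

theorem zig_surj (r i : ℕ) (hi : i < r) (U : ℤ) (h0 : 0 ≤ U) (h2 : U < 2 * r) :
    ∃ s : ℕ, s < 2 * r ∧ cg r (i + zig s) U := by
  obtain ⟨W, hW0, hW1, hW⟩ : ∃ W : ℤ, 0 ≤ W ∧ W < 2 * r ∧ (W = U - i ∨ W = U - i + 2 * r) := by
    by_cases h : U - i < 0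
    · exact ⟨U - i + 2 * r, by omega, by omega, Or.inr rfl⟩
    · exact ⟨U - i, by omega, by omega, Or.inl rfl⟩
  by_cases h0 : W = 0
  · refine ⟨0, by omega, ?_⟩
    unfold cg zig; split_ifs <;> omega
  by_cases h1 : W ≤ r
  · refine ⟨(2 * W - 1).toNat, by omega, ?_⟩
    unfold cg zig; split_ifs <;> omega
  · refine ⟨(2 * (2 * r - W)).toNat, by omega, ?_⟩
    unfold cg zig; split_ifs <;> omega

/-- A cyclic family covering all pairs in distinct parts. -/
structure CycDec {P Q ι : Type} (L : ℕ) (v0 : P × Q) (f : ι → ℕ → P × Q) : Prop where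
  per : ∀ i t, f i (t % L) = f i t
  surj : ∀ i v, ∃ t < L, f i t = v
  zero : ∀ i, f i 0 = v0
  cover : ∀ u v : P × Q, u.1 ≠ v.1 → ∃ i t, (f i t = u ∧ f i (t + 1) = v) ∨
    (f i t = v ∧ f i (t + 1) = u)

/-- Blow-up of a cyclic family. -/
def blow {P Q ι : Type} (L k : ℕ) (h : ℕ → ZMod k) (f : ι → ℕ → P × Q) :
    ι × ZMod k → ℕ → P × (Q × ZMod k) :=
  fun ic t => ((f ic.1 t).1, ((f ic.1 t).2, ((t / L : ℕ) : ZMod k) + h (t % L) * ic.2))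

theorem blow_cycDec {P Q ι : Type} (L k : ℕ) (hL : 0 < L) (hk : 0 < k) (v0 : P × Q)
    (f : ι → ℕ → P × Q) (hf : CycDec L v0 f) (h : ℕ → ZMod k) (h0 : h 0 = 0)
    (hu : ∀ j, j + 1 < L → IsUnit (h (j + 1) - h j)) (hu' : IsUnit (h (L - 1))) :
    CycDec (L * k) (v0.1, (v0.2, (0 : ZMod k))) (blow L k h f) := by
  have : NeZero k := ⟨hk.ne'⟩
  have hd : ∀ q j : ℕ, j < L → (L * q + j) / L = q := by
    intro q j hj
    rw [Nat.mul_add_div hL, Nat.div_eq_of_lt hj, add_zero]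
  have hm : ∀ q j : ℕ, j < L → (L * q + j) % L = j := by
    intro q j hj
    rw [Nat.mul_add_mod, Nat.mod_eq_of_lt hj]
  have hfm : ∀ i q j, f i (L * q + j) = f i j := by
    intro i q j
    rw [← hf.per i (L * q + j), Nat.mul_add_mod, hf.per]
  have key : ∀ (u v : P × Q) (a b : ZMod k) i j, j < L → f i j = u → f i (j + 1) = v →
      ∃ ic t, blow L k h f ic t = (u.1, (u.2, a)) ∧
        blow L k h f ic (t + 1) = (v.1, (v.2, b)) := by
    intro u v a b i j hj h1 h2
    by_cases hj' : j + 1 < L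
    · obtain ⟨w, hw⟩ := (hu j hj').exists_right_inv
      refine ⟨(i, w * (b - a)), L * (a - h j * (w * (b - a))).val + j, ?_, ?_⟩
      · simp only [blow, hfm, hd _ _ hj, hm _ _ hj, h1, ZMod.natCast_zmod_val]
        simp
      · simp only [blow, add_assoc, hfm, hd _ _ hj', hm _ _ hj', h2, ZMod.natCast_zmod_val]
        congr 2
        linear_combination (b - a) * hw
    · have hjL : j + 1 = L := by omega
      have hj1 : j = L - 1 := by omega
      obtain ⟨w, hw⟩ := hu'.exists_right_inv
      refine ⟨(i, w * (a - b + 1)), L * (b - 1).val + j, ?_, ?_⟩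
      · simp only [blow, hfm, hd _ _ hj, hm _ _ hj, h1, ZMod.natCast_zmod_val]
        congr 2
        rw [hj1]
        linear_combination (a - b + 1) * hw
      · have e : L * (b - 1).val + j + 1 = L * ((b - 1).val + 1) + 0 := by
          rw [mul_add, add_assoc, hjL]; ring
        have h3 : f i 0 = v := by
          rw [← h2, hjL, ← hf.per i L, Nat.mod_self]
        rw [e]
        simp only [blow, hfm, hd _ _ hL, hm _ _ hL, h3, Nat.cast_add, ZMod.natCast_zmod_val, h0]
        simp
  refine ⟨?_, ?_, ?_, ?_⟩
  · rintro ⟨i, c⟩ t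
    have e1 : t % (L * k) % L = t % L := Nat.mod_mul_right_mod t L k
    have e2 : t % (L * k) / L = t / L % k := Nat.mod_mul_right_div_self t L k
    have e3 : f i (t % (L * k)) = f i t := by
      rw [← hf.per i (t % (L * k)), e1, hf.per]
    simp only [blow, e1, e2, e3, ZMod.natCast_mod]
  · rintro ⟨i, c⟩ ⟨p, q, b⟩
    obtain ⟨j, hj, hj'⟩ := hf.surj i (p, q)
    refine ⟨L * (b - h j * c).val + j, ?_, ?_⟩
    · have := ZMod.val_lt (b - h j * c)
      calc _ < L * (b - h j * c).val + L := by omega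
        _ = L * ((b - h j * c).val + 1) := by ring
        _ ≤ L * k := Nat.mul_le_mul_left _ this
    · simp only [blow, hfm, hd _ _ hj, hm _ _ hj, hj', ZMod.natCast_zmod_val]
      simp
  · rintro ⟨i, c⟩
    simp [blow, h0, hf.zero]
  · rintro ⟨p, q, a⟩ ⟨p', q', b⟩ hne
    obtain ⟨i, t, ht⟩ := hf.cover (p, q) (p', q') hne
    have hj : t % L < L := Nat.mod_lt _ hL
    have e : f i (t % L + 1) = f i (t + 1) := by
      rw [← hf.per i (t % L + 1), ← hf.per i (t + 1), Nat.mod_add_mod]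
    rcases ht with ⟨h1, h2⟩ | ⟨h1, h2⟩
    · obtain ⟨ic, t, h⟩ := key _ _ a b i (t % L) hj (by rw [hf.per, h1]) (by rw [e, h2])
      exact ⟨ic, t, Or.inl h⟩
    · obtain ⟨ic, t, h⟩ := key _ _ b a i (t % L) hj (by rw [hf.per, h1]) (by rw [e, h2])
      exact ⟨ic, t, Or.inr h⟩

/-- Walk from a sequence. -/
theorem exists_walk_of_seq {V : Type*} (G : SimpleGraph V) (p : ℕ → V) (n : ℕ)
    (h : ∀ s < n, G.Adj (p s) (p (s + 1))) :
    ∃ w : G.Walk (p 0) (p n), w.support = (List.range (n + 1)).map p ∧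
      w.edges = (List.range n).map (fun s => s(p s, p (s + 1))) := by
  induction n with
  | zero => exact ⟨Walk.nil, by simp, by simp⟩
  | succ n ih =>
    obtain ⟨w, h1, h2⟩ := ih (fun s hs => h s (by omega))
    refine ⟨w.concat (h n (by omega)), ?_, ?_⟩
    · rw [Walk.support_concat, h1, List.range_succ (n := n + 1)]; simp
    · rw [Walk.edges_concat, h2, List.range_succ (n := n)]; simp

theorem hpd_of_seq {V : Type*} [DecidableEq V] [Fintype V] (G : SimpleGraph V)
    [DecidableRel G.Adj] (t n : ℕ) (p : Fin t → ℕ → V)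
    (hV : Fintype.card V = n + 1)
    (hE : G.edgeFinset.card = t * n)
    (hs : ∀ i v, ∃ s < n + 1, p i s = v)
    (hc : ∀ u v, G.Adj u v → ∃ i, ∃ s < n, s(p i s, p i (s + 1)) = s(u, v)) :
    G.HamiltonianPathDecomposition t := by
  let φ : Fin t × Fin n → Sym2 V := fun x => s(p x.1 x.2, p x.1 (x.2 + 1))
  have hsub : G.edgeFinset ⊆ Finset.univ.image φ := by
    intro e he
    induction e with
    | _ u v =>
      rw [mem_edgeFinset, mem_edgeSet] at he
      obtain ⟨i, s, hs, h⟩ := hc u v he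
      exact Finset.mem_image.2 ⟨(i, ⟨s, hs⟩), Finset.mem_univ _, h⟩
  have hcard : (Finset.univ : Finset (Fin t × Fin n)).card = t * n := by simp
  have hle : (Finset.univ.image φ).card ≤ G.edgeFinset.card := by
    rw [hE, ← hcard]; exact Finset.card_image_le
  have heq := Finset.eq_of_subset_of_card_le hsub hle
  have hinj : Function.Injective φ := by
    rw [← Set.injOn_univ, ← Finset.coe_univ]
    apply Finset.card_image_iff.1
    rw [← heq, hE, hcard]
  have hadj : ∀ i, ∀ s < n, G.Adj (p i s) (p i (s + 1)) := by
    intro i s hs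
    rw [← mem_edgeSet, ← mem_edgeFinset, heq]
    exact Finset.mem_image.2 ⟨(i, ⟨s, hs⟩), Finset.mem_univ _, rfl⟩
  choose w hw1 hw2 using fun i => exists_walk_of_seq G (p i) n (hadj i)
  refine ⟨_, _, w, ?_, ?_⟩
  · intro i v
    have hb : Function.Bijective (fun s : Fin (n + 1) => p i s) := by
      rw [Fintype.bijective_iff_surjective_and_card]
      refine ⟨fun v => ?_, by simp [hV]⟩
      obtain ⟨s, hs, h⟩ := hs i v
      exact ⟨⟨s, hs⟩, h⟩
    apply List.count_eq_one_of_mem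
    · rw [hw1]
      refine List.Nodup.map_on ?_ List.nodup_range
      intro a ha b hb' hab
      have := @hb.1 ⟨a, List.mem_range.1 ha⟩ ⟨b, List.mem_range.1 hb'⟩ hab
      simpa using this
    · rw [hw1]
      obtain ⟨s, hs, h⟩ := hs i v
      exact List.mem_map.2 ⟨s, List.mem_range.2 hs, h⟩
  · intro e he
    rw [← mem_edgeFinset, heq] at he
    obtain ⟨⟨i, s⟩, -, h⟩ := Finset.mem_image.1 he
    refine ⟨i, ?_, ?_⟩
    · show e ∈ (w i).edges
      rw [hw2]
      exact List.mem_map.2 ⟨s, List.mem_range.2 s.2, h⟩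
    · intro j hj
      rw [hw2] at hj
      obtain ⟨s', hs', h'⟩ := List.mem_map.1 hj
      have := @hinj (j, ⟨s', List.mem_range.1 hs'⟩) (i, s) (h'.trans h.symm)
      exact congrArg Prod.fst this

theorem card_edges_mp (a x : ℕ) (hev : Even ((a + 1) * x))
    [DecidableRel (completeMultipartiteGraph
      (fun i : Fin (x + 1) => Fin (if i = 0 then a else a + 1))).Adj] :
    (completeMultipartiteGraph
      (fun i : Fin (x + 1) => Fin (if i = 0 then a else a + 1))).edgeFinset.card =
      ((a + 1) * x / 2) * (a + (a + 1) * x - 1) := by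
  set G := (completeMultipartiteGraph
      (fun i : Fin (x + 1) => Fin (if i = 0 then a else a + 1))) with hG
  have hV : Fintype.card (Σ i : Fin (x + 1), Fin (if i = 0 then a else a + 1)) =
      a + (a + 1) * x := by
    simp [Fintype.card_sigma, Fin.sum_univ_succ, Fin.succ_ne_zero, mul_comm]
  have hdeg : ∀ u, G.degree u + (if u.1 = 0 then a else a + 1) = a + (a + 1) * x := by
    intro u
    rw [← hV, ← card_neighborFinset_eq_degree, ← Finset.card_compl_add_card (G.neighborFinset u),
      add_comm]
    congr 1
    have : (G.neighborFinset u)ᶜ = Finset.univ.map ⟨Sigma.mk u.1, sigma_mk_injective⟩ := by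
      ext v
      simp only [Finset.mem_compl, mem_neighborFinset, hG, Finset.mem_map, Finset.mem_univ,
        true_and, Function.Embedding.coeFn_mk]
      simp only [completeMultipartiteGraph, comap_adj, top_adj, not_not]
      constructor
      · intro h
        obtain ⟨i, j⟩ := v
        obtain ⟨i', j'⟩ := u
        simp only at h
        subst h
        exact ⟨j, rfl⟩
      · rintro ⟨j, rfl⟩
        rfl
    rw [this, Finset.card_map]
    simp
  have hsum := G.sum_degrees_eq_twice_card_edges
  have hdeg' : ∀ u, G.degree u = a + (a + 1) * x - (if u.1 = 0 then a else a + 1) := by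
    intro u; have := hdeg u; omega
  simp only [hdeg'] at hsum
  rw [Fintype.sum_sigma] at hsum
  have hin : ∀ i : Fin (x + 1), (∑ _j : Fin (if i = 0 then a else a + 1),
      (a + (a + 1) * x - (if i = 0 then a else a + 1))) =
      (if i = 0 then a else a + 1) * (a + (a + 1) * x - (if i = 0 then a else a + 1)) := by
    intro i
    rw [Finset.sum_const, Finset.card_univ, Fintype.card_fin, smul_eq_mul]
  rw [Finset.sum_congr rfl (fun i _ => hin i), Fin.sum_univ_succ] at hsum
  simp [Fin.succ_ne_zero] at hsum
  obtain ⟨m, hm⟩ := hev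
  have hm2 : (a + 1) * x / 2 = m := by omega
  rw [hm2]
  have e1 : x * ((a + 1) * (a + (a + 1) * x - (a + 1))) = 2 * m * (2 * m - 1) := by
    rw [hm, ← mul_assoc, mul_comm x, hm]
    congr 1 <;> omega
  rw [e1, hm] at hsum
  rw [hm]
  rcases Nat.eq_zero_or_pos m with h0 | h0
  · subst h0; simp at hsum ⊢; omega
  · have : 2 * G.edgeFinset.card = 2 * (m * (a + (m + m) - 1)) := by
      rw [← hsum]
      obtain ⟨m, rfl⟩ : ∃ k, m = k + 1 := ⟨m - 1, by omega⟩
      have e2 : 2 * (m + 1) - 1 = 2 * m + 1 := by omega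
      have e3 : a + (m + 1 + (m + 1)) - 1 = a + 2 * m + 1 := by omega
      rw [e2, e3]; ring
    have h := Nat.eq_of_mul_eq_mul_left two_pos this
    convert h

theorem final_of_cycDec (a x : ℕ) (hev : Even ((a + 1) * x))
    (ha : 1 ≤ a)
    {Q ι : Type} [Fintype Q] [Fintype ι] (hQ : Fintype.card Q = a + 1)
    (hι : Fintype.card ι = (a + 1) * x / 2) (q0 : Q)
    (f : ι → ℕ → Option (Fin x) × Q) (hf : CycDec ((a + 1) * (x + 1)) (none, q0) f) :
    (completeMultipartiteGraph
      (fun i : Fin (x + 1) => Fin (if i = 0 then a else a + 1))).HamiltonianPathDecomposition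
      ((a + 1) * x / 2) := by
  classical
  set L := (a + 1) * (x + 1) with hL
  have hLa : L = a + (a + 1) * x + 1 := by rw [hL]; ring
  obtain ⟨e, he⟩ : ∃ e : Q ≃ Fin (a + 1), e q0 = Fin.last a := by
    let e0 := Fintype.equivFinOfCardEq hQ
    exact ⟨e0.trans (Equiv.swap (e0 q0) (Fin.last a)), by simp⟩
  let Ψ : (Σ i : Fin (x + 1), Fin (if i = 0 then a else a + 1)) → Option (Fin x) × Q :=
    fun w => (finSuccEquiv x w.1, e.symm ⟨w.2.1, by have := w.2.2; split_ifs at this <;> omega⟩)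
  have hΨinj : Function.Injective Ψ := by
    rintro ⟨i, j⟩ ⟨i', j'⟩ h
    simp only [Ψ, Prod.mk.injEq, EmbeddingLike.apply_eq_iff_eq, Fin.mk.injEq] at h
    obtain ⟨rfl, h⟩ := h
    have := Fin.ext h
    rw [this]
  have hΨne : ∀ w, Ψ w ≠ (none, q0) := by
    rintro ⟨i, j⟩ h
    simp only [Ψ, Prod.mk.injEq, Equiv.symm_apply_eq, he] at h
    obtain ⟨h1, h2⟩ := h
    have hi : i = 0 := by
      rw [← finSuccEquiv_zero] at h1
      exact (finSuccEquiv x).injective h1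
    have h3 := congrArg Fin.val h2
    simp only [Fin.val_last] at h3
    have : j.1 < a := lt_of_lt_of_eq j.2 (if_pos hi)
    omega
  have hΨsurj : ∀ v, v ≠ (none, q0) → ∃ w, Ψ w = v := by
    rintro ⟨p, q⟩ hne
    obtain ⟨i, rfl⟩ := (finSuccEquiv x).surjective p
    obtain ⟨j, rfl⟩ := e.symm.surjective q
    have hj : j.1 < (if i = 0 then a else a + 1) := by
      split_ifs with hi
      · subst hi
        by_contra hcon
        apply hne
        have : j = Fin.last a := by apply Fin.ext; simp; omega
        rw [this, ← he]; simp
      · exact j.2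
    exact ⟨⟨i, ⟨j.1, hj⟩⟩, rfl⟩
  have hb : ∀ i, ∀ s t, s < L → t < L → f i s = f i t → s = t := by
    intro i s t hs ht hst
    have hb : Function.Bijective (fun s : Fin L => f i s) := by
      rw [Fintype.bijective_iff_surjective_and_card]
      refine ⟨fun v => ?_, by simp [hQ, hL, mul_comm]⟩
      obtain ⟨s, hs, h⟩ := hf.surj i v
      exact ⟨⟨s, hs⟩, h⟩
    simpa using @hb.1 ⟨s, hs⟩ ⟨t, ht⟩ hst
  have hex : ∀ i s, ∃ w, (s + 1 < L → Ψ w = f i (s + 1)) := by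
    intro i s
    by_cases hs : s + 1 < L
    · obtain ⟨w, hw⟩ := hΨsurj (f i (s + 1)) (by
        rw [← hf.zero i]
        intro h
        have := hb i _ _ hs (by omega) h
        omega)
      exact ⟨w, fun _ => hw⟩
    · exact ⟨⟨0, ⟨0, by simp; omega⟩⟩, fun h => absurd h hs⟩
  choose p hp using hex
  let ε := Fintype.equivFinOfCardEq hι
  refine hpd_of_seq _ ((a + 1) * x / 2) (a + (a + 1) * x - 1) (fun i => p (ε.symm i)) ?_ ?_ ?_ ?_
  · simp [Fintype.card_sigma, Fin.sum_univ_succ, Fin.succ_ne_zero]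
    rw [mul_comm x]; omega
  · exact card_edges_mp a x hev
  · intro i v
    obtain ⟨t, ht, h⟩ := hf.surj (ε.symm i) (Ψ v)
    have ht0 : t ≠ 0 := by
      rintro rfl
      exact hΨne v (by rw [← h, hf.zero])
    obtain ⟨t, rfl⟩ : ∃ k, t = k + 1 := ⟨t - 1, by omega⟩
    refine ⟨t, by omega, hΨinj ?_⟩
    rw [hp _ _ ht, h]
  · intro u v huv
    have key : ∀ u v i t, f i t = Ψ u → f i (t + 1) = Ψ v →
        ∃ s < a + (a + 1) * x - 1, p i s = u ∧ p i (s + 1) = v := by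
      intro u v i t h1 h2
      have hj : t % L < L := Nat.mod_lt _ (by omega)
      have e : f i (t % L + 1) = f i (t + 1) := by
        rw [← hf.per i (t % L + 1), ← hf.per i (t + 1), Nat.mod_add_mod]
      rw [← hf.per] at h1
      rw [← e] at h2
      generalize t % L = t at *
      have ht0 : t ≠ 0 := by
        rintro rfl
        exact hΨne u (by rw [← h1, hf.zero])
      have ht1 : t + 1 ≠ L := by
        intro h
        apply hΨne v
        rw [← h2, h, ← hf.per, Nat.mod_self, hf.zero]
      obtain ⟨t, rfl⟩ : ∃ k, t = k + 1 := ⟨t - 1, by omega⟩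
      refine ⟨t, by omega, hΨinj ?_, hΨinj ?_⟩
      · rw [hp _ _ (by omega), h1]
      · rw [hp _ _ (by omega), h2]
    have hne : (Ψ u).1 ≠ (Ψ v).1 := by
      simpa [Ψ, completeMultipartiteGraph] using huv
    obtain ⟨i, t, ⟨h1, h2⟩ | ⟨h1, h2⟩⟩ := hf.cover (Ψ u) (Ψ v) hne
    · obtain ⟨s, hs, h3, h4⟩ := key _ _ _ _ h1 h2
      exact ⟨ε i, s, hs, by simp [h3, h4]⟩
    · obtain ⟨s, hs, h3, h4⟩ := key _ _ _ _ h1 h2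
      exact ⟨ε i, s, hs, by simp [h3, h4, Sym2.eq_swap]⟩

/-- Residue modulo `2r`. -/
def encOdd (r : ℕ) (hr : 0 < r) (A : ℤ) : Fin (2 * r) :=
  ⟨(A % (2 * r)).toNat, by
    have h1 := Int.emod_nonneg A (b := 2 * r) (by omega)
    have h2 := Int.emod_lt_of_pos A (b := 2 * r) (by omega)
    omega⟩

theorem encOdd_eq (r : ℕ) (hr : 0 < r) (A : ℤ) (u : Fin (2 * r)) (h : cg r A u) :
    encOdd r hr A = u := by
  have h3 : A % (2 * r) = u := by
    have hu : ((u : ℕ) : ℤ) % (2 * r) = u := Int.emod_eq_of_lt (by omega) (by omega)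
    rcases h with h | h | h
    · rw [h, hu]
    · rw [h, Int.add_emod_right, hu]
    · rw [h, Int.sub_emod_right, hu]
  apply Fin.ext
  simp [encOdd, h3]

/-- Walecki's cycles in `K_{2r+1}`. -/
def baseOdd (r : ℕ) (hr : 0 < r) (i : Fin r) (t : ℕ) : Option (Fin (2 * r)) × Unit :=
  if t % (2 * r + 1) = 0 then (none, ())
  else (some (encOdd r hr (i + zig (t % (2 * r + 1) - 1))), ())

theorem baseOdd_eq (r : ℕ) (hr : 0 < r) (i : Fin r) (s : ℕ) (hs : s < 2 * r)
    (u : Fin (2 * r)) (h : cg r (i + zig s) u) : baseOdd r hr i (s + 1) = (some u, ()) := by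
  have e : (s + 1) % (2 * r + 1) = s + 1 := Nat.mod_eq_of_lt (by omega)
  simp only [baseOdd, e]
  rw [if_neg (by omega), Nat.add_sub_cancel, encOdd_eq r hr _ u h]

theorem baseOdd_zero (r : ℕ) (hr : 0 < r) (i : Fin r) : baseOdd r hr i 0 = (none, ()) := by
  simp [baseOdd]

theorem baseOdd_last (r : ℕ) (hr : 0 < r) (i : Fin r) :
    baseOdd r hr i (2 * r + 1) = (none, ()) := by
  simp [baseOdd]

theorem baseOdd_cycDec (r : ℕ) (hr : 0 < r) :
    CycDec (2 * r + 1) (none, ()) (baseOdd r hr) := by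
  have hinf : ∀ u : Fin (2 * r), ∃ i t,
      (baseOdd r hr i t = (none, ()) ∧ baseOdd r hr i (t + 1) = (some u, ())) ∨
      (baseOdd r hr i t = (some u, ()) ∧ baseOdd r hr i (t + 1) = (none, ())) := by
    intro u
    by_cases hu : u.1 < r
    · refine ⟨⟨u.1, hu⟩, 0, Or.inl ⟨baseOdd_zero _ _ _, baseOdd_eq _ _ _ 0 (by omega) _ ?_⟩⟩
      simp only [cg, zig]; omega
    · refine ⟨⟨u.1 - r, by omega⟩, 2 * r - 1 + 1, Or.inr
        ⟨baseOdd_eq _ _ _ _ (by omega) _ ?_, ?_⟩⟩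
      · simp only [cg, zig]; split_ifs <;> omega
      · rw [show 2 * r - 1 + 1 + 1 = 2 * r + 1 by omega, baseOdd_last]
  refine ⟨?_, ?_, ?_, ?_⟩
  · intro i t; simp [baseOdd]
  · rintro i ⟨_ | u, ⟨⟩⟩
    · exact ⟨0, by omega, baseOdd_zero _ _ _⟩
    · obtain ⟨s, hs, h⟩ := zig_surj r i i.2 u (by omega) (by omega)
      exact ⟨s + 1, by omega, baseOdd_eq _ _ _ _ hs _ h⟩
  · exact baseOdd_zero r hr
  · rintro ⟨_ | u, ⟨⟩⟩ ⟨_ | v, ⟨⟩⟩ hne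
    · exact absurd rfl hne
    · exact hinf v
    · obtain ⟨i, t, h⟩ := hinf u
      exact ⟨i, t, h.symm⟩
    · have huv : u.1 ≠ v.1 := by
        intro h; exact hne (congrArg some (Fin.ext h))
      obtain ⟨i, s, hi, hs, h⟩ := zig_cover r u v (by omega) (by omega) (by omega) (by omega)
        (by omega)
      refine ⟨⟨i, hi⟩, s + 1, ?_⟩
      rcases h with ⟨h1, h2⟩ | ⟨h1, h2⟩
      · exact Or.inl ⟨baseOdd_eq _ _ _ _ (by omega) _ h1, baseOdd_eq _ _ _ _ hs _ h2⟩
      · exact Or.inr ⟨baseOdd_eq _ _ _ _ (by omega) _ h1, baseOdd_eq _ _ _ _ hs _ h2⟩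

/-- The integer in `[0, 2r)` encoded by a pair. -/
def val2 (r : ℕ) (u : Fin r × Bool) : ℤ := (u.1 : ℕ) + (if u.2 then (r : ℤ) else 0)

/-- Residue modulo `2r`, as a pair of antipodes and a choice. -/
def encEven (r : ℕ) (hr : 0 < r) (A : ℤ) : Fin r × Bool :=
  if h : (A % (2 * r)).toNat < r then (⟨(A % (2 * r)).toNat, h⟩, false)
  else (⟨(A % (2 * r)).toNat - r, by
    have h1 := Int.emod_nonneg A (b := 2 * r) (by omega)
    have h2 := Int.emod_lt_of_pos A (b := 2 * r) (by omega)
    omega⟩, true)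

theorem val2_bd (r : ℕ) (u : Fin r × Bool) : 0 ≤ val2 r u ∧ val2 r u < 2 * r := by
  unfold val2
  have := u.1.2
  split_ifs <;> omega

theorem encEven_eq (r : ℕ) (hr : 0 < r) (A : ℤ) (u : Fin r × Bool) (h : cg r A (val2 r u)) :
    encEven r hr A = u := by
  have hb := val2_bd r u
  have h3 : A % (2 * r) = val2 r u := by
    have hu : val2 r u % (2 * r) = val2 r u := Int.emod_eq_of_lt hb.1 hb.2
    rcases h with h | h | h
    · rw [h, hu]
    · rw [h, Int.add_emod_right, hu]
    · rw [h, Int.sub_emod_right, hu]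
  obtain ⟨u, b⟩ := u
  have := u.2
  unfold encEven
  simp only [h3]
  cases b
  · have e : val2 r (u, false) = (u : ℕ) := by simp [val2]
    simp only [e]
    rw [dif_pos (by omega)]
    simp
  · have e : val2 r (u, true) = ((u + r : ℕ) : ℤ) := by simp [val2]
    simp only [e]
    rw [dif_neg (by omega)]
    refine Prod.ext (Fin.ext ?_) rfl
    simp only
    omega

/-- Cycles decomposing `K_{2r+2}` minus a perfect matching. -/
def baseEven (r : ℕ) (hr : 0 < r) (i : Fin r) (t : ℕ) : Option (Fin r) × Bool :=
  if t % (2 * r + 2) = 0 then (none, false)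
  else if t % (2 * r + 2) = r + 1 then (none, true)
  else if t % (2 * r + 2) ≤ r then
    (some (encEven r hr (i + zig (t % (2 * r + 2) - 1))).1,
      (encEven r hr (i + zig (t % (2 * r + 2) - 1))).2)
  else (some (encEven r hr (i + zig (t % (2 * r + 2) - 2))).1,
      (encEven r hr (i + zig (t % (2 * r + 2) - 2))).2)

theorem baseEven_eq1 (r : ℕ) (hr : 0 < r) (i : Fin r) (s : ℕ) (hs : s < r)
    (u : Fin r × Bool) (h : cg r (i + zig s) (val2 r u)) :
    baseEven r hr i (s + 1) = (some u.1, u.2) := by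
  have e : (s + 1) % (2 * r + 2) = s + 1 := Nat.mod_eq_of_lt (by omega)
  simp only [baseEven, e]
  rw [if_neg (by omega), if_neg (by omega), if_pos (by omega), Nat.add_sub_cancel,
    encEven_eq r hr _ u h]

theorem baseEven_eq2 (r : ℕ) (hr : 0 < r) (i : Fin r) (s : ℕ) (hs : r ≤ s) (hs' : s < 2 * r)
    (u : Fin r × Bool) (h : cg r (i + zig s) (val2 r u)) :
    baseEven r hr i (s + 2) = (some u.1, u.2) := by
  have e : (s + 2) % (2 * r + 2) = s + 2 := Nat.mod_eq_of_lt (by omega)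
  simp only [baseEven, e]
  rw [if_neg (by omega), if_neg (by omega), if_neg (by omega), Nat.add_sub_cancel,
    encEven_eq r hr _ u h]

theorem baseEven_zero (r : ℕ) (hr : 0 < r) (i : Fin r) :
    baseEven r hr i 0 = (none, false) := by
  simp [baseEven]

theorem baseEven_last (r : ℕ) (hr : 0 < r) (i : Fin r) :
    baseEven r hr i (2 * r + 2) = (none, false) := by
  simp [baseEven]

theorem baseEven_mid (r : ℕ) (hr : 0 < r) (i : Fin r) :
    baseEven r hr i (r + 1) = (none, true) := by
  have e : (r + 1) % (2 * r + 2) = r + 1 := Nat.mod_eq_of_lt (by omega)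
  simp [baseEven, e]

theorem baseEven_cycDec (r : ℕ) (hr : 0 < r) :
    CycDec (2 * r + 2) (none, false) (baseEven r hr) := by
  have hinf : ∀ (b : Bool) (u : Fin r × Bool), ∃ i t,
      (baseEven r hr i t = (none, b) ∧ baseEven r hr i (t + 1) = (some u.1, u.2)) ∨
      (baseEven r hr i t = (some u.1, u.2) ∧ baseEven r hr i (t + 1) = (none, b)) := by
    rintro b u
    have hb := val2_bd r u
    cases b
    · by_cases hu : val2 r u < r
      · refine ⟨⟨(val2 r u).toNat, by omega⟩, 0,
          Or.inl ⟨baseEven_zero _ _ _, baseEven_eq1 _ _ _ 0 (by omega) _ ?_⟩⟩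
        simp only [cg, zig]; omega
      · refine ⟨⟨(val2 r u - r).toNat, by omega⟩, 2 * r - 1 + 2, Or.inr
          ⟨baseEven_eq2 _ _ _ _ (by omega) (by omega) _ ?_, ?_⟩⟩
        · simp only [cg, zig]; split_ifs <;> omega
        · rw [show 2 * r - 1 + 2 + 1 = 2 * r + 2 by omega, baseEven_last]
    · obtain ⟨i, hi, h⟩ : ∃ i : ℕ, i < r ∧
          (cg r (i + zig (r - 1)) (val2 r u) ∨ cg r (i + zig r) (val2 r u)) := by
        have key : ∀ j : ℤ, 0 ≤ j → j < r →
            (cg r (j + zig (r - 1)) (val2 r u) ∨ cg r (j + zig r) (val2 r u)) →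
            ∃ i : ℕ, i < r ∧
          (cg r (i + zig (r - 1)) (val2 r u) ∨ cg r (i + zig r) (val2 r u)) := by
          intro j h0 h1 h
          refine ⟨j.toNat, by omega, ?_⟩
          rwa [Int.toNat_of_nonneg h0]
        have e : zig (r - 1) = zig r + r ∨ zig (r - 1) = zig r - r := by
          unfold zig; split_ifs <;> omega
        have e2 : -r ≤ zig r ∧ zig r ≤ r := by
          unfold zig; split_ifs <;> omega
        by_cases h1 : val2 r u - zig r < 0
        · refine key (val2 r u - zig r + r) (by omega) (by omega) ?_
          unfold cg; omega
        · by_cases h2 : val2 r u - zig r < r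
          · refine key (val2 r u - zig r) (by omega) (by omega) ?_
            unfold cg; omega
          · by_cases h3 : val2 r u - zig r < 2 * r
            · refine key (val2 r u - zig r - r) (by omega) (by omega) ?_
              unfold cg; omega
            · refine key (val2 r u - zig r - 2 * r) (by omega) (by omega) ?_
              unfold cg; omega
      rcases h with h | h
      · refine ⟨⟨i, hi⟩, r - 1 + 1, Or.inr ⟨baseEven_eq1 _ _ _ _ (by omega) _ h, ?_⟩⟩
        rw [show r - 1 + 1 + 1 = r + 1 by omega, baseEven_mid]
      · exact ⟨⟨i, hi⟩, r + 1, Or.inl ⟨baseEven_mid _ _ _,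
          baseEven_eq2 _ _ _ _ (by omega) (by omega) _ h⟩⟩
  refine ⟨?_, ?_, ?_, ?_⟩
  · intro i t; simp [baseEven]
  · rintro i ⟨_ | u, b⟩
    · cases b
      · exact ⟨0, by omega, baseEven_zero _ _ _⟩
      · exact ⟨r + 1, by omega, baseEven_mid _ _ _⟩
    · have hb := val2_bd r (u, b)
      obtain ⟨s, hs, h⟩ := zig_surj r i i.2 (val2 r (u, b)) hb.1 hb.2
      by_cases hsr : s < r
      · exact ⟨s + 1, by omega, baseEven_eq1 _ _ _ _ hsr _ h⟩
      · exact ⟨s + 2, by omega, baseEven_eq2 _ _ _ _ (by omega) hs _ h⟩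
  · exact baseEven_zero r hr
  · rintro ⟨_ | u, b⟩ ⟨_ | v, c⟩ hne
    · exact absurd rfl hne
    · exact hinf b (v, c)
    · obtain ⟨i, t, h⟩ := hinf c (u, b)
      exact ⟨i, t, h.symm⟩
    · have huv : u.1 ≠ v.1 := by
        intro h; exact hne (congrArg some (Fin.ext h))
      have hb := val2_bd r (u, b)
      have hc := val2_bd r (v, c)
      have hd : val2 r (u, b) ≠ val2 r (v, c) ∧ val2 r (u, b) ≠ val2 r (v, c) + r ∧
          val2 r (v, c) ≠ val2 r (u, b) + r := by
        have := u.2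
        have := v.2
        unfold val2
        simp only
        split_ifs <;> omega
      obtain ⟨i, s, hi, hs, h⟩ := zig_cover r _ _ hb.1 hc.1 hd.1 hc.2 hb.2
      have hsr : s ≠ r - 1 := by
        rintro rfl
        rw [show r - 1 + 1 = r by omega] at h
        have e : zig (r - 1) = zig r + r ∨ zig (r - 1) = zig r - r := by
          unfold zig; split_ifs <;> omega
        unfold cg at h
        omega
      have key : ∀ u v : Fin r × Bool, cg r (i + zig s) (val2 r u) →
          cg r (i + zig (s + 1)) (val2 r v) →
          ∃ t, baseEven r hr ⟨i, hi⟩ t = (some u.1, u.2) ∧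
            baseEven r hr ⟨i, hi⟩ (t + 1) = (some v.1, v.2) := by
        intro u v h1 h2
        by_cases hlt : s < r
        · exact ⟨s + 1, baseEven_eq1 _ _ _ _ hlt _ h1, baseEven_eq1 _ _ _ _ (by omega) _ h2⟩
        · exact ⟨s + 2, baseEven_eq2 _ _ _ _ (by omega) (by omega) _ h1,
            baseEven_eq2 _ _ ⟨i, hi⟩ (s + 1) (by omega) hs _ h2⟩
      rcases h with ⟨h1, h2⟩ | ⟨h1, h2⟩
      · obtain ⟨t, h⟩ := key _ _ h1 h2
        exact ⟨_, t, Or.inl h⟩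
      · obtain ⟨t, h⟩ := key _ _ h1 h2
        exact ⟨_, t, Or.inr h⟩

/-- `K_{a,(a+1)^x}` decomposes into `(a+1)x/2` Hamilton paths whenever `(a+1)x` is even. -/
theorem hamiltonianPathDecomposition_K_a_aPlusOne_pow_x
    (a x : ℕ) (ha : 1 ≤ a) (hx : 1 ≤ x) (hev : Even ((a + 1) * x)) :
    (completeMultipartiteGraph
      (fun i : Fin (x + 1) => Fin (if i = 0 then a else a + 1))).HamiltonianPathDecomposition
      ((a + 1) * x / 2) := by
  by_cases hn : Even (a + 1)
  · obtain ⟨k, hk⟩ := hn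
    have hk0 : 0 < k := by omega
    have : NeZero k := ⟨hk0.ne'⟩
    have hB := blow_cycDec (2 * x + 2) k (by omega) hk0 _ _ (baseEven_cycDec x hx)
      (fun j => ((j % 2 : ℕ) : ZMod k)) (by simp)
      (by
        intro j _
        rcases Nat.mod_two_eq_zero_or_one j with h | h
        · have h' : (j + 1) % 2 = 1 := by omega
          simp [h, h']
        · have h' : (j + 1) % 2 = 0 := by omega
          simp [h, h'])
      (by
        have h' : (2 * x + 2 - 1) % 2 = 1 := by omega
        simp [h'])
    refine final_of_cycDec a x hev ha ?_ ?_ _ _ (by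
      have e : (a + 1) * (x + 1) = (2 * x + 2) * k := by rw [hk]; ring
      rw [e]; exact hB)
    · simp [ZMod.card]; omega
    · have e : (a + 1) * x = 2 * (x * k) := by rw [hk]; ring
      rw [e]
      simp [ZMod.card]
  · have hx2 : Even x := (Nat.even_mul.1 hev).resolve_left hn
    obtain ⟨r, hr⟩ := hx2
    obtain rfl : x = 2 * r := by omega
    have hr0 : 0 < r := by omega
    have hodd : Odd (a + 1) := Nat.not_even_iff_odd.1 hn
    have h2 : IsUnit (2 : ZMod (a + 1)) := by
      have := (ZMod.isUnit_iff_coprime 2 (a + 1)).2 (Nat.coprime_two_left.2 hodd)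
      simpa using this
    have hB := blow_cycDec (2 * r + 1) (a + 1) (by omega) (by omega) _ _ (baseOdd_cycDec r hr0)
      (fun j => if j = 2 * r then 2 else ((j % 2 : ℕ) : ZMod (a + 1))) (by simp; omega)
      (by
        intro j hj
        have hj1 : j ≠ 2 * r := by omega
        simp only [if_neg hj1]
        by_cases hj2 : j + 1 = 2 * r
        · have h' : j % 2 = 1 := by omega
          rw [if_pos hj2, h']
          norm_num
        · rw [if_neg hj2]
          rcases Nat.mod_two_eq_zero_or_one j with h | h
          · have h' : (j + 1) % 2 = 1 := by omega
            simp [h, h']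
          · have h' : (j + 1) % 2 = 0 := by omega
            simp [h, h'])
      (by simpa using h2)
    refine final_of_cycDec a (2 * r) hev ha ?_ ?_ _ _ (by
      have e : (a + 1) * (2 * r + 1) = (2 * r + 1) * (a + 1) := by ring
      rw [e]; exact hB)
    · simp [ZMod.card]
    · have e : (a + 1) * (2 * r) = 2 * (r * (a + 1)) := by ring
      rw [e]
      simp [ZMod.card]
end

section
/- For every integer a ≥ 2, the complete multipartite graph with (a−1)² parts of cardinality 1 and one part of cardinality a can be decomposed into a(a−1)/2 edge-disjoint Hamilton paths. -/
open SimpleGraph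

section HD
set_option linter.unusedSectionVars false
set_option linter.unusedSimpArgs false
variable {V : Type*} [DecidableEq V]

def eL : List V → List (Sym2 V)
  | a :: b :: l => s(a, b) :: eL (b :: l)
  | _ => []

def en (l : List V) (v : V) : ℕ :=
  (if l.head? = some v then 1 else 0) + (if l.getLast? = some v then 1 else 0)

lemma en_reverse (l : List V) (v : V) : en l.reverse v = en l v := by
  simp [en, add_comm]

lemma eL_append (P Q : List V) (u v : V) (e : Sym2 V) :
    e ∈ eL (P ++ [u] ++ (v :: Q)) ↔ e ∈ eL (P ++ [u]) ∨ e ∈ eL (v :: Q) ∨ e = s(u, v) := by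
  induction P with
  | nil => simp [eL]; tauto
  | cons a P ih =>
    cases P with
    | nil => simp [eL]; tauto
    | cons b P => simp [eL] at ih ⊢; rw [ih]; tauto

lemma eL_reverse (l : List V) (e : Sym2 V) : e ∈ eL l.reverse ↔ e ∈ eL l := by
  induction l with
  | nil => simp
  | cons a l ih =>
    cases l with
    | nil => simp
    | cons b l =>
      have := eL_append l.reverse [] b a e
      simp only [List.reverse_cons, List.append_assoc, List.cons_append, List.nil_append] at this ih ⊢
      rw [this, ih]
      simp [eL, Sym2.eq_swap]
      tauto

lemma mem_of_eL (l : List V) (u v : V) (h : s(u, v) ∈ eL l) : u ∈ l ∧ v ∈ l := by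
  induction l with
  | nil => simp [eL] at h
  | cons a l ih =>
    cases l with
    | nil => simp [eL] at h
    | cons b l =>
      simp only [eL, List.mem_cons] at h ih ⊢
      rcases h with h | h
      · rw [Sym2.eq_iff] at h; tauto
      · have := ih h; tauto

lemma eL_ne (l : List V) (hl : l.Nodup) (u v : V) (h : s(u, v) ∈ eL l) : u ≠ v := by
  induction l with
  | nil => simp [eL] at h
  | cons a l ih =>
    cases l with
    | nil => simp [eL] at h
    | cons b l =>
      simp only [eL, List.mem_cons] at h ih
      rcases h with h | h
      · rw [Sym2.eq_iff] at h
        simp at hl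
        rcases h with ⟨rfl, rfl⟩ | ⟨rfl, rfl⟩
        · exact hl.1.1
        · exact fun h => hl.1.1 h.symm
      · exact ih hl.of_cons h

lemma mem_of_en {l : List V} {v : V} (h : 0 < en l v) : v ∈ l := by
  unfold en at h
  by_cases h1 : l.head? = some v
  · exact List.mem_of_head? h1
  · by_cases h2 : l.getLast? = some v
    · exact List.mem_of_getLast? h2
    · simp [h1, h2] at h

/-- orient a path so that it ends at `u` -/
lemma orient_last {l : List V} {u : V} (h : 0 < en l u) :
    ∃ P, (l = P ++ [u] ∨ l = (P ++ [u]).reverse) := by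
  unfold en at h
  by_cases h2 : l.getLast? = some u
  · obtain ⟨P, hP⟩ := List.getLast?_eq_some_iff.1 h2
    exact ⟨P, Or.inl hP⟩
  · by_cases h1 : l.head? = some u
    · obtain ⟨P, hP⟩ := List.head?_eq_some_iff.1 h1
      exact ⟨P.reverse, Or.inr (by simp [hP])⟩
    · simp [h1, h2] at h

lemma en_append (P Q : List V) (u v x : V) :
    en (P ++ [u] ++ (v :: Q)) x + (if x = u then 1 else 0) + (if x = v then 1 else 0)
      = en (P ++ [u]) x + en (v :: Q) x := by
  have h1 : (P ++ [u] ++ (v :: Q)).head? = (P ++ [u]).head? := by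
    cases P <;> simp
  have h2 : (P ++ [u] ++ (v :: Q)).getLast? = (v :: Q).getLast? := by
    rw [List.getLast?_append]; simp [List.getLast?_cons]
  unfold en
  rw [h1, h2]
  simp only [List.getLast?_append, List.head?_cons, Option.some.injEq, List.getLast?_singleton,
    Option.some_or, eq_comm (a := x)]
  omega

lemma sum_en {S : Finset V} {l : List V} (hne : l ≠ []) (h : ∀ v ∈ l, v ∈ S) :
    ∑ v ∈ S, en l v = 2 := by
  unfold en
  rw [Finset.sum_add_distrib]
  have h1 := List.head?_eq_some_head hne
  have h2 := List.getLast?_eq_some_getLast hne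
  rw [h1, h2]
  simp [h _ (List.head_mem hne), h _ (List.getLast_mem hne)]

structure Forest (S : Finset V) (F : Finset (List V)) : Prop where
  ne : ∀ l ∈ F, l ≠ []
  nd : ∀ l ∈ F, l.Nodup
  dj : ∀ l ∈ F, ∀ l' ∈ F, ∀ v, v ∈ l → v ∈ l' → l = l'
  cov : ∀ v, v ∈ S ↔ ∃ l ∈ F, v ∈ l

def FE (F : Finset (List V)) (e : Sym2 V) : Prop := ∃ l ∈ F, e ∈ eL l

def ec (F : Finset (List V)) (v : V) : ℕ := ∑ l ∈ F, en l v

lemma Forest.join {S : Finset V} {F : Finset (List V)} (hF : Forest S F) {P Q : List V} {u v : V}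
    (hP : P ∈ F) (hQ : Q ∈ F) (hPQ : P ≠ Q) (hu : 0 < en P u) (hv : 0 < en Q v) :
    ∃ F' R, Forest S F' ∧ R ∈ F' ∧ F'.card + 1 = F.card ∧
      (∀ e, FE F' e ↔ FE F e ∨ e = s(u, v)) ∧
      (∀ x, ec F' x + (if x = u then 1 else 0) + (if x = v then 1 else 0) = ec F x) ∧
      (∀ T ∈ F, T ≠ P → T ≠ Q → T ∈ F' ∧ T ≠ R) ∧
      (∀ x, en R x + (if x = u then 1 else 0) + (if x = v then 1 else 0) = en P x + en Q x) := by
  obtain ⟨P0, hP0⟩ := orient_last hu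
  obtain ⟨Q0, hQ0⟩ := orient_last hv
  have hQ1 : Q = v :: Q0.reverse ∨ Q = (v :: Q0.reverse).reverse := by
    rcases hQ0 with h | h
    · right; simp [h]
    · left; simp [h]
  set Q1 := Q0.reverse
  clear_value Q1
  have mP : ∀ x, x ∈ P ↔ x ∈ P0 ++ [u] := by
    intro x; rcases hP0 with h | h <;> rw [h]; exact List.mem_reverse
  have mQ : ∀ x, x ∈ Q ↔ x ∈ v :: Q1 := by
    intro x; rcases hQ1 with h | h <;> rw [h]; exact List.mem_reverse
  have eP : ∀ x, en P x = en (P0 ++ [u]) x := by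
    intro x; rcases hP0 with h | h <;> rw [h]; exact en_reverse _ _
  have eQ : ∀ x, en Q x = en (v :: Q1) x := by
    intro x; rcases hQ1 with h | h <;> rw [h]; exact en_reverse _ _
  have lP : ∀ x, x ∈ eL P ↔ x ∈ eL (P0 ++ [u]) := by
    intro x; rcases hP0 with h | h <;> rw [h]; exact eL_reverse _ _
  have lQ : ∀ x, x ∈ eL Q ↔ x ∈ eL (v :: Q1) := by
    intro x; rcases hQ1 with h | h <;> rw [h]; exact eL_reverse _ _
  have nP : (P0 ++ [u]).Nodup := by
    have := hF.nd P hP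
    rcases hP0 with h | h <;> rw [h] at this
    · exact this
    · exact List.nodup_reverse.1 this
  have nQ : (v :: Q1).Nodup := by
    have := hF.nd Q hQ
    rcases hQ1 with h | h <;> rw [h] at this
    · exact this
    · exact List.nodup_reverse.1 this
  set R := P0 ++ [u] ++ (v :: Q1) with hR
  have mR : ∀ x, x ∈ R ↔ x ∈ P ∨ x ∈ Q := by
    intro x; rw [mP, mQ, hR, List.mem_append]
  have uP : u ∈ P := mem_of_en hu
  have vQ : v ∈ Q := mem_of_en hv
  have hQ' : Q ∈ F.erase P := Finset.mem_erase.2 ⟨hPQ.symm, hQ⟩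
  have hRn : R ∉ (F.erase P).erase Q := by
    intro h
    simp only [Finset.mem_erase] at h
    exact h.2.1 (hF.dj R h.2.2 P hP u ((mR u).2 (Or.inl uP)) uP)
  have enR : ∀ x, en R x + (if x = u then 1 else 0) + (if x = v then 1 else 0)
      = en P x + en Q x := by
    intro x; rw [eP, eQ, hR]; exact en_append _ _ _ _ _
  refine ⟨insert R ((F.erase P).erase Q), R, ⟨?_, ?_, ?_, ?_⟩, by simp, ?_, ?_, ?_, ?_, enR⟩
  · intro l hl
    simp only [Finset.mem_insert, Finset.mem_erase] at hl
    rcases hl with rfl | hl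
    · simp [hR]
    · exact hF.ne l hl.2.2
  · intro l hl
    simp only [Finset.mem_insert, Finset.mem_erase] at hl
    rcases hl with rfl | hl
    · rw [hR, List.nodup_append]
      refine ⟨nP, nQ, ?_⟩
      rintro x hx y hy rfl
      exact hPQ (hF.dj P hP Q hQ x ((mP x).2 hx) ((mQ x).2 hy))
    · exact hF.nd l hl.2.2
  · intro l hl l' hl' x hx hx'
    simp only [Finset.mem_insert, Finset.mem_erase] at hl hl'
    rcases hl with rfl | hl <;> rcases hl' with rfl | hl'
    · rfl
    · exfalso
      rcases (mR x).1 hx with h | h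
      · exact hl'.2.1 (hF.dj _ hl'.2.2 _ hP x hx' h)
      · exact hl'.1 (hF.dj _ hl'.2.2 _ hQ x hx' h)
    · exfalso
      rcases (mR x).1 hx' with h | h
      · exact hl.2.1 (hF.dj _ hl.2.2 _ hP x hx h)
      · exact hl.1 (hF.dj _ hl.2.2 _ hQ x hx h)
    · exact hF.dj _ hl.2.2 _ hl'.2.2 x hx hx'
  · intro x
    rw [hF.cov]
    constructor
    · rintro ⟨l, hl, hx⟩
      by_cases h1 : l = P
      · subst h1; exact ⟨R, by simp, (mR x).2 (Or.inl hx)⟩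
      by_cases h2 : l = Q
      · subst h2; exact ⟨R, by simp, (mR x).2 (Or.inr hx)⟩
      exact ⟨l, by simp [h1, h2, hl], hx⟩
    · rintro ⟨l, hl, hx⟩
      simp only [Finset.mem_insert, Finset.mem_erase] at hl
      rcases hl with rfl | hl
      · rcases (mR x).1 hx with h | h
        · exact ⟨P, hP, h⟩
        · exact ⟨Q, hQ, h⟩
      · exact ⟨l, hl.2.2, hx⟩
  · rw [Finset.card_insert_of_notMem hRn, Finset.card_erase_add_one hQ',
      Finset.card_erase_add_one hP]
  · intro e
    have key : e ∈ eL R ↔ e ∈ eL P ∨ e ∈ eL Q ∨ e = s(u, v) := by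
      rw [lP, lQ, hR]; exact eL_append _ _ _ _ _
    constructor
    · rintro ⟨l, hl, hx⟩
      simp only [Finset.mem_insert, Finset.mem_erase] at hl
      rcases hl with rfl | hl
      · rcases key.1 hx with h | h | h
        · exact Or.inl ⟨P, hP, h⟩
        · exact Or.inl ⟨Q, hQ, h⟩
        · exact Or.inr h
      · exact Or.inl ⟨l, hl.2.2, hx⟩
    · rintro (⟨l, hl, hx⟩ | h)
      · by_cases h1 : l = P
        · subst h1; exact ⟨R, by simp, key.2 (Or.inl hx)⟩
        by_cases h2 : l = Q
        · subst h2; exact ⟨R, by simp, key.2 (Or.inr (Or.inl hx))⟩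
        exact ⟨l, by simp [h1, h2, hl], hx⟩
      · exact ⟨R, by simp, key.2 (Or.inr (Or.inr h))⟩
  · intro x
    unfold ec
    rw [Finset.sum_insert hRn]
    have h1 := Finset.add_sum_erase F (fun l => en l x) hP
    have h2 := Finset.add_sum_erase (F.erase P) (fun l => en l x) hQ'
    have h3 := enR x
    omega
  · intro T hT h1 h2
    refine ⟨by simp [hT, h1, h2], ?_⟩
    rintro h
    apply hRn
    rw [← h]
    simp [hT, h1, h2]

lemma Forest.add {S : Finset V} {F : Finset (List V)} (hF : Forest S F) {w : V} (hw : w ∉ S) :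
    Forest (insert w S) (insert [w] F) ∧ [w] ∉ F := by
  have hn : ∀ l ∈ F, w ∉ l := fun l hl h => hw ((hF.cov w).2 ⟨l, hl, h⟩)
  refine ⟨⟨?_, ?_, ?_, ?_⟩, fun h => hn _ h (by simp)⟩
  · intro l hl
    rcases Finset.mem_insert.1 hl with rfl | hl
    · simp
    · exact hF.ne l hl
  · intro l hl
    rcases Finset.mem_insert.1 hl with rfl | hl
    · simp
    · exact hF.nd l hl
  · intro l hl l' hl' x hx hx'
    rcases Finset.mem_insert.1 hl with rfl | kl <;>
      rcases Finset.mem_insert.1 hl' with rfl | kl'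
    · rfl
    · simp at hx; subst hx; exact absurd hx' (hn _ kl')
    · simp at hx'; subst hx'; exact absurd hx (hn _ kl)
    · exact hF.dj _ kl _ kl' x hx hx'
  · intro x
    simp [hF.cov x]

lemma en_single (w x : V) : en [w] x = if x = w then 2 else 0 := by
  unfold en
  by_cases h : x = w
  · simp [h]
  · simp [h, Ne.symm h]

lemma Forest.colourStep {S : Finset V} {F : Finset (List V)} (hF : Forest S F) {w : V} (hw : w ∉ S)
    (U : Finset V) (hU : U.card ≤ 2) (hUS : U ⊆ S) (g : V → List V)
    (hg : ∀ u ∈ U, g u ∈ F ∧ 0 < en (g u) u)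
    (hinj : ∀ u ∈ U, ∀ v ∈ U, g u = g v → u = v) :
    ∃ F', Forest (insert w S) F' ∧ F'.card + U.card = F.card + 1 ∧
      (∀ e, FE F' e ↔ FE F e ∨ ∃ u ∈ U, e = s(u, w)) ∧
      (∀ x ∈ S, ec F' x + (if x ∈ U then 1 else 0) = ec F x) ∧ ec F' w + U.card = 2 := by
  obtain ⟨h0, hwF⟩ := hF.add hw
  have hc0 : (insert [w] F).card = F.card + 1 := Finset.card_insert_of_notMem hwF
  have hE0 : ∀ e, FE (insert [w] F) e ↔ FE F e := by
    intro e; simp [FE, eL]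
  have hec0 : ∀ x, ec (insert [w] F) x = ec F x + if x = w then 2 else 0 := by
    intro x; unfold ec; rw [Finset.sum_insert hwF, en_single]; omega
  have hecw : ec F w = 0 := by
    unfold ec
    apply Finset.sum_eq_zero
    intro l hl
    by_contra h
    exact hw ((hF.cov w).2 ⟨l, hl, mem_of_en (Nat.pos_of_ne_zero h)⟩)
  have hSw : ∀ x ∈ S, x ≠ w := by rintro x hx rfl; exact hw hx
  have hcases : U.card = 0 ∨ U.card = 1 ∨ U.card = 2 := by omega
  rcases hcases with h | h | h
  · rw [Finset.card_eq_zero] at h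
    subst h
    refine ⟨_, h0, by simp [hc0], by simp [hE0], ?_, by simp [hec0, hecw]⟩
    intro x hx
    simp [hec0, hSw x hx]
  · obtain ⟨u, rfl⟩ := Finset.card_eq_one.1 h
    obtain ⟨hgu, hgu'⟩ := hg u (by simp)
    have hne : g u ≠ [w] := by intro h; exact hwF (h ▸ hgu)
    have huw : u ≠ w := hSw u (hUS (by simp))
    obtain ⟨F', R, k1, k2, k3, k4, k5, k6, k7⟩ := h0.join (P := g u) (Q := [w]) (u := u) (v := w)
      (by simp [hgu]) (by simp) hne hgu' (by simp [en_single])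
    refine ⟨F', k1, by simp; omega, by simp [k4, hE0], ?_, ?_⟩
    · intro x hx
      have := k5 x
      simp [hec0, hSw x hx] at this ⊢
      omega
    · have := k5 w
      simp [hec0, hecw, huw.symm] at this ⊢
      omega
  · obtain ⟨u, v, huv, rfl⟩ := Finset.card_eq_two.1 h
    obtain ⟨hgu, hgu'⟩ := hg u (by simp)
    obtain ⟨hgv, hgv'⟩ := hg v (by simp)
    have hne : g u ≠ [w] := by intro h; exact hwF (h ▸ hgu)
    have hnev : g v ≠ [w] := by intro h; exact hwF (h ▸ hgv)
    have hguv : g v ≠ g u := fun h => huv (hinj u (by simp) v (by simp) h.symm)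
    have huw : u ≠ w := hSw u (hUS (by simp))
    have hvw : v ≠ w := hSw v (hUS (by simp))
    obtain ⟨F', R, k1, k2, k3, k4, k5, k6, k7⟩ := h0.join (P := g u) (Q := [w]) (u := u) (v := w)
      (by simp [hgu]) (by simp) hne hgu' (by simp [en_single])
    obtain ⟨hv1, hv2⟩ := k6 (g v) (by simp [hgv]) hguv hnev
    have hRw : 0 < en R w := by
      have := k7 w
      simp [en_single, huw.symm] at this
      omega
    obtain ⟨F'', R', j1, j2, j3, j4, j5, j6, j7⟩ := k1.join hv1 k2 hv2 hgv' hRw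
    refine ⟨F'', j1, by omega, ?_, ?_, ?_⟩
    · intro e
      simp only [j4, k4, hE0, Finset.mem_insert, Finset.mem_singleton, exists_eq_or_imp,
        exists_eq_left]
      tauto
    · intro x hx
      have a1 := k5 x
      have a2 := j5 x
      simp only [hec0, hSw x hx, if_false, Finset.mem_insert, Finset.mem_singleton] at a1 a2 ⊢
      by_cases hxu : x = u
      · subst hxu; simp [huv] at a1 a2 ⊢; omega
      · simp [hxu] at a1 a2 ⊢; omega
    · have a1 := k5 w
      have a2 := j5 w
      simp [hec0, hecw, huw.symm, hvw.symm] at a1 a2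
      omega

lemma hallWeight {L R : Type*} [Fintype L] [Fintype R] [DecidableEq R] [DecidableEq L]
    (M : L → R → ℚ) (h0 : ∀ x y, 0 ≤ M x y) (hr : ∀ x, ∑ y, M x y = 1)
    (hc : ∀ y, ∑ x, M x y ≤ 1) : ∃ f : L → R, Function.Injective f ∧ ∀ x, 0 < M x (f x) := by
  classical
  obtain ⟨f, hf, hf'⟩ := (Finset.all_card_le_biUnion_card_iff_exists_injective
    (fun x : L => Finset.univ.filter (fun y => 0 < M x y))).1 (by
      intro X
      set N := X.biUnion (fun x : L => Finset.univ.filter (fun y => 0 < M x y)) with hN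
      have h1 : (X.card : ℚ) = ∑ x ∈ X, ∑ y ∈ N, M x y := by
        rw [Finset.card_eq_sum_ones, Nat.cast_sum]
        apply Finset.sum_congr rfl
        intro x hx
        rw [Nat.cast_one, ← hr x]
        symm
        apply Finset.sum_subset (Finset.subset_univ _)
        intro y _ hy
        by_contra hne
        apply hy
        rw [hN, Finset.mem_biUnion]
        exact ⟨x, hx, by simp [lt_of_le_of_ne (h0 x y) (Ne.symm hne)]⟩
      have h2 : ∑ x ∈ X, ∑ y ∈ N, M x y ≤ (N.card : ℚ) := by
        rw [Finset.sum_comm, Finset.card_eq_sum_ones, Nat.cast_sum]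
        apply Finset.sum_le_sum
        intro y _
        rw [Nat.cast_one]
        refine le_trans ?_ (hc y)
        exact Finset.sum_le_sum_of_subset_of_nonneg (Finset.subset_univ _) (fun x _ _ => h0 x y)
      rw [← h1] at h2
      exact_mod_cast h2)
  exact ⟨f, hf, fun x => by simpa using hf' x⟩

lemma matching {I : Type*} [Fintype I] [DecidableEq I] [Nonempty I] {S : Finset V}
    {F : I → Finset (List V)} (hF : ∀ i, Forest S (F i)) {q : ℕ} (hq : 2 ≤ q)
    (hI : 2 * Fintype.card I + 1 = S.card + q) (hc : ∀ i, (F i).card ≤ q)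
    (hs : ∀ v ∈ S, ∑ i, ec (F i) v = q) :
    ∃ (c : V → I) (g : V → List V), (∀ v ∈ S, g v ∈ F (c v) ∧ 0 < en (g v) v) ∧
      (∀ v ∈ S, ∀ v' ∈ S, c v = c v' → g v = g v' → v = v') ∧
      ∀ i, (S.filter (fun v => c v = i)).card ≤ 2 ∧
        (F i).card + 2 ≤ q + (S.filter (fun v => c v = i)).card := by
  classical
  have hq0 : (0 : ℚ) < q := by exact_mod_cast (by omega : 0 < q)
  have hq2 : (2 : ℚ) ≤ q := by exact_mod_cast hq
  have hq1 : (0 : ℚ) < (q : ℚ) - 1 := by linarith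
  have hqc : ((q - 1 : ℕ) : ℚ) = (q : ℚ) - 1 := by
    rw [Nat.cast_sub (by omega)]; simp
  let K := (i : I) × {l // l ∈ F i}
  let X : I → Bool → ℚ := fun i b =>
    if b then min (q : ℚ) (2 * (F i).card) else 2 * (F i).card - min (q : ℚ) (2 * (F i).card)
  have hcq : ∀ i, ((F i).card : ℚ) ≤ q := fun i => by exact_mod_cast hc i
  have hX0 : ∀ i b, 0 ≤ X i b := by
    intro i b
    cases b
    · simp [X]
    · simp [X]
  have hXq : ∀ i b, X i b ≤ q := by
    intro i b
    cases b
    · have := hcq i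
      simp only [X]
      simp
      rcases min_cases (q : ℚ) (2 * (F i).card) with h | h <;> linarith
    · simp [X]
  have hXs : ∀ i, X i true + X i false = 2 * (F i).card := by
    intro i; simp [X]
  have hXc : ∀ i b, ((F i).card : ℚ) * (X i b / (q * (F i).card)) = X i b / q := by
    intro i b
    by_cases h : (F i).card = 0
    · have : X i b = 0 := by cases b <;> simp [X, h, hq0.le]
      simp [this]
    · have : ((F i).card : ℚ) ≠ 0 := by exact_mod_cast h
      field_simp
  let M : ({v // v ∈ S} ⊕ (K ⊕ Fin (q - 1))) → (K ⊕ (I × Bool)) → ℚ := fun a b =>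
    match a, b with
    | Sum.inl v, Sum.inl P => (en P.2.1 v.1 : ℚ) / q
    | Sum.inl _, Sum.inr _ => 0
    | Sum.inr (Sum.inl P), Sum.inl P' => if P = P' then 1 - 2 / q else 0
    | Sum.inr (Sum.inl P), Sum.inr jb => if P.1 = jb.1 then X jb.1 jb.2 / (q * (F jb.1).card) else 0
    | Sum.inr (Sum.inr _), Sum.inl _ => 0
    | Sum.inr (Sum.inr _), Sum.inr jb => (1 - X jb.1 jb.2 / q) / (q - 1)
  have hsum : ∑ i, (2 * (F i).card : ℚ) = S.card * q := by
    have h1 : ∑ v ∈ S, ∑ i, ec (F i) v = S.card * q := by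
      rw [Finset.sum_congr rfl hs]; simp
    rw [Finset.sum_comm] at h1
    have h2 : ∀ i, ∑ v ∈ S, ec (F i) v = 2 * (F i).card := by
      intro i
      unfold ec
      rw [Finset.sum_comm, Finset.sum_congr rfl
        (fun l hl => sum_en ((hF i).ne l hl) (fun v hv => ((hF i).cov v).2 ⟨l, hl, hv⟩))]
      rw [Finset.sum_const, smul_eq_mul, mul_comm]
    simp only [h2] at h1
    exact_mod_cast h1
  have hM0 : ∀ a b, 0 ≤ M a b := by
    rintro (v | P | d) (P' | jb)
    · exact div_nonneg (Nat.cast_nonneg _) hq0.le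
    · exact le_rfl
    · simp only [M]
      split_ifs
      · rw [sub_nonneg, div_le_one hq0]; exact hq2
      · exact le_rfl
    · simp only [M]
      split_ifs
      · exact div_nonneg (hX0 _ _) (mul_nonneg hq0.le (Nat.cast_nonneg _))
      · exact le_rfl
    · exact le_rfl
    · simp only [M]
      apply div_nonneg _ hq1.le
      rw [sub_nonneg, div_le_one hq0]; exact hXq _ _
  have hMr : ∀ a, ∑ b, M a b = 1 := by
    rintro (v | P | d)
    · rw [Fintype.sum_sum_type]
      simp only [M, Finset.sum_const_zero, add_zero]
      rw [← Finset.sum_div, div_eq_one_iff_eq hq0.ne', Fintype.sum_sigma]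
      have := hs v.1 v.2
      rw [← this]
      push_cast
      apply Finset.sum_congr rfl
      intro i _
      unfold ec
      rw [Finset.univ_eq_attach]
      push_cast
      exact Finset.sum_attach (F i) (fun l => (en l v.1 : ℚ))
    · rw [Fintype.sum_sum_type]
      simp only [M]
      rw [Fintype.sum_prod_type]
      simp only [Fintype.sum_bool]
      rw [Finset.sum_ite_eq Finset.univ P]
      have : ∀ j : I, ((if P.1 = j then X j true / (q * (F j).card) else 0) +
          (if P.1 = j then X j false / (q * (F j).card) else 0)) = if P.1 = j then 2 / (q : ℚ) else 0 := by
        intro j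
        split_ifs with h
        · rw [← add_div, hXs]
          have : ((F j).card : ℚ) ≠ 0 := by
            subst h
            exact_mod_cast (Finset.card_pos.2 ⟨P.2.1, P.2.2⟩).ne'
          field_simp
        · simp
      simp only [this]
      simp
    · rw [Fintype.sum_sum_type]
      simp only [M, Finset.sum_const_zero, zero_add]
      rw [Fintype.sum_prod_type]
      simp only [Fintype.sum_bool]
      have : ∀ j : I, (1 - X j true / q) / ((q : ℚ) - 1) + (1 - X j false / q) / ((q : ℚ) - 1)
          = (2 - (2 * (F j).card : ℚ) / q) / ((q : ℚ) - 1) := by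
        intro j
        rw [← hXs j]; ring
      simp only [this]
      rw [← Finset.sum_div, Finset.sum_sub_distrib, ← Finset.sum_div, hsum, div_eq_one_iff_eq hq1.ne',
        mul_div_cancel_right₀ _ hq0.ne']
      simp
      have : (2 * Fintype.card I + 1 : ℚ) = S.card + q := by exact_mod_cast hI
      linarith
  have hMc : ∀ b, ∑ a, M a b = 1 := by
    rintro (P | jb)
    · rw [Fintype.sum_sum_type, Fintype.sum_sum_type]
      simp only [M, Finset.sum_const_zero, add_zero]
      rw [Finset.sum_ite_eq', ← Finset.sum_div, Finset.univ_eq_attach,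
        Finset.sum_attach S (fun v => (en P.2.1 v : ℚ))]
      have := sum_en ((hF P.1).ne P.2.1 P.2.2)
        (fun v hv => ((hF P.1).cov v).2 ⟨P.2.1, P.2.2, hv⟩)
      rw [← Nat.cast_sum, this]
      simp
    · rw [Fintype.sum_sum_type, Fintype.sum_sum_type]
      simp only [M, Finset.sum_const_zero, zero_add]
      rw [Fintype.sum_sigma]
      have : ∀ i : I, (∑ _y : {l // l ∈ F i}, if i = jb.1 then X jb.1 jb.2 / (q * (F jb.1).card) else 0)
          = if i = jb.1 then X jb.1 jb.2 / q else 0 := by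
        intro i
        rw [Finset.sum_const, Finset.card_univ, Fintype.card_coe, nsmul_eq_mul]
        split_ifs with h
        · rw [h, hXc]
        · simp
      simp only [this]
      rw [Finset.sum_const, Finset.card_univ, Fintype.card_fin, nsmul_eq_mul, hqc]
      rw [Finset.sum_ite_eq']
      simp only [Finset.mem_univ, if_true]
      field_simp
      ring
  obtain ⟨f, hfi, hfM⟩ := hallWeight M hM0 hMr (fun b => (hMc b).le)
  have hcard : Fintype.card ({v // v ∈ S} ⊕ (K ⊕ Fin (q - 1))) = Fintype.card (K ⊕ (I × Bool)) := by
    simp only [Fintype.card_sum, Fintype.card_prod, Fintype.card_fin, Fintype.card_bool,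
      Fintype.card_coe]
    omega
  have hfs : Function.Surjective f := ((Fintype.bijective_iff_injective_and_card f).2 ⟨hfi, hcard⟩).2
  have hv : ∀ v : {v // v ∈ S}, ∃ (P : K) (b : Bool), f (Sum.inl v) = Sum.inl P ∧ 0 < en P.2.1 v.1 ∧
      f (Sum.inr (Sum.inl P)) = Sum.inr (P.1, b) := by
    intro v
    have h1 := hfM (Sum.inl v)
    rcases h : f (Sum.inl v) with P | jb
    · rw [h] at h1
      simp only [M] at h1
      have h2 := hfM (Sum.inr (Sum.inl P))
      rcases h' : f (Sum.inr (Sum.inl P)) with P' | jb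
      · rw [h'] at h2
        simp only [M] at h2
        split_ifs at h2 with hPP
        · subst hPP
          rw [← h] at h'
          simpa using hfi h'
        · exact absurd h2 (lt_irrefl _)
      · rw [h'] at h2
        simp only [M] at h2
        split_ifs at h2 with hPP
        · refine ⟨P, jb.2, rfl, ?_, by rw [h', hPP]⟩
          by_contra h0
          have : en P.2.1 v.1 = 0 := by omega
          simp [this] at h1
        · exact absurd h2 (lt_irrefl _)
    · rw [h] at h1
      exact absurd h1 (lt_irrefl _)
  choose P b hP1 hP2 hP3 using hv
  have hPinj : ∀ v v', P v = P v' → v = v' := by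
    intro v v' h
    have := hP1 v
    rw [h, ← hP1 v'] at this
    simpa using hfi this
  have hbinj : ∀ v v', (P v).1 = (P v').1 → b v = b v' → v = v' := by
    intro v v' h h'
    have := hP3 v
    rw [h, h', ← hP3 v'] at this
    apply hPinj
    simpa using hfi this
  have hfull : ∀ i β, X i β = q → ∃ v, (P v).1 = i ∧ b v = β := by
    intro i β hX
    obtain ⟨a, ha⟩ := hfs (Sum.inr (i, β))
    have h1 := hfM a
    rw [ha] at h1
    rcases a with v | Q | d
    · exact absurd h1 (lt_irrefl _)
    · simp only [M] at h1
      split_ifs at h1 with hQ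
      · obtain ⟨a', ha'⟩ := hfs (Sum.inl Q)
        have h2 := hfM a'
        rw [ha'] at h2
        rcases a' with v | Q' | d
        · have h3 := hP1 v
          rw [ha'] at h3
          have h4 : Q = P v := by simpa using h3
          have h5 := hP3 v
          rw [← h4, ha] at h5
          simp at h5
          exact ⟨v, by rw [← h4]; exact hQ, h5.2.symm⟩
        · simp only [M] at h2
          split_ifs at h2 with hQ'
          · subst hQ'
            rw [ha] at ha'
            simp at ha'
          · exact absurd h2 (lt_irrefl _)
        · exact absurd h2 (lt_irrefl _)
      · exact absurd h1 (lt_irrefl _)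
    · simp only [M] at h1
      rw [hX, div_self hq0.ne'] at h1
      simp at h1
  refine ⟨fun v => if h : v ∈ S then (P ⟨v, h⟩).1 else Classical.arbitrary I,
    fun v => if h : v ∈ S then (P ⟨v, h⟩).2.1 else [], ?_, ?_, ?_⟩
  · intro v hv
    simp only [hv, dif_pos]
    exact ⟨(P ⟨v, hv⟩).2.2, hP2 ⟨v, hv⟩⟩
  · intro v hv v' hv'
    simp only [hv, hv', dif_pos]
    intro h1 h2
    have : P ⟨v, hv⟩ = P ⟨v', hv'⟩ := by
      apply Sigma.ext h1
      rw [Subtype.heq_iff_coe_eq]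
      · exact h2
      · intro x; rw [h1]
    simpa using hPinj _ _ this
  · intro i
    set U := S.filter (fun v => (if h : v ∈ S then (P ⟨v, h⟩).1 else Classical.arbitrary I) = i) with hU
    have hmem : ∀ v (h : v ∈ S), v ∈ U ↔ (P ⟨v, h⟩).1 = i := by
      intro v h; simp [hU, h]
    constructor
    · have : U.card ≤ (Finset.univ : Finset Bool).card := by
        apply Finset.card_le_card_of_injOn (fun v => if h : v ∈ S then b ⟨v, h⟩ else true)
        · intro x _; exact Finset.mem_coe.2 (Finset.mem_univ _)
        · intro v hv v' hv' hb
          have h1 : v ∈ S := (Finset.mem_filter.1 hv).1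
          have h2 : v' ∈ S := (Finset.mem_filter.1 hv').1
          simp only [h1, h2, dif_pos] at hb
          have := hbinj ⟨v, h1⟩ ⟨v', h2⟩
            (((hmem v h1).1 hv).trans ((hmem v' h2).1 hv').symm) hb
          simpa using this
      simpa using this
    · have hci := hc i
      by_cases h1 : (F i).card = q
      · obtain ⟨v, hv1, hv2⟩ := hfull i true (by simp only [X, h1, if_true]; rw [min_eq_left (by linarith)])
        obtain ⟨v', hv1', hv2'⟩ := hfull i false (by
          simp [X, h1]; rw [min_eq_left (by linarith)]; ring)
        have hne : v.1 ≠ v'.1 := by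
          intro h
          have : v = v' := Subtype.ext h
          rw [this, hv2'] at hv2
          simp at hv2
        have : ({v.1, v'.1} : Finset V).card ≤ U.card := by
          apply Finset.card_le_card
          intro x hx
          simp only [Finset.mem_insert, Finset.mem_singleton] at hx
          rcases hx with rfl | rfl
          · exact (hmem _ v.2).2 hv1
          · exact (hmem _ v'.2).2 hv1'
        rw [Finset.card_pair hne] at this
        omega
      by_cases h2 : (F i).card + 1 = q
      · obtain ⟨v, hv1, hv2⟩ := hfull i true (by
          have : (q : ℚ) = (F i).card + 1 := by exact_mod_cast h2.symm
          simp [X]; linarith)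
        have : 0 < U.card := Finset.card_pos.2 ⟨v.1, (hmem _ v.2).2 hv1⟩
        omega
      · omega

lemma Forest.mem_of_FE {S : Finset V} {F : Finset (List V)} (hF : Forest S F) {u v : V}
    (h : FE F s(u, v)) : u ∈ S ∧ v ∈ S := by
  obtain ⟨l, hl, h⟩ := h
  have := mem_of_eL l u v h
  exact ⟨(hF.cov u).2 ⟨l, hl, this.1⟩, (hF.cov v).2 ⟨l, hl, this.2⟩⟩

structure St {I : Type*} [Fintype I] (n : ℕ) (x y : I → V) (S : Finset V)
    (F : I → Finset (List V)) : Prop where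
  fo : ∀ i, Forest S (F i)
  cd : ∀ i, (F i).card + S.card ≤ n
  sl : ∀ v ∈ S, ∑ i, ec (F i) v + S.card = n
  ed : ∀ u ∈ S, ∀ v ∈ S, u ≠ v → ∃! i, FE (F i) s(u, v)
  xy : ∀ i, FE (F i) s(x i, y i)

lemma St.step {I : Type*} [Fintype I] [DecidableEq I] [Nonempty I] {n : ℕ} {x y : I → V}
    {S : Finset V} {F : I → Finset (List V)} (h : St n x y S F)
    (hn : 2 * Fintype.card I + 1 = n) (hS : S.card + 2 ≤ n) {w : V} (hw : w ∉ S) :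
    ∃ F', St n x y (insert w S) F' := by
  obtain ⟨c, g, hg, hinj, hcnt⟩ := matching (q := n - S.card) h.fo (by omega) (by omega)
    (fun i => by have := h.cd i; omega) (fun v hv => by have := h.sl v hv; omega)
  have key := fun i => (h.fo i).colourStep hw (S.filter (fun v => c v = i)) (hcnt i).1
    (Finset.filter_subset _ _) g
    (by
      intro u hu
      obtain ⟨h1, h2⟩ := Finset.mem_filter.1 hu
      have := hg u h1
      rwa [h2] at this)
    (by
      intro u hu v hv
      obtain ⟨h1, h2⟩ := Finset.mem_filter.1 hu
      obtain ⟨h3, h4⟩ := Finset.mem_filter.1 hv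
      exact hinj u h1 v h3 (h2.trans h4.symm))
  choose F' k1 k2 k3 k4 k5 using key
  have hins : (insert w S).card = S.card + 1 := Finset.card_insert_of_notMem hw
  have huw : ∀ u ∈ S, u ≠ w := by rintro u hu rfl; exact hw hu
  have hedw : ∀ u ∈ S, ∃! i, FE (F' i) s(u, w) := by
    intro u hu
    have : ∀ i, FE (F' i) s(u, w) ↔ c u = i := by
      intro i
      rw [k3]
      constructor
      · rintro (h1 | ⟨u', h1, h2⟩)
        · exact absurd ((h.fo i).mem_of_FE h1).2 hw
        · rw [Sym2.eq_iff] at h2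
          rcases h2 with ⟨rfl, _⟩ | ⟨h2, _⟩
          · exact (Finset.mem_filter.1 h1).2
          · exact absurd h2 (huw u hu)
      · intro h1
        exact Or.inr ⟨u, Finset.mem_filter.2 ⟨hu, h1⟩, rfl⟩
    simp only [this]
    exact ⟨c u, rfl, fun y hy => hy.symm⟩
  refine ⟨F', k1, ?_, ?_, ?_, fun i => (k3 i _).2 (Or.inl (h.xy i))⟩
  · intro i
    have h1 := k2 i
    have h2 := (hcnt i).2
    omega
  · intro v hv
    rcases Finset.mem_insert.1 hv with rfl | hv
    · have h1 : ∑ i, (ec (F' i) v + (S.filter (fun u => c u = i)).card) = ∑ _i : I, 2 :=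
        Finset.sum_congr rfl (fun i _ => k5 i)
      rw [Finset.sum_add_distrib, ← Finset.card_eq_sum_card_fiberwise
        (fun x _ => Finset.mem_coe.2 (Finset.mem_univ (c x)))] at h1
      simp at h1
      omega
    · have h1 : ∑ i, (ec (F' i) v + (if v ∈ S.filter (fun u => c u = i) then 1 else 0))
          = ∑ i, ec (F i) v := Finset.sum_congr rfl (fun i _ => k4 i v hv)
      rw [Finset.sum_add_distrib] at h1
      simp [hv] at h1
      have := h.sl v hv
      omega
  · intro u hu v hv huv
    replace hu := Finset.mem_insert.1 hu
    replace hv := Finset.mem_insert.1 hv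
    rcases hu with rfl | hu <;> rcases hv with rfl | hv
    · exact absurd rfl huv
    · rw [Sym2.eq_swap]; exact hedw v hv
    · exact hedw u hu
    · have : ∀ i, FE (F' i) s(u, v) ↔ FE (F i) s(u, v) := by
        intro i
        rw [k3]
        constructor
        · rintro (h1 | ⟨u', h1, h2⟩)
          · exact h1
          · rw [Sym2.eq_iff] at h2
            rcases h2 with ⟨_, h2⟩ | ⟨h2, _⟩
            · exact absurd h2 (huw v hv)
            · exact absurd h2 (huw u hu)
        · exact Or.inl
      simp only [this]
      exact h.ed u hu v hv huv

lemma St.run [Fintype V] {I : Type*} [Fintype I] [DecidableEq I] [Nonempty I] {x y : I → V}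
    (hn : 2 * Fintype.card I + 1 = Fintype.card V) (k : ℕ) :
    ∀ {S : Finset V} {F : I → Finset (List V)}, St (Fintype.card V) x y S F →
      S.card + 1 + k = Fintype.card V →
      ∃ S' F', St (Fintype.card V) x y S' F' ∧ S'.card + 1 = Fintype.card V ∧ S ⊆ S' := by
  induction k with
  | zero => intro S F h hk; exact ⟨S, F, h, by omega, subset_rfl⟩
  | succ k ih =>
    intro S F h hk
    obtain ⟨w, hw⟩ : ∃ w, w ∉ S := by
      by_contra! hh
      have := Finset.card_eq_iff_eq_univ S |>.2 (by ext; simp [hh])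
      omega
    obtain ⟨F', h'⟩ := h.step hn (by omega) hw
    obtain ⟨S', F'', a1, a2, a3⟩ := ih h' (by rw [Finset.card_insert_of_notMem hw]; omega)
    exact ⟨S', F'', a1, a2, (Finset.subset_insert _ _).trans a3⟩

lemma eL_split (l : List V) (x y : V) (h : s(x, y) ∈ eL l) :
    ∃ p r, l = p ++ [x] ++ (y :: r) ∨ l = p ++ [y] ++ (x :: r) := by
  induction l with
  | nil => simp [eL] at h
  | cons a l ih =>
    cases l with
    | nil => simp [eL] at h
    | cons b l =>
      simp only [eL, List.mem_cons] at h
      rcases h with h | h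
      · rw [Sym2.eq_iff] at h
        rcases h with ⟨rfl, rfl⟩ | ⟨rfl, rfl⟩
        · exact ⟨[], l, Or.inl (by simp)⟩
        · exact ⟨[], l, Or.inr (by simp)⟩
      · obtain ⟨p, r, h1 | h1⟩ := ih h
        · exact ⟨a :: p, r, Or.inl (by simp [h1])⟩
        · exact ⟨a :: p, r, Or.inr (by simp [h1])⟩

lemma close_aux (p r : List V) (x y w : V) (hl : (p ++ [x] ++ (y :: r)).Nodup)
    (hw : w ∉ p ++ [x] ++ (y :: r)) :
    ∃ l' : List V, l'.Nodup ∧ (∀ v, v ∈ l' ↔ v ∈ p ++ [x] ++ (y :: r) ∨ v = w) ∧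
      ∀ e, e ∈ eL l' ↔ (e ∈ eL (p ++ [x] ++ (y :: r)) ∧ e ≠ s(x, y)) ∨
        ∃ u, 0 < en (p ++ [x] ++ (y :: r)) u ∧ e = s(u, w) := by
  have hen : ∀ u, 0 < en (p ++ [x] ++ (y :: r)) u ↔
      (p ++ [x]).head? = some u ∨ (y :: r).getLast? = some u := by
    intro u
    have h1 : (p ++ [x] ++ (y :: r)).head? = (p ++ [x]).head? := by
      cases p <;> simp
    have h2 : (p ++ [x] ++ (y :: r)).getLast? = (y :: r).getLast? := by
      rw [List.getLast?_append]; simp [List.getLast?_cons]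
    unfold en
    rw [h1, h2]
    split_ifs <;> simp_all
  refine ⟨(y :: r) ++ (w :: (p ++ [x])), ?_, ?_, ?_⟩
  · simp only [List.nodup_append, List.nodup_cons, List.mem_append, List.mem_cons,
      List.mem_singleton] at *
    grind
  · intro v
    simp only [List.mem_append, List.mem_cons, List.mem_singleton]
    tauto
  · intro e
    have hx : x ∉ y :: r := by
      rw [List.nodup_append] at hl
      intro hh
      exact hl.2.2 x (by simp) x hh rfl
    have hy : y ∉ p ++ [x] := by
      rw [List.nodup_append] at hl
      intro hh
      exact hl.2.2 y hh y (by simp) rfl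
    have hex : e ∈ eL (y :: r) → e ≠ s(x, y) := by
      rintro h rfl; exact hx (mem_of_eL _ _ _ h).1
    have hey : e ∈ eL (p ++ [x]) → e ≠ s(x, y) := by
      rintro h rfl; exact hy (mem_of_eL _ _ _ h).2
    rw [eL_append]
    simp only [hen]
    obtain ⟨R, z, hR⟩ : ∃ R z, y :: r = R ++ [z] :=
      ⟨_, _, (List.dropLast_append_getLast (List.cons_ne_nil y r)).symm⟩
    obtain ⟨b, T, hT⟩ : ∃ b T, p ++ [x] = b :: T := by
      cases p with
      | nil => exact ⟨x, [], rfl⟩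
      | cons b p => exact ⟨b, p ++ [x], rfl⟩
    rw [hR] at hex ⊢
    rw [hT] at hey ⊢
    rw [eL_append]
    simp only [eL, List.mem_cons, List.head?_cons, List.getLast?_append, List.getLast?_singleton,
      Option.some_or, Option.some.injEq]
    constructor
    · rintro (h | (h | h) | h)
      · exact Or.inl ⟨Or.inr (Or.inl h), hex h⟩
      · exact Or.inr ⟨b, Or.inl rfl, by rw [h, Sym2.eq_swap]⟩
      · exact Or.inl ⟨Or.inl h, hey h⟩
      · exact Or.inr ⟨z, Or.inr rfl, h⟩
    · rintro (⟨h | h | h, h'⟩ | ⟨u, rfl | rfl, h⟩)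
      · exact Or.inr (Or.inl (Or.inr h))
      · exact Or.inl h
      · exact absurd h h'
      · exact Or.inr (Or.inl (Or.inl (by rw [h, Sym2.eq_swap])))
      · exact Or.inr (Or.inr h)

lemma close_path (l : List V) (x y w : V) (hl : l.Nodup) (hxy : s(x, y) ∈ eL l) (hw : w ∉ l) :
    ∃ l' : List V, l'.Nodup ∧ (∀ v, v ∈ l' ↔ v ∈ l ∨ v = w) ∧
      ∀ e, e ∈ eL l' ↔ (e ∈ eL l ∧ e ≠ s(x, y)) ∨ ∃ u, 0 < en l u ∧ e = s(u, w) := by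
  obtain ⟨p, r, rfl | rfl⟩ := eL_split l x y hxy
  · exact close_aux p r x y w hl hw
  · rw [Sym2.eq_swap (a := x)]; exact close_aux p r y x w hl hw

lemma init_state [Fintype V] {I : Type*} [Fintype I] {x y : I → V} {A : Finset V}
    (hn : 2 * Fintype.card I + 1 = Fintype.card V) (hA : 2 ≤ A.card)
    (hA' : Fintype.card V = A.card * (A.card - 1) + 1)
    (hx : ∀ i, x i ∈ A) (hy : ∀ i, y i ∈ A) (hxy : ∀ i, x i ≠ y i)
    (hp : ∀ u ∈ A, ∀ v ∈ A, u ≠ v → ∃! i, s(u, v) = s(x i, y i)) :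
    ∃ F, St (Fintype.card V) x y A F := by
  classical
  set F0 : Finset (List V) := A.image (fun z => [z]) with hF0
  have f0 : Forest A F0 := by
    refine ⟨?_, ?_, ?_, ?_⟩
    · intro l hl; obtain ⟨z, hz, rfl⟩ := Finset.mem_image.1 hl; simp
    · intro l hl; obtain ⟨z, hz, rfl⟩ := Finset.mem_image.1 hl; simp
    · intro l hl l' hl' v hv hv'
      obtain ⟨z, hz, rfl⟩ := Finset.mem_image.1 hl
      obtain ⟨z', hz', rfl⟩ := Finset.mem_image.1 hl'
      simp at hv hv'
      rw [← hv, ← hv']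
    · intro v; simp [hF0]
  have hinj : Function.Injective (fun z : V => [z]) := fun a b h => by simpa using h
  have c0 : F0.card = A.card := Finset.card_image_of_injective _ hinj
  have e0 : ∀ v ∈ A, ec F0 v = 2 := by
    intro v hv
    unfold ec
    rw [hF0, Finset.sum_image (fun a _ b _ h => hinj h)]
    simp [en_single, hv]
  have E0 : ∀ e, ¬ FE F0 e := by
    rintro e ⟨l, hl, h⟩
    obtain ⟨z, hz, rfl⟩ := Finset.mem_image.1 hl
    simp [eL] at h
  have key := fun i => f0.join (P := [x i]) (Q := [y i]) (u := x i) (v := y i)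
    (Finset.mem_image_of_mem _ (hx i)) (Finset.mem_image_of_mem _ (hy i))
    (by simpa using hxy i) (by simp [en_single]) (by simp [en_single])
  choose F R k1 k2 k3 k4 k5 k6 k7 using key
  have k4' : ∀ i e, FE (F i) e ↔ e = s(x i, y i) := by
    intro i e; rw [k4]; simp [E0]
  obtain ⟨a, ha⟩ : ∃ a, A.card = a + 2 := ⟨A.card - 2, by omega⟩
  rw [ha] at hA'
  have hA2 : a + 2 - 1 = a + 1 := rfl
  rw [hA2] at hA'
  refine ⟨F, k1, ?_, ?_, ?_, fun i => (k4' i _).2 rfl⟩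
  · intro i
    have := k3 i
    rw [hA']
    have h3 : (F i).card = a + 1 := by omega
    rw [h3, ha]
    nlinarith
  · intro v hv
    have h1 : ∑ i, (ec (F i) v + ((if v = x i then 1 else 0) + (if v = y i then 1 else 0)))
        = ∑ _i : I, 2 := by
      apply Finset.sum_congr rfl
      intro i _
      have := k5 i v
      rw [e0 v hv] at this
      omega
    have h2 : ∑ i, ((if v = x i then 1 else 0) + (if v = y i then 1 else 0)) = A.card - 1 := by
      rw [← Finset.card_erase_of_mem hv, Finset.card_eq_sum_ones]
      have h3 : ∀ u ∈ A.erase v, (1 : ℕ) = ∑ i, if s(u, v) = s(x i, y i) then 1 else 0 := by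
        intro u hu
        obtain ⟨hu1, hu2⟩ := Finset.mem_erase.1 hu
        obtain ⟨i, hi, hi'⟩ := hp u hu2 v hv hu1
        rw [Finset.sum_eq_single i]
        · simp [hi]
        · intro j _ hj
          rw [if_neg]
          exact fun h => hj (hi' j h)
        · simp
      rw [Finset.sum_congr rfl h3, Finset.sum_comm]
      apply Finset.sum_congr rfl
      intro i _
      have hxyi := hxy i
      by_cases hvx : v = x i
      · have hvy : v ≠ y i := by rw [hvx]; exact hxyi
        rw [if_pos hvx, if_neg hvy, Finset.sum_eq_single (y i)]
        · rw [if_pos]; rw [hvx, Sym2.eq_swap]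
        · intro u _ hu
          rw [if_neg]
          rw [Sym2.eq_iff]
          tauto
        · intro h
          exact absurd (Finset.mem_erase.2 ⟨hvy.symm, hy i⟩) h
      · by_cases hvy : v = y i
        · rw [if_neg hvx, if_pos hvy, Finset.sum_eq_single (x i)]
          · rw [if_pos]; rw [hvy]
          · intro u _ hu
            rw [if_neg]
            rw [Sym2.eq_iff]
            tauto
          · intro h
            exact absurd (Finset.mem_erase.2 ⟨fun h => hvx h.symm, hx i⟩) h
        · rw [if_neg hvx, if_neg hvy]
          symm
          apply Finset.sum_eq_zero
          intro u _
          rw [if_neg]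
          rw [Sym2.eq_iff]
          tauto
    rw [Finset.sum_add_distrib, h2] at h1
    simp at h1
    have h4 : Fintype.card I * 2 = (a + 2) * (a + 1) := by omega
    rw [ha] at h1 ⊢
    rw [hA']
    have : a + 2 - 1 = a + 1 := rfl
    rw [this] at h1
    omega
  · intro u hu v hv huv
    simp only [k4']
    exact hp u hu v hv huv

theorem path_lists [Fintype V] {I : Type*} [Fintype I] [DecidableEq I] [Nonempty I]
    {x y : I → V} {A : Finset V}
    (hn : 2 * Fintype.card I + 1 = Fintype.card V) (hA : 2 ≤ A.card)
    (hA' : Fintype.card V = A.card * (A.card - 1) + 1)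
    (hx : ∀ i, x i ∈ A) (hy : ∀ i, y i ∈ A) (hxy : ∀ i, x i ≠ y i)
    (hp : ∀ u ∈ A, ∀ v ∈ A, u ≠ v → ∃! i, s(u, v) = s(x i, y i)) :
    ∃ L : I → List V, (∀ i, (L i).Nodup ∧ ∀ v, v ∈ L i) ∧
      (∀ i u v, s(u, v) ∈ eL (L i) → u ≠ v ∧ ¬ (u ∈ A ∧ v ∈ A)) ∧
      (∀ u v, u ≠ v → ¬ (u ∈ A ∧ v ∈ A) → ∃! i, s(u, v) ∈ eL (L i)) := by
  obtain ⟨F0, h0⟩ := init_state hn hA hA' hx hy hxy hp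
  obtain ⟨k, hk⟩ : ∃ k, A.card + 1 + k = Fintype.card V := by
    refine ⟨Fintype.card V - (A.card + 1), ?_⟩
    obtain ⟨a, ha⟩ : ∃ a, A.card = a + 2 := ⟨A.card - 2, by omega⟩
    have : A.card + 1 ≤ Fintype.card V := by
      rw [hA', ha]
      have hA2 : a + 2 - 1 = a + 1 := rfl
      rw [hA2]; nlinarith
    omega
  obtain ⟨S, F, h, hS, hAS⟩ := St.run hn k h0 hk
  obtain ⟨w, hw⟩ : ∃ w, Sᶜ = {w} := by
    rw [← Finset.card_eq_one, Finset.card_compl]; omega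
  have hwS : w ∉ S := by
    rw [← Finset.mem_compl, hw]; simp
  have hwS' : ∀ v, v ∈ S ∨ v = w := by
    intro v
    by_cases hv : v ∈ S
    · exact Or.inl hv
    · rw [← Finset.mem_compl, hw] at hv; right; simpa using hv
  have hl : ∀ i, ∃ l, F i = {l} := by
    intro i
    rw [← Finset.card_eq_one]
    have h1 := h.cd i
    have h2 : 0 < (F i).card := by
      obtain ⟨l, hl, _⟩ := h.xy i
      exact Finset.card_pos.2 ⟨l, hl⟩
    omega
  choose l hl using hl
  have hFE : ∀ i e, FE (F i) e ↔ e ∈ eL (l i) := by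
    intro i e; simp [FE, hl]
  have hec : ∀ i v, ec (F i) v = en (l i) v := by
    intro i v; simp [ec, hl]
  have hmem : ∀ i v, v ∈ l i ↔ v ∈ S := by
    intro i v; rw [(h.fo i).cov v]; simp [hl]
  have hnd : ∀ i, (l i).Nodup := fun i => (h.fo i).nd _ (by simp [hl])
  have key := fun i => close_path (l i) (x i) (y i) w (hnd i) ((hFE i _).1 (h.xy i))
    (by rw [hmem]; exact hwS)
  choose L k1 k2 k3 using key
  have hedw : ∀ u ∈ S, ∃! i, s(u, w) ∈ eL (L i) := by
    intro u hu
    have hiff : ∀ i, s(u, w) ∈ eL (L i) ↔ 0 < en (l i) u := by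
      intro i
      rw [k3]
      constructor
      · rintro (⟨h1, _⟩ | ⟨u', h1, h2⟩)
        · exact absurd ((hmem i w).1 (mem_of_eL _ _ _ h1).2) hwS
        · rw [Sym2.eq_iff] at h2
          rcases h2 with ⟨rfl, _⟩ | ⟨h2, _⟩
          · exact h1
          · rw [h2] at hu; exact absurd hu hwS
      · intro h1
        exact Or.inr ⟨u, h1, rfl⟩
    simp only [hiff]
    have h1 := h.sl u hu
    simp only [hec] at h1
    have h2 : ∑ i, en (l i) u = 1 := by omega
    obtain ⟨i, hi⟩ : ∃ i, 0 < en (l i) u := by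
      by_contra! hh
      rw [Finset.sum_eq_zero (fun i _ => by have := hh i; omega)] at h2
      omega
    refine ⟨i, hi, fun j hj => ?_⟩
    by_contra hij
    have h3 : ∑ k ∈ ({i, j} : Finset I), en (l k) u ≤ ∑ k, en (l k) u :=
      Finset.sum_le_sum_of_subset (Finset.subset_univ _)
    rw [Finset.sum_pair (fun h => hij h.symm)] at h3
    simp only at hj
    omega
  refine ⟨L, fun i => ⟨k1 i, fun v => (k2 i v).2 (by rw [hmem]; exact hwS' v)⟩, ?_, ?_⟩
  · intro i u v huv
    have hne := eL_ne _ (k1 i) u v huv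
    refine ⟨hne, ?_⟩
    rintro ⟨hu, hv⟩
    rcases (k3 i _).1 huv with ⟨h1, h2⟩ | ⟨u', h1, h2⟩
    · obtain ⟨j, hj, _⟩ := hp u hu v hv hne
      obtain ⟨j', _, hj'⟩ := h.ed u (hAS hu) v (hAS hv) hne
      have e1 := hj' i ((hFE i _).2 h1)
      have e2 := hj' j (by rw [hj]; exact h.xy j)
      rw [e1, ← e2] at h2
      exact h2 hj
    · rw [Sym2.eq_iff] at h2
      rcases h2 with ⟨_, rfl⟩ | ⟨rfl, _⟩
      · exact hwS (hAS hv)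
      · exact hwS (hAS hu)
  · intro u v huv hnA
    rcases hwS' u with hu | rfl
    · rcases hwS' v with hv | rfl
      · have hiff : ∀ i, s(u, v) ∈ eL (L i) ↔ FE (F i) s(u, v) := by
          intro i
          rw [k3, hFE]
          constructor
          · rintro (⟨h1, _⟩ | ⟨u', h1, h2⟩)
            · exact h1
            · rw [Sym2.eq_iff] at h2
              rcases h2 with ⟨_, rfl⟩ | ⟨rfl, _⟩
              · exact absurd hv hwS
              · exact absurd hu hwS
          · intro h1
            refine Or.inl ⟨h1, fun h2 => hnA ?_⟩
            rw [Sym2.eq_iff] at h2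
            rcases h2 with ⟨rfl, rfl⟩ | ⟨rfl, rfl⟩
            · exact ⟨hx i, hy i⟩
            · exact ⟨hy i, hx i⟩
        simp only [hiff]
        exact h.ed u hu v hv huv
      · exact hedw u hu
    · rw [Sym2.eq_swap]
      rcases hwS' v with hv | rfl
      · exact hedw v hv
      · exact absurd rfl huv

lemma exists_pairs (A : Finset V) (t : ℕ) (ht : A.card * (A.card - 1) / 2 = t) :
    ∃ x y : Fin t → V, (∀ i, x i ∈ A) ∧ (∀ i, y i ∈ A) ∧ (∀ i, x i ≠ y i) ∧
      ∀ u ∈ A, ∀ v ∈ A, u ≠ v → ∃! i, s(u, v) = s(x i, y i) := by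
  have hc : Fintype.card {p // p ∈ A.powersetCard 2} = t := by
    rw [Fintype.card_coe, Finset.card_powersetCard, Nat.choose_two_right, ht]
  let e : {p // p ∈ A.powersetCard 2} ≃ Fin t := Fintype.equivFinOfCardEq hc
  have h : ∀ i : Fin t, ∃ x y, x ≠ y ∧ (e.symm i).1 = {x, y} ∧ x ∈ A ∧ y ∈ A := by
    intro i
    obtain ⟨h1, h2⟩ := Finset.mem_powersetCard.1 (e.symm i).2
    obtain ⟨x, y, hxy, h3⟩ := Finset.card_eq_two.1 h2
    exact ⟨x, y, hxy, h3, h1 (by simp [h3]), h1 (by simp [h3])⟩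
  choose x y h1 h2 h3 h4 using h
  refine ⟨x, y, h3, h4, h1, ?_⟩
  intro u hu v hv huv
  have hm : ({u, v} : Finset V) ∈ A.powersetCard 2 := by
    rw [Finset.mem_powersetCard]
    refine ⟨?_, Finset.card_pair huv⟩
    intro z hz
    simp only [Finset.mem_insert, Finset.mem_singleton] at hz
    rcases hz with rfl | rfl <;> assumption
  have hiff : ∀ i, s(u, v) = s(x i, y i) ↔ i = e ⟨_, hm⟩ := by
    intro i
    rw [← Equiv.symm_apply_eq, Subtype.ext_iff, h2]
    constructor
    · intro h
      rw [Sym2.eq_iff] at h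
      rcases h with ⟨rfl, rfl⟩ | ⟨rfl, rfl⟩
      · rfl
      · exact Finset.pair_comm _ _
    · intro h
      change ({x i, y i} : Finset V) = {u, v} at h
      have hx : x i ∈ ({u, v} : Finset V) := by rw [← h]; simp
      have hy : y i ∈ ({u, v} : Finset V) := by rw [← h]; simp
      simp only [Finset.mem_insert, Finset.mem_singleton] at hx hy
      have := h1 i
      rw [Sym2.eq_iff]
      rcases hx with hx | hx <;> rcases hy with hy | hy
      · exact absurd (hx.trans hy.symm) this
      · exact Or.inl ⟨hx.symm, hy.symm⟩
      · exact Or.inr ⟨hy.symm, hx.symm⟩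
      · exact absurd (hx.trans hy.symm) this
  simp only [hiff]
  exact ⟨_, rfl, fun _ h => h⟩

lemma isChain_of_eL (G : SimpleGraph V) (l : List V)
    (h : ∀ u v, s(u, v) ∈ eL l → G.Adj u v) : l.IsChain G.Adj := by
  induction l with
  | nil => simp
  | cons a l ih =>
    cases l with
    | nil => simp
    | cons b l =>
      rw [List.isChain_cons_cons]
      exact ⟨h a b (by simp [eL]), ih (fun u v huv => h u v (by simp [eL, huv]))⟩

lemma edges_eq_eL {G : SimpleGraph V} {u v : V} (p : G.Walk u v) : p.edges = eL p.support := by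
  induction p with
  | nil => simp [eL]
  | cons hd p ih =>
    rw [Walk.edges_cons, Walk.support_cons, ih]
    cases p with
    | nil => simp [eL]
    | cons h2 p => simp [eL]

end HD

/-- `K_{1^{(a-1)^2},a}` decomposes into `a(a-1)/2` Hamilton paths, for `a ≥ 2`. -/
theorem hamiltonianPathDecomposition_K_one_pow_aSubOneSq_a
    (a : ℕ) (ha : 2 ≤ a) :
    (completeMultipartiteGraph
      (fun i : Fin ((a - 1) ^ 2 + 1) =>
        Fin (if i = 0 then a else 1))).HamiltonianPathDecomposition
      (a * (a - 1) / 2) := by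
  classical
  set f : Fin ((a - 1) ^ 2 + 1) → Type := fun i => Fin (if i = 0 then a else 1) with hf
  set A : Finset ((i : Fin ((a - 1) ^ 2 + 1)) × f i) := Finset.univ.filter (fun v => v.1 = 0) with hA
  have hVcard : Fintype.card ((i : Fin ((a - 1) ^ 2 + 1)) × f i) = a * (a - 1) + 1 := by
    rw [Fintype.card_sigma]
    simp only [hf, Fintype.card_fin]
    rw [Fin.sum_univ_succ]
    simp only [if_true, Fin.succ_ne_zero, if_false]
    simp
    obtain ⟨b, rfl⟩ : ∃ b, a = b + 1 := ⟨a - 1, by omega⟩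
    simp
    ring
  have hAcard : A.card = a := by
    rw [← Fintype.card_subtype]
    have : Fintype.card {v : (i : Fin ((a - 1) ^ 2 + 1)) × f i // v.1 = 0} = Fintype.card (f 0) := by
      apply Fintype.card_congr
      exact Equiv.sigmaSubtype 0
    rw [this]
    simp [hf]
  have hpar : 2 * (a * (a - 1) / 2) = a * (a - 1) := by
    apply Nat.mul_div_cancel'
    rw [mul_comm]
    have := Nat.even_mul_succ_self (a - 1)
    rw [Nat.sub_add_cancel (by omega)] at this
    exact this.two_dvd
  have htpos : 0 < a * (a - 1) / 2 := by
    have : 0 < a * (a - 1) := Nat.mul_pos (by omega) (by omega)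
    omega
  haveI : Nonempty (Fin (a * (a - 1) / 2)) := ⟨⟨0, htpos⟩⟩
  obtain ⟨x, y, hx, hy, hxy, hp⟩ := exists_pairs A (a * (a - 1) / 2) (by rw [hAcard])
  obtain ⟨L, h1, h2, h3⟩ := path_lists (by rw [hVcard, Fintype.card_fin, hpar]) (by omega)
    (by rw [hVcard, hAcard]) hx hy hxy hp
  have hadj : ∀ u v, (completeMultipartiteGraph f).Adj u v ↔ u ≠ v ∧ ¬ (u ∈ A ∧ v ∈ A) := by
    rintro ⟨i, u⟩ ⟨j, v⟩
    simp only [completeMultipartiteGraph, SimpleGraph.comap_adj, SimpleGraph.top_adj, hA,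
      Finset.mem_filter, Finset.mem_univ, true_and]
    constructor
    · intro h
      refine ⟨fun h' => h (congrArg Sigma.fst h'), ?_⟩
      rintro ⟨rfl, rfl⟩
      exact h rfl
    · rintro ⟨h, h'⟩ rfl
      have hi : i ≠ 0 := fun hi => h' ⟨hi, hi⟩
      apply h
      have : Subsingleton (f i) := by
        simp only [hf, if_neg hi]; infer_instance
      rw [Subsingleton.elim u v]
  have hne : ∀ i, L i ≠ [] := fun i hi => by
    have := (h1 i).2 (x i)
    rw [hi] at this
    simp at this
  have hch : ∀ i, (L i).IsChain (completeMultipartiteGraph f).Adj := fun i =>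
    isChain_of_eL _ _ (fun u v huv => (hadj u v).2 (h2 i u v huv))
  refine ⟨_, _, fun i => Walk.ofSupport (L i) (hne i) (hch i), ?_, ?_⟩
  · intro i v
    rw [Walk.support_ofSupport]
    convert List.count_eq_one_of_mem (h1 i).1 ((h1 i).2 v)
  · intro e
    induction e using Sym2.ind with
    | _ u v =>
      intro he
      rw [SimpleGraph.mem_edgeSet, hadj] at he
      simp only [edges_eq_eL, Walk.support_ofSupport]
      exact h3 u v he.1 he.2
end
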